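/- arXiv:2207.12778 — 2 statements merged into one kernel-verified Lean document; each statement's English description precedes it below -/
import Mathlib

section
/- Let X be an absolutely TzS-closed semigroup and A ⊆ VE(X). Then the following are equivalent: (1) the set Z(X) ∩ √A is bounded in X; (2) the set Z(X) ∩ H(X) ∩ √A is bounded in X; (3) X is B-centrobounded over every countably infinite antichain B ⊆ A (an antichain in the order e ≤ f ⇔ ef = fe = e). -/
universe u

open Set TopologicalSpace

/-- A topological space is zero-dimensional: it has a base of clopen sets. -/
def HasClopenBasis (Y : Type*) [TopologicalSpace Y] : Prop :=
  ∃ B : Set (Set Y), (∀ s ∈ B, IsClopen s) ∧ IsTopologicalBasis B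

section TopClasses

variable (X : Type u) [Semigroup X]

/-- `X` is absolutely `T₁S`-closed: the image of every homomorphism to a `T₁`
topological semigroup is closed. -/
def AbsolutelyT1SClosed : Prop :=
  ∀ (Y : Type u) [Semigroup Y] [TopologicalSpace Y] [ContinuousMul Y] [T1Space Y]
    (h : X →ₙ* Y), IsClosed (Set.range h)

/-- `X` is absolutely `T₂S`-closed. -/
def AbsolutelyT2SClosed : Prop :=
  ∀ (Y : Type u) [Semigroup Y] [TopologicalSpace Y] [ContinuousMul Y] [T2Space Y]
    (h : X →ₙ* Y), IsClosed (Set.range h)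

/-- `X` is absolutely `TzS`-closed. -/
def AbsolutelyTzSClosed : Prop :=
  ∀ (Y : Type u) [Semigroup Y] [TopologicalSpace Y] [ContinuousMul Y] [T1Space Y],
    HasClopenBasis Y → ∀ (h : X →ₙ* Y), IsClosed (Set.range h)

/-- `X` is `T₁S`-closed: the image of every injective homomorphism to a `T₁`
topological semigroup with discrete image is closed. -/
def T1SClosed : Prop :=
  ∀ (Y : Type u) [Semigroup Y] [TopologicalSpace Y] [ContinuousMul Y] [T1Space Y]
    (h : X →ₙ* Y), Function.Injective h → DiscreteTopology (Set.range h) →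
      IsClosed (Set.range h)

/-- `X` is `T₂S`-closed. -/
def T2SClosed : Prop :=
  ∀ (Y : Type u) [Semigroup Y] [TopologicalSpace Y] [ContinuousMul Y] [T2Space Y]
    (h : X →ₙ* Y), Function.Injective h → DiscreteTopology (Set.range h) →
      IsClosed (Set.range h)

/-- `X` is `TzS`-closed. -/
def TzSClosed : Prop :=
  ∀ (Y : Type u) [Semigroup Y] [TopologicalSpace Y] [ContinuousMul Y] [T1Space Y],
    HasClopenBasis Y → ∀ (h : X →ₙ* Y), Function.Injective h →
      DiscreteTopology (Set.range h) → IsClosed (Set.range h)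

/-- `X` is injectively `T₂S`-closed. -/
def InjectivelyT2SClosed : Prop :=
  ∀ (Y : Type u) [Semigroup Y] [TopologicalSpace Y] [ContinuousMul Y] [T2Space Y]
    (h : X →ₙ* Y), Function.Injective h → IsClosed (Set.range h)

/-- `X` is projectively `T₁S`-closed: all congruence quotients are `T₁S`-closed. -/
def ProjectivelyT1SClosed : Prop := ∀ c : Con X, T1SClosed c.Quotient

/-- `X` is projectively `TzS`-closed. -/
def ProjectivelyTzSClosed : Prop := ∀ c : Con X, TzSClosed c.Quotient

/-- `X` is projectively `T₁S`-discrete: every homomorphism into a `T₁`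
topological semigroup has discrete image. -/
def ProjectivelyT1SDiscrete : Prop :=
  ∀ (Y : Type u) [Semigroup Y] [TopologicalSpace Y] [ContinuousMul Y] [T1Space Y]
    (h : X →ₙ* Y), DiscreteTopology (Set.range h)

/-- `X` is projectively `TzS`-discrete. -/
def ProjectivelyTzSDiscrete : Prop :=
  ∀ (Y : Type u) [Semigroup Y] [TopologicalSpace Y] [ContinuousMul Y] [T1Space Y],
    HasClopenBasis Y → ∀ (h : X →ₙ* Y), DiscreteTopology (Set.range h)

end TopClasses

/-- `spow x n` is the power `x^(n+1)` in a semigroup; thus as `n` ranges over `ℕ`,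
`spow x n` ranges over all powers `x^m`, `m ≥ 1`. -/
def spow {X : Type*} [Semigroup X] (x : X) : ℕ → X
  | 0 => x
  | n + 1 => spow x n * x

section AlgDefs

variable (X : Type*) [Semigroup X]

/-- the set `E(X)` of idempotents. -/
def idemSet : Set X := {x | x * x = x}

/-- `H_e`, the maximal subgroup containing the idempotent `e`. -/
def maxSubgroup (e : X) : Set X :=
  {x | x * e = x ∧ e * x = x ∧ ∃ y, y * e = y ∧ e * y = y ∧ x * y = e ∧ y * x = e}

/-- The Clifford part `H(X) = ⋃_{e ∈ E(X)} H_e`. -/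
def cliffordPart : Set X := ⋃ e ∈ idemSet X, maxSubgroup X e

/-- `H_e/e := {x : xe = ex ∈ H_e}`. -/
def HeCoideal (e : X) : Set X := {x | x * e = e * x ∧ x * e ∈ maxSubgroup X e}

/-- `I` is an ideal of the semigroup `X`. -/
def IsIdealSet (I : Set X) : Prop := ∀ x ∈ I, ∀ y : X, x * y ∈ I ∧ y * x ∈ I

/-- The set `VE(X)` of viable idempotents: `e` is idempotent and `X ∖ (H_e/e)` is an ideal. -/
def viableIdems : Set X := {e | e ∈ idemSet X ∧ IsIdealSet X (Set.univ \ HeCoideal X e)}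

/-- The center `Z(X)`. -/
def centerSet : Set X := {z | ∀ x, z * x = x * z}

/-- `√A = {x : xⁿ ∈ A for some n ≥ 1}`. -/
def sqrtSet (A : Set X) : Set X := {x | ∃ n : ℕ, spow x n ∈ A}

/-- A subset `B ⊆ X` is bounded: there is `n ≥ 1` with `xⁿ` idempotent for all `x ∈ B`. -/
def BoundedSet (B : Set X) : Prop := ∃ n : ℕ, ∀ x ∈ B, spow x n ∈ idemSet X

/-- The semigroup `X` is bounded. -/
def BoundedSemigroup : Prop := ∃ n : ℕ, ∀ x : X, spow x n ∈ idemSet X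

/-- `X` is chain-finite. -/
def ChainFinite : Prop :=
  ∀ I : Set X, I.Infinite → ∃ x ∈ I, ∃ y ∈ I, x * y ≠ x ∧ x * y ≠ y

/-- `G ⊆ X` is a subgroup of the semigroup `X`. -/
def IsSubgroupSet (G : Set X) : Prop :=
  (∀ x ∈ G, ∀ y ∈ G, x * y ∈ G) ∧
    ∃ e ∈ G, (∀ x ∈ G, x * e = x ∧ e * x = x) ∧ ∀ x ∈ G, ∃ y ∈ G, x * y = e ∧ y * x = e

/-- `X` is group-finite: all its subgroups are finite. -/
def GroupFinite : Prop := ∀ G : Set X, IsSubgroupSet X G → G.Finite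

/-- `X` is Clifford+finite: `X ∖ H(X)` is finite. -/
def CliffordPlusFinite : Prop := (Set.univ \ cliffordPart X).Finite

/-- `X` is `E`-commutative: idempotents commute. -/
def ECommutative : Prop := ∀ x ∈ idemSet X, ∀ y ∈ idemSet X, x * y = y * x

end AlgDefs

/-- The Rees congruence associated with an ideal `I` of `X`. -/
def ReesCon {X : Type*} [Semigroup X] (I : Set X) (hI : IsIdealSet X I) : Con X where
  r x y := x = y ∨ (x ∈ I ∧ y ∈ I)
  iseqv :=
    { refl := fun _ => Or.inl rfl
      symm := by rintro x y (rfl | ⟨h1, h2⟩); exacts [Or.inl rfl, Or.inr ⟨h2, h1⟩]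
      trans := by
        rintro x y z (rfl | ⟨h1, h2⟩) (rfl | ⟨h3, h4⟩)
        exacts [Or.inl rfl, Or.inr ⟨h3, h4⟩, Or.inr ⟨h1, h2⟩, Or.inr ⟨h1, h4⟩] }
  mul' := by
    rintro a b c d (rfl | ⟨h1, h2⟩) (rfl | ⟨h3, h4⟩)
    · exact Or.inl rfl
    · exact Or.inr ⟨(hI c h3 a).2, (hI d h4 a).2⟩
    · exact Or.inr ⟨(hI a h1 c).1, (hI b h2 c).1⟩
    · exact Or.inr ⟨(hI a h1 c).1, (hI b h2 d).1⟩

/-- `X` is ideally `T₂S`-closed: all its Rees quotients are `T₂S`-closed. -/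
def IdeallyT2SClosed (X : Type u) [Semigroup X] : Prop :=
  ∀ (I : Set X) (hI : IsIdealSet X I), T2SClosed (ReesCon I hI).Quotient

/-- `X` is ideally `TzS`-closed. -/
def IdeallyTzSClosed (X : Type u) [Semigroup X] : Prop :=
  ∀ (I : Set X) (hI : IsIdealSet X I), TzSClosed (ReesCon I hI).Quotient

/-- A congruence is a semilattice congruence if its quotient is a commutative
semigroup of idempotents. -/
def IsSemilatticeCon {X : Type*} [Semigroup X] (c : Con X) : Prop :=
  (∀ a b : c.Quotient, a * b = b * a) ∧ ∀ a : c.Quotient, a * a = a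

/-- The smallest semilattice congruence `⇕` on `X`, the intersection of all
semilattice congruences. -/
def slCon (X : Type*) [Semigroup X] : Con X := sInf {c | IsSemilatticeCon c}

theorem centerSet_mul_mem {X : Type*} [Semigroup X] {a b : X}
    (ha : a ∈ centerSet X) (hb : b ∈ centerSet X) : a * b ∈ centerSet X := fun t => by
  rw [mul_assoc, hb t, ← mul_assoc, ha t, mul_assoc]

/-- The ideal center `IZ(X) = {z ∈ Z(X) : zX ⊆ Z(X)}`, as a subsemigroup of `X`. -/
def idealCenter (X : Type*) [Semigroup X] : Subsemigroup X where
  carrier := {z | z ∈ centerSet X ∧ ∀ x : X, z * x ∈ centerSet X}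
  mul_mem' := by
    rintro a b ⟨ha, ha'⟩ ⟨hb, hb'⟩
    refine ⟨centerSet_mul_mem ha hb, fun x => ?_⟩
    have h : a * b * x = a * (b * x) := mul_assoc a b x
    rw [h]
    exact centerSet_mul_mem ha (hb' x)

/-- Evaluation of the semigroup polynomial with coefficients `a, l = [a₁, …, aₙ]`:
`x ↦ a * x * a₁ * x * ⋯ * x * aₙ` (computed in `X¹ = WithOne X`). -/
def polyEval {X : Type*} [Semigroup X] (a : WithOne X) (l : List (WithOne X)) (x : X) :
    WithOne X :=
  l.foldl (fun acc b => acc * (x : WithOne X) * b) a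

/-- `f : X → X¹` is a semigroup polynomial of degree `d ≥ 1`. -/
def IsSemigroupPolynomial {X : Type*} [Semigroup X] (f : X → WithOne X) (d : ℕ) : Prop :=
  1 ≤ d ∧ ∃ (a : WithOne X) (l : List (WithOne X)), l.length = d ∧ ∀ x, f x = polyEval a l x

/-- `X` is polybounded. -/
def Polybounded (X : Type*) [Semigroup X] : Prop :=
  ∃ (k : ℕ) (f : Fin k → X → WithOne X) (d : Fin k → ℕ) (b : Fin k → X),
    (∀ i, IsSemigroupPolynomial (f i) (d i)) ∧ ∀ x : X, ∃ i, f i x = (b i : WithOne X)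

/-- `X` is polyfinite. -/
def Polyfinite (X : Type*) [Semigroup X] : Prop :=
  ∃ (d : ℕ) (F : Set X), F.Finite ∧ ∀ x y : X,
    ∃ (f : X → WithOne X) (m : ℕ), m ≤ d ∧ IsSemigroupPolynomial f m ∧
      (∃ u ∈ F, f x = (u : WithOne X)) ∧ ∃ v ∈ F, f y = (v : WithOne X)

/-- `X` is `B`-centrobounded over `B ⊆ E(X)`: there is `n ≥ 1` such that for every
`e ∈ B` and all `x, y ∈ ⋂_{a ∈ B} H_a/a`, if `w` is the inverse of `y*e` in the group
`H_e` and `(x*e)*w ∈ H_e ∩ Z(X)`, then `((x*e)*w)ⁿ` is an idempotent. -/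
def Centrobounded {X : Type*} [Semigroup X] (B : Set X) : Prop :=
  ∃ n : ℕ, ∀ e ∈ B, ∀ x ∈ ⋂ a ∈ B, HeCoideal X a, ∀ y ∈ ⋂ a ∈ B, HeCoideal X a,
    ∀ w ∈ maxSubgroup X e, (y * e) * w = e → w * (y * e) = e →
      (x * e) * w ∈ maxSubgroup X e → (x * e) * w ∈ centerSet X →
        spow ((x * e) * w) n ∈ idemSet X

/-- `B` is an antichain in the natural partial order `e ≤ f ⇔ ef = fe = e` on idempotents. -/
def IsIdemAntichain {X : Type*} [Semigroup X] (B : Set X) : Prop :=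
  ∀ e ∈ B, ∀ f ∈ B, e ≠ f → ¬(e * f = e ∧ f * e = e) ∧ ¬(e * f = f ∧ f * e = f)

theorem HasClopenBasis.of_forall {Y : Type*} [TopologicalSpace Y]
    (h : ∀ (y : Y) (U : Set Y), IsOpen U → y ∈ U → ∃ W, IsClopen W ∧ y ∈ W ∧ W ⊆ U) :
    HasClopenBasis Y := by
  refine ⟨{W | IsClopen W}, fun _ hW => hW,
    isTopologicalBasis_of_isOpen_of_nhds (fun _ hW => hW.isOpen) fun y U hy hU => ?_⟩
  obtain ⟨W, hW, hyW, hWU⟩ := h y U hU hy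
  exact ⟨W, hW, hyW, hWU⟩

theorem HasClopenBasis.exists_isClopen {Y : Type*} [TopologicalSpace Y] (h : HasClopenBasis Y)
    {y : Y} {U : Set Y} (hU : IsOpen U) (hy : y ∈ U) : ∃ W, IsClopen W ∧ y ∈ W ∧ W ⊆ U := by
  obtain ⟨B, hB, hbasis⟩ := h
  obtain ⟨W, hW, hyW, hWU⟩ := hbasis.exists_subset_of_mem_open hy hU
  exact ⟨W, hB W hW, hyW, hWU⟩

theorem HasClopenBasis.of_profinite (Y : Type*) [TopologicalSpace Y] [T2Space Y] [CompactSpace Y]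
    [TotallyDisconnectedSpace Y] : HasClopenBasis Y :=
  ⟨{W | IsClopen W}, fun _ hW => hW, isTopologicalBasis_isClopen⟩

theorem HasClopenBasis.subtype {Y : Type*} [TopologicalSpace Y] (h : HasClopenBasis Y)
    (p : Y → Prop) : HasClopenBasis {y // p y} := by
  refine HasClopenBasis.of_forall fun y U hU hy => ?_
  obtain ⟨V, hV, rfl⟩ := isOpen_induced_iff.1 hU
  obtain ⟨W, hW, hyW, hWV⟩ := h.exists_isClopen hV hy
  exact ⟨Subtype.val ⁻¹' W, hW.preimage continuous_subtype_val, hyW, preimage_mono hWV⟩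

/-- A completely regular space that is locally countable has a base of clopen sets. -/
theorem HasClopenBasis.of_locally_countable {Y : Type*} [TopologicalSpace Y]
    [CompletelyRegularSpace Y] (h : ∀ y : Y, ∃ V : Set Y, IsOpen V ∧ y ∈ V ∧ V.Countable) :
    HasClopenBasis Y := by
  refine HasClopenBasis.of_forall fun y U hU hy => ?_
  obtain ⟨V, hV, hyV, hVc⟩ := h y
  obtain ⟨f, hf, hf0, hf1⟩ := CompletelyRegularSpace.completely_regular_isOpen y (U ∩ V)
    (hU.inter hV) ⟨hy, hyV⟩
  let g : Y → ℝ := fun z => f z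
  have hg : Continuous g := continuous_subtype_val.comp hf
  have hg1 : ∀ z ∉ U ∩ V, g z = 1 := fun z hz => by simp [g, hf1 hz]
  have hcount : (range g).Countable := by
    refine ((hVc.image g).union (countable_singleton 1)).mono ?_
    rintro _ ⟨z, rfl⟩
    by_cases hz : z ∈ U ∩ V
    · exact Or.inl ⟨z, hz.2, rfl⟩
    · exact Or.inr (hg1 z hz)
  obtain ⟨r, hr, hrg⟩ : ∃ r ∈ Ioo (0 : ℝ) 1, r ∉ range g := by
    by_contra! hcon
    refine not_le_of_gt Cardinal.aleph0_lt_continuum ?_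
    rw [← Cardinal.mk_Ioo_real (zero_lt_one' ℝ)]
    exact Cardinal.le_aleph0_iff_set_countable.2 (hcount.mono hcon)
  refine ⟨g ⁻¹' Iio r, ⟨?_, isOpen_Iio.preimage hg⟩, by simp [g, hf0, hr.1], fun z hz => ?_⟩
  · have : g ⁻¹' Iio r = g ⁻¹' Iic r := by
      ext z
      change g z < r ↔ g z ≤ r
      exact ⟨le_of_lt, fun hz => lt_of_le_of_ne hz fun heq => hrg ⟨z, heq⟩⟩
    rw [this]
    exact isClosed_Iic.preimage hg
  · by_contra hzU
    have := hg1 z fun hz' => hzU hz'.1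
    simp only [mem_preimage, mem_Iio, this] at hz
    exact absurd hz hr.2.not_gt

theorem AbsolutelyTzSClosed.of_surjective {X S : Type u} [Semigroup X] [Semigroup S]
    (hX : AbsolutelyTzSClosed X) (q : X →ₙ* S) (hq : Function.Surjective q) :
    AbsolutelyTzSClosed S := by
  intro Y _ _ _ _ hY h
  have := hX Y hY (h.comp q)
  rwa [MulHom.coe_comp, range_comp, hq.range_eq, image_univ] at this

/-- A family of neighbourhood systems turning a semigroup into a zero-dimensional
topological semigroup. -/
structure ClopenNhds (Y : Type*) [Semigroup Y] where
  N : Y → ℕ → Set Y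
  mem : ∀ p n, p ∈ N p n
  anti : ∀ p, Antitone (N p)
  isOpen' : ∀ p n, ∀ q ∈ N p n, ∃ m, N q m ⊆ N p n
  isClosed' : ∀ p n, ∀ q ∉ N p n, ∃ m, Disjoint (N q m) (N p n)
  mul' : ∀ p q n, ∃ m, ∀ a ∈ N p m, ∀ b ∈ N q m, a * b ∈ N (p * q) n
  sep : ∀ p q, p ≠ q → ∃ n, q ∉ N p n

theorem AbsolutelyTzSClosed.exists_eq_of_clopenNhds {X Y : Type u} [Semigroup X] [Semigroup Y]
    (hX : AbsolutelyTzSClosed X) (c : ClopenNhds Y) (h : X →ₙ* Y) (p : Y)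
    (hp : ∀ n, ∃ x, h x ∈ c.N p n) : ∃ x, h x = p := by
  let _ : TopologicalSpace Y :=
    { IsOpen := fun s => ∀ p ∈ s, ∃ n, c.N p n ⊆ s
      isOpen_univ := fun _ _ => ⟨0, subset_univ _⟩
      isOpen_inter := fun s t hs ht p hp => by
        obtain ⟨n, hn⟩ := hs p hp.1
        obtain ⟨m, hm⟩ := ht p hp.2
        exact ⟨max n m, subset_inter ((c.anti p (le_max_left _ _)).trans hn)
          ((c.anti p (le_max_right _ _)).trans hm)⟩
      isOpen_sUnion := fun s hs p ⟨t, hts, hpt⟩ => by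
        obtain ⟨n, hn⟩ := hs t hts p hpt
        exact ⟨n, hn.trans (subset_sUnion_of_mem hts)⟩ }
  have hopen : ∀ s : Set Y, IsOpen s ↔ ∀ p ∈ s, ∃ n, c.N p n ⊆ s := fun _ => Iff.rfl
  have hNo : ∀ p n, IsOpen (c.N p n) := fun p n => (hopen _).2 (c.isOpen' p n)
  have hNc : ∀ p n, IsClopen (c.N p n) := fun p n => by
    refine ⟨⟨(hopen _).2 fun q hq => ?_⟩, hNo p n⟩
    obtain ⟨m, hm⟩ := c.isClosed' p n q hq
    exact ⟨m, subset_compl_iff_disjoint_right.2 hm⟩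
  have : T1Space Y := ⟨fun q => ⟨(hopen _).2 fun p hp => by
    obtain ⟨n, hn⟩ := c.sep p q hp
    exact ⟨n, fun a ha haq => hn (haq ▸ ha)⟩⟩⟩
  have : ContinuousMul Y := ⟨continuous_def.2 fun s hs => isOpen_prod_iff.2 fun p q hpq => by
    obtain ⟨n, hn⟩ := (hopen s).1 hs _ hpq
    obtain ⟨m, hm⟩ := c.mul' p q n
    exact ⟨c.N p m, c.N q m, hNo p m, hNo q m, c.mem p m, c.mem q m,
      fun ab hab => hn (hm _ hab.1 _ hab.2)⟩⟩
  have hbasis : HasClopenBasis Y := HasClopenBasis.of_forall fun y U hU hy => by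
    obtain ⟨n, hn⟩ := (hopen U).1 hU y hy
    exact ⟨c.N y n, hNc y n, c.mem y n, hn⟩
  have hcl := hX Y hbasis h
  have : p ∈ closure (range h) := mem_closure_iff.2 fun U hU hpU => by
    obtain ⟨n, hn⟩ := (hopen U).1 hU p hpU
    obtain ⟨x, hx⟩ := hp n
    exact ⟨h x, hn hx, mem_range_self x⟩
  exact hcl.closure_subset this

/-- A prime coideal: the preimage of `1` under a homomorphism to the semilattice `{0, 1}`. -/
def IsPrimeCoideal {X : Type*} [Semigroup X] (F : Set X) : Prop :=
  ∀ a b, a * b ∈ F ↔ a ∈ F ∧ b ∈ F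

theorem AbsolutelyTzSClosed.exists_mem_iff {X ι : Type u} [Semigroup X]
    (hX : AbsolutelyTzSClosed X) (F : ι → Set X) (hF : ∀ j, IsPrimeCoideal (F j)) (x : ℕ → X)
    (P : ι → Prop) (hP : ∀ j, ∀ᶠ i in Filter.atTop, (x i ∈ F j ↔ P j)) :
    ∃ a, ∀ j, a ∈ F j ↔ P j := by
  classical
  let h : X →ₙ* (ι → Fin 2) :=
    { toFun := fun a j => if a ∈ F j then 1 else 0
      map_mul' := fun a b => by
        funext j
        by_cases ha : a ∈ F j <;> by_cases hb : b ∈ F j <;> simp [hF j a b, ha, hb] }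
  have hcl := hX (ι → Fin 2) (HasClopenBasis.of_profinite _) h
  have hlim : Filter.Tendsto (fun i => h (x i)) Filter.atTop
      (nhds fun j => if P j then (1 : Fin 2) else 0) := by
    refine tendsto_pi_nhds.2 fun j => ?_
    refine tendsto_const_nhds.congr' ((hP j).mono fun i hi => ?_)
    simp [h, hi]
  obtain ⟨a, ha⟩ := hcl.mem_of_tendsto hlim (Filter.Eventually.of_forall fun i => ⟨x i, rfl⟩)
  refine ⟨a, fun j => ?_⟩
  have hj := congrFun ha j
  by_cases h1 : a ∈ F j <;> by_cases h2 : P j <;> simp_all [h]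

theorem AbsolutelyTzSClosed.no_increasing_coideals {X : Type u} [Semigroup X]
    (hX : AbsolutelyTzSClosed X) (F : ℕ → Set X) (hF : ∀ j, IsPrimeCoideal (F j))
    (hmono : Monotone F) (x : ℕ → X) (hx : ∀ i j, x i ∈ F j ↔ i ≤ j) : False := by
  let F' : ULift.{u} (Option ℕ) → Set X := fun j => j.down.elim (⋃ i, F i) F
  have hF' : ∀ j, IsPrimeCoideal (F' j) := by
    rintro ⟨_ | j⟩
    · intro a b
      simp only [F', Option.elim, mem_iUnion]
      constructor
      · rintro ⟨i, hi⟩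
        exact ⟨⟨i, ((hF i a b).1 hi).1⟩, ⟨i, ((hF i a b).1 hi).2⟩⟩
      · rintro ⟨⟨i, hi⟩, ⟨k, hk⟩⟩
        exact ⟨max i k, (hF _ a b).2 ⟨hmono (le_max_left i k) hi, hmono (le_max_right i k) hk⟩⟩
    · exact hF j
  obtain ⟨a, ha⟩ := hX.exists_mem_iff F' hF' x (fun j => j.down = none) (by
    rintro ⟨_ | j⟩
    · refine Filter.Eventually.of_forall fun i => ?_
      simpa [F'] using ⟨i, (hx i i).2 le_rfl⟩
    · filter_upwards [Filter.eventually_gt_atTop j] with i hi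
      simp [F', hx, hi])
  obtain ⟨i, hi⟩ := mem_iUnion.1 ((ha ⟨none⟩).2 rfl)
  simpa using (ha ⟨some i⟩).1 hi

theorem AbsolutelyTzSClosed.no_decreasing_coideals {X : Type u} [Semigroup X]
    (hX : AbsolutelyTzSClosed X) (F : ℕ → Set X) (hF : ∀ j, IsPrimeCoideal (F j))
    (x : ℕ → X) (hx : ∀ i j, x i ∈ F j ↔ j ≤ i) : False := by
  let F' : ULift.{u} (Option ℕ) → Set X := fun j => j.down.elim (⋂ i, F i) F
  have hF' : ∀ j, IsPrimeCoideal (F' j) := by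
    rintro ⟨_ | j⟩
    · intro a b
      simp only [F', Option.elim, mem_iInter, hF _ a b, forall_and]
    · exact hF j
  obtain ⟨a, ha⟩ := hX.exists_mem_iff F' hF' x (fun j => j.down ≠ none) (by
    rintro ⟨_ | j⟩
    · refine Filter.Eventually.of_forall fun i => ?_
      simpa [F', hx] using ⟨i + 1, by omega⟩
    · filter_upwards [Filter.eventually_ge_atTop j] with i hi
      simp [F', hx, hi])
  have : a ∈ ⋂ i, F i := mem_iInter.2 fun i => (ha ⟨some i⟩).2 (by simp)
  simpa using (ha ⟨none⟩).1 this

section Ultrafilter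

attribute [local instance] Ultrafilter.semigroup

theorem Ultrafilter.mem_mul {S : Type*} [Semigroup S] {p q : Ultrafilter S} {s : Set S} :
    s ∈ p * q ↔ ∀ᶠ a in (p : Filter S), ∀ᶠ b in (q : Filter S), a * b ∈ s :=
  Ultrafilter.eventually_mul p q (· ∈ s)

theorem map_zero_of_map_mul {S : Type*} [Semigroup S] {o : S}
    (ho : ∀ x, o * x = o ∧ x * o = o) {f : S → S} (hf : ∀ a c, f (a * c) = f a * c) :
    f o = o := by
  have := hf o o
  rwa [(ho o).1, (ho (f o)).2] at this

/-- The principal ultrafilters together with the translates of an ultrafilter containing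
a set of central elements with zero multiplication. -/
def translateSubsemigroup {S : Type*} [Semigroup S] (o : S) (ho : ∀ x, o * x = o ∧ x * o = o)
    (A : Set S) (hAZ : A ⊆ centerSet S) (hAA : ∀ a ∈ A, ∀ b ∈ A, a * b = o)
    (𝓕 : Ultrafilter S) (hA : A ∈ 𝓕) : Subsemigroup (Ultrafilter S) where
  carrier := {W | (∃ x, W = pure x) ∨
    ∃ f : S → S, (∀ a c, f (a * c) = f a * c) ∧ W = 𝓕.map f}
  mul_mem' := by
    rintro p q (⟨x, rfl⟩ | ⟨f, hf, rfl⟩) (⟨y, rfl⟩ | ⟨g, hg, rfl⟩)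
    · refine Or.inl ⟨x * y, Ultrafilter.ext fun s => ?_⟩
      simp [Ultrafilter.mem_mul]
    · refine Or.inr ⟨fun a => x * g a, fun a c => by
        change x * g (a * c) = x * g a * c
        rw [hg, mul_assoc],
        Ultrafilter.ext fun s => ?_⟩
      simp [Ultrafilter.mem_mul, Filter.Eventually, preimage]
    · refine Or.inr ⟨fun a => f (y * a), fun a c => by
        change f (y * (a * c)) = f (y * a) * c
        rw [← mul_assoc, hf],
        Ultrafilter.ext fun s => ?_⟩
      have : ∀ᶠ a in (𝓕 : Filter S), (f a * y ∈ s ↔ f (y * a) ∈ s) := by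
        filter_upwards [hA] with a ha
        rw [← hAZ ha y, hf]
      simpa [Ultrafilter.mem_mul, Filter.Eventually, preimage] using Filter.eventually_congr this
    · refine Or.inl ⟨o, Ultrafilter.ext fun s => ?_⟩
      have : ∀ᶠ a in (𝓕 : Filter S), ∀ᶠ b in (𝓕 : Filter S), f a * g b = o := by
        filter_upwards [hA] with a ha
        filter_upwards [hA] with b hb
        rw [← hf, hAZ ha, ← hg, hAA b hb a ha, map_zero_of_map_mul ho hg,
          map_zero_of_map_mul ho hf]
      rw [Ultrafilter.mem_mul, Ultrafilter.mem_pure]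
      simp only [Ultrafilter.coe_map, Filter.eventually_map]
      constructor
      · intro h
        obtain ⟨a, ha1, ha2⟩ := (h.and this).exists
        obtain ⟨b, hb1, hb2⟩ := (ha1.and ha2).exists
        exact hb2 ▸ hb1
      · intro h
        filter_upwards [this] with a ha
        filter_upwards [ha] with b hb
        rwa [hb]

theorem continuousMul_translateSubsemigroup {S : Type*} [Semigroup S] (o : S)
    (ho : ∀ x, o * x = o ∧ x * o = o) (A : Set S) (hAZ : A ⊆ centerSet S)
    (hAA : ∀ a ∈ A, ∀ b ∈ A, a * b = o) (𝓕 : Ultrafilter S) (hA : A ∈ 𝓕) :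
    ContinuousMul (translateSubsemigroup o ho A hAZ hAA 𝓕 hA) := by
  have key : ∀ p ∈ translateSubsemigroup o ho A hAZ hAA 𝓕 hA,
      ∀ q ∈ translateSubsemigroup o ho A hAZ hAA 𝓕 hA, ∀ s ∈ p * q,
        ∃ t ∈ p, ∃ r ∈ q, ∀ a ∈ t, ∀ b ∈ r, a * b ∈ s := by
    rintro p (⟨x, rfl⟩ | ⟨f, hf, rfl⟩) q (⟨y, rfl⟩ | ⟨g, hg, rfl⟩) s hs
    · refine ⟨{x}, by simp, {y}, by simp, ?_⟩
      simpa [Ultrafilter.mem_mul] using hs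
    · refine ⟨{x}, by simp, {b | x * b ∈ s}, ?_, by simp⟩
      simpa [Ultrafilter.mem_mul, Filter.Eventually, preimage] using hs
    · refine ⟨{a | a * y ∈ s}, ?_, {y}, by simp, by simp⟩
      simpa [Ultrafilter.mem_mul, Filter.Eventually, preimage] using hs
    · have hprod : ∀ a ∈ A, ∀ b ∈ A, f a * g b = o := fun a ha b hb => by
        rw [← hf, hAZ ha, ← hg, hAA b hb a ha, map_zero_of_map_mul ho hg,
          map_zero_of_map_mul ho hf]
      have hos : o ∈ s := by
        rw [Ultrafilter.mem_mul] at hs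
        simp only [Ultrafilter.coe_map, Filter.eventually_map] at hs
        obtain ⟨a, ha, ha'⟩ := (hs.and hA).exists
        obtain ⟨b, hb, hb'⟩ := (ha.and hA).exists
        exact hprod a ha' b hb' ▸ hb
      refine ⟨f '' A, Filter.image_mem_map hA, g '' A, Filter.image_mem_map hA, ?_⟩
      rintro _ ⟨a, ha, rfl⟩ _ ⟨b, hb, rfl⟩
      rwa [hprod a ha b hb]
  refine ⟨continuous_induced_rng.2 (ultrafilterBasis_is_basis.continuous_iff.2 ?_)⟩
  rintro _ ⟨s, rfl⟩
  refine isOpen_prod_iff.2 fun p q hpq => ?_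
  obtain ⟨t, ht, r, hr, htr⟩ := key p p.2 q q.2 s hpq
  refine ⟨Subtype.val ⁻¹' {W | t ∈ W}, Subtype.val ⁻¹' {W | r ∈ W},
    (ultrafilter_isOpen_basic t).preimage continuous_subtype_val,
    (ultrafilter_isOpen_basic r).preimage continuous_subtype_val, ht, hr, fun pq h => ?_⟩
  change s ∈ (pq.1 : Ultrafilter S) * (pq.2 : Ultrafilter S)
  rw [Ultrafilter.mem_mul]
  filter_upwards [h.1] with a ha
  filter_upwards [h.2] with b hb
  exact htr a ha b hb

theorem AbsolutelyTzSClosed.finite_of_mul_eq {S : Type u} [Semigroup S]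
    (hS : AbsolutelyTzSClosed S) (o : S) (ho : ∀ x, o * x = o ∧ x * o = o) {A : Set S}
    (hAZ : A ⊆ centerSet S) (hAA : ∀ a ∈ A, ∀ b ∈ A, a * b = o) : A.Finite := by
  by_contra hinf
  have : (Filter.cofinite ⊓ Filter.principal A).NeBot :=
    Set.Infinite.cofinite_inf_principal_neBot hinf
  let 𝓕 : Ultrafilter S := Ultrafilter.of (Filter.cofinite ⊓ Filter.principal A)
  have h𝓕 : (𝓕 : Filter S) ≤ Filter.cofinite ⊓ Filter.principal A := Ultrafilter.of_le _
  have hA : A ∈ 𝓕 := h𝓕 (Filter.mem_inf_of_right (Filter.mem_principal_self A))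
  have := continuousMul_translateSubsemigroup o ho A hAZ hAA 𝓕 hA
  let h : S →ₙ* translateSubsemigroup o ho A hAZ hAA 𝓕 hA :=
    { toFun := fun x => ⟨pure x, Or.inl ⟨x, rfl⟩⟩
      map_mul' := fun x y => Subtype.ext (Ultrafilter.ext fun s => by
        change s ∈ (pure (x * y) : Ultrafilter S) ↔ s ∈ (pure x * pure y : Ultrafilter S)
        simp [Ultrafilter.mem_mul]) }
  have hcl := hS _ ((HasClopenBasis.of_profinite (Ultrafilter S)).subtype _) h
  let y : translateSubsemigroup o ho A hAZ hAA 𝓕 hA := ⟨𝓕, Or.inr ⟨id, fun _ _ => rfl, rfl⟩⟩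
  have hy : y ∈ closure (range h) := by
    refine mem_closure_iff.2 fun V hV hyV => ?_
    obtain ⟨V', hV', rfl⟩ := isOpen_induced_iff.1 hV
    obtain ⟨x, hx⟩ := denseRange_pure.exists_mem_open hV' ⟨_, hyV⟩
    exact ⟨h x, hx, mem_range_self x⟩
  obtain ⟨x, hx⟩ := hcl.closure_subset hy
  have hx' : (pure x : Ultrafilter S) = 𝓕 := congrArg Subtype.val hx
  have hmem : ({x}ᶜ : Set S) ∈ 𝓕 :=
    h𝓕 (Filter.mem_inf_of_left (finite_singleton x).compl_mem_cofinite)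
  rw [← hx'] at hmem
  simp at hmem

end Ultrafilter

/-- The quotient homomorphism onto the Rees quotient. -/
def reesMk {X : Type*} [Semigroup X] {U : Set X} (hU : IsIdealSet X U) :
    X →ₙ* (ReesCon U hU).Quotient where
  toFun x := (x : (ReesCon U hU).Quotient)
  map_mul' _ _ := rfl

theorem reesMk_surjective {X : Type*} [Semigroup X] {U : Set X} (hU : IsIdealSet X U) :
    Function.Surjective (reesMk hU) := Quotient.mk_surjective

theorem reesMk_eq {X : Type*} [Semigroup X] {U : Set X} (hU : IsIdealSet X U) {x y : X} :
    reesMk hU x = reesMk hU y ↔ x = y ∨ (x ∈ U ∧ y ∈ U) := Con.eq _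

theorem reesMk_zero {X : Type*} [Semigroup X] {U : Set X} (hU : IsIdealSet X U) {u : X}
    (hu : u ∈ U) (x : (ReesCon U hU).Quotient) :
    reesMk hU u * x = reesMk hU u ∧ x * reesMk hU u = reesMk hU u := by
  obtain ⟨x, rfl⟩ := reesMk_surjective hU x
  rw [← map_mul, ← map_mul, reesMk_eq, reesMk_eq]
  exact ⟨Or.inr ⟨(hU u hu x).1, hu⟩, Or.inr ⟨(hU u hu x).2, hu⟩⟩

/-- A set of central elements outside an ideal `U` is finite if all its products lie in `U`. -/
theorem AbsolutelyTzSClosed.finite_of_mul_mem {X : Type u} [Semigroup X]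
    (hX : AbsolutelyTzSClosed X) {U : Set X} (hU : IsIdealSet X U) {A : Set X}
    (hAZ : A ⊆ centerSet X) (hAU : ∀ a ∈ A, a ∉ U) (hAA : ∀ a ∈ A, ∀ b ∈ A, a * b ∈ U) :
    A.Finite := by
  rcases A.eq_empty_or_nonempty with rfl | ⟨a₀, ha₀⟩
  · exact finite_empty
  have hu := hAA a₀ ha₀ a₀ ha₀
  have hfin : (reesMk hU '' A).Finite := by
    refine (hX.of_surjective _ (reesMk_surjective hU)).finite_of_mul_eq (reesMk hU (a₀ * a₀))
      (reesMk_zero hU hu) ?_ ?_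
    · rintro _ ⟨a, ha, rfl⟩ y
      obtain ⟨y, rfl⟩ := reesMk_surjective hU y
      rw [← map_mul, ← map_mul, hAZ ha y]
    · rintro _ ⟨a, ha, rfl⟩ _ ⟨b, hb, rfl⟩
      rw [← map_mul, reesMk_eq]
      exact Or.inr ⟨hAA a ha b hb, hu⟩
  refine hfin.of_finite_image fun a ha b hb hab => ?_
  exact ((reesMk_eq hU).1 hab).resolve_right fun h => hAU a ha h.1

section Powers

variable {X : Type*} [Semigroup X]

theorem coe_spow (x : X) (n : ℕ) : ((spow x n : X) : WithOne X) = (x : WithOne X) ^ (n + 1) := by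
  induction n with
  | zero => simp [spow]
  | succ n ih => rw [spow, WithOne.coe_mul, ih, pow_succ _ (n + 1)]

theorem spow_mul_spow (x : X) (m n : ℕ) : spow x m * spow x n = spow x (m + n + 1) := by
  rw [← WithOne.coe_inj, WithOne.coe_mul, coe_spow, coe_spow, coe_spow, ← pow_add]
  congr 1
  omega

theorem mul_spow_self (x : X) (n : ℕ) : x * spow x n = spow x (n + 1) := by
  have := spow_mul_spow x 0 n
  rwa [zero_add] at this

theorem spow_spow (x : X) (m n : ℕ) : spow (spow x m) n = spow x (m * n + m + n) := by
  rw [← WithOne.coe_inj, coe_spow, coe_spow, coe_spow, ← pow_mul]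
  congr 1
  ring

theorem spow_of_mul_self {e : X} (he : e * e = e) (n : ℕ) : spow e n = e := by
  induction n with
  | zero => rfl
  | succ n ih => rw [spow, ih, he]

theorem spow_mul {x y : X} (h : x * y = y * x) (n : ℕ) :
    spow (x * y) n = spow x n * spow y n := by
  rw [← WithOne.coe_inj, WithOne.coe_mul, coe_spow, coe_spow, coe_spow, WithOne.coe_mul]
  refine Commute.mul_pow ?_ _
  change (x : WithOne X) * y = y * x
  rw [← WithOne.coe_mul, h, WithOne.coe_mul]

theorem spow_mem_centerSet {z : X} (hz : z ∈ centerSet X) (n : ℕ) : spow z n ∈ centerSet X := by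
  induction n with
  | zero => exact hz
  | succ n ih => exact centerSet_mul_mem ih hz

theorem IsPrimeCoideal.spow_mem_iff {F : Set X} (hF : IsPrimeCoideal F) (x : X) (n : ℕ) :
    spow x n ∈ F ↔ x ∈ F := by
  induction n with
  | zero => exact Iff.rfl
  | succ n ih => rw [spow, hF, ih, and_self_iff]

end Powers

section MaxSubgroup

variable {X : Type*} [Semigroup X] {e f x y z : X}

theorem self_mem_maxSubgroup (he : e * e = e) : e ∈ maxSubgroup X e :=
  ⟨he, he, e, he, he, he, he⟩

theorem mul_mem_maxSubgroup (hx : x ∈ maxSubgroup X e) (hy : y ∈ maxSubgroup X e) :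
    x * y ∈ maxSubgroup X e := by
  obtain ⟨hx1, hx2, x', hx3, hx4, hx5, hx6⟩ := hx
  obtain ⟨hy1, hy2, y', hy3, hy4, hy5, hy6⟩ := hy
  refine ⟨by rw [mul_assoc, hy1], by rw [← mul_assoc, hx2], y' * x', by rw [mul_assoc, hx3],
    by rw [← mul_assoc, hy4], ?_, ?_⟩
  · rw [mul_assoc, ← mul_assoc y, hy5, hx4, hx5]
  · rw [mul_assoc, ← mul_assoc x', hx6, hy2, hy6]

theorem spow_mem_maxSubgroup (hx : x ∈ maxSubgroup X e) (n : ℕ) : spow x n ∈ maxSubgroup X e := by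
  induction n with
  | zero => exact hx
  | succ n ih => exact mul_mem_maxSubgroup ih hx

theorem exists_inv_mem_maxSubgroup (hx : x ∈ maxSubgroup X e) :
    ∃ y ∈ maxSubgroup X e, x * y = e ∧ y * x = e := by
  obtain ⟨hx1, hx2, y, hy1, hy2, hy3, hy4⟩ := hx
  exact ⟨y, ⟨hy1, hy2, x, hx1, hx2, hy4, hy3⟩, hy3, hy4⟩

theorem eq_of_mem_maxSubgroup_of_mul_self (hx : x ∈ maxSubgroup X e) (h : x * x = x) : x = e := by
  obtain ⟨y, hy, hxy, -⟩ := exists_inv_mem_maxSubgroup hx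
  have := congrArg (· * y) h
  simp only [mul_assoc, hxy, hx.1] at this
  exact this

theorem mul_right_cancel_of_mem_maxSubgroup (hx : x ∈ maxSubgroup X e) (hy : y ∈ maxSubgroup X e)
    (hz : z ∈ maxSubgroup X e) (h : y * x = z * x) : y = z := by
  obtain ⟨w, hw, hxw, -⟩ := exists_inv_mem_maxSubgroup hx
  have := congrArg (· * w) h
  simpa only [mul_assoc, hxw, hy.1, hz.1] using this

/-- The group structure of the maximal subgroup at an idempotent. -/
@[reducible]
noncomputable def maxSubgroupGroup (he : e * e = e) : Group (maxSubgroup X e) :=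
  letI : Mul (maxSubgroup X e) := ⟨fun a b => ⟨a * b, mul_mem_maxSubgroup a.2 b.2⟩⟩
  letI : One (maxSubgroup X e) := ⟨⟨e, self_mem_maxSubgroup he⟩⟩
  letI : Inv (maxSubgroup X e) := ⟨fun a =>
    ⟨(exists_inv_mem_maxSubgroup a.2).choose, (exists_inv_mem_maxSubgroup a.2).choose_spec.1⟩⟩
  Group.ofLeftAxioms (fun a b c => Subtype.ext (mul_assoc (a : X) b c))
    (fun a => Subtype.ext a.2.2.1)
    (fun a => Subtype.ext (exists_inv_mem_maxSubgroup a.2).choose_spec.2.2)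

theorem mul_mem_HeCoideal (hx : x ∈ HeCoideal X e) (hy : y ∈ HeCoideal X e) (he : e * e = e) :
    x * y ∈ HeCoideal X e ∧ x * y * e = (x * e) * (y * e) := by
  have h : x * y * e = (x * e) * (y * e) := by
    rw [hy.1, mul_assoc x e, ← mul_assoc e e, he, mul_assoc, hy.1]
  refine ⟨⟨?_, ?_⟩, h⟩
  · rw [mul_assoc, hy.1, ← mul_assoc, hx.1, mul_assoc]
  · rw [h]
    exact mul_mem_maxSubgroup hx.2 hy.2

theorem isPrimeCoideal_HeCoideal (he : e ∈ viableIdems X) : IsPrimeCoideal (HeCoideal X e) := by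
  refine fun a b => ⟨fun hab => ?_, fun h => (mul_mem_HeCoideal h.1 h.2 he.1).1⟩
  by_contra hcon
  rw [not_and_or] at hcon
  rcases hcon with h | h
  · exact (he.2 a ⟨trivial, h⟩ b).1.2 hab
  · exact (he.2 b ⟨trivial, h⟩ a).2.2 hab

theorem mem_HeCoideal_of_mem_maxSubgroup (hx : x ∈ maxSubgroup X e) : x ∈ HeCoideal X e :=
  ⟨by rw [hx.1, hx.2.1], by rwa [hx.1]⟩

theorem mem_HeCoideal_iff (he : e * e = e) (hf : f * f = f) :
    f ∈ HeCoideal X e ↔ e * f = e ∧ f * e = e := by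
  constructor
  · intro h
    have h2 : f * e * (f * e) = f * e := by
      rw [mul_assoc, ← mul_assoc e, ← h.1, mul_assoc, he, ← mul_assoc, hf]
    have := eq_of_mem_maxSubgroup_of_mul_self h.2 h2
    exact ⟨h.1 ▸ this, this⟩
  · rintro ⟨h1, h2⟩
    exact ⟨by rw [h1, h2], by rw [h2]; exact self_mem_maxSubgroup he⟩

theorem mem_HeCoideal_of_spow_eq (hz : z ∈ centerSet X) {n : ℕ} (he : e * e = e)
    (h : spow z n = e) : z ∈ HeCoideal X e := by
  have hec : e ∈ centerSet X := h ▸ spow_mem_centerSet hz n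
  have hzw : z * spow z (n + n) = e := by
    rw [mul_spow_self, ← spow_mul_spow, h, he]
  have hwz : spow z (n + n) * z = e := by rw [← hz, hzw]
  refine ⟨hz e, by rw [mul_assoc, he], by rw [hz, ← mul_assoc, he], spow z (n + n) * e,
    by rw [mul_assoc, he], by rw [hec, mul_assoc, he], ?_, ?_⟩
  · rw [mul_assoc, ← mul_assoc e, hec, mul_assoc, he, ← mul_assoc, hzw, he]
  · rw [mul_assoc, ← mul_assoc e, hec, mul_assoc, he, ← mul_assoc, hwz, he]

theorem mem_maxSubgroup_of_spow_eq {n : ℕ} (hz : z ∈ maxSubgroup X f) (he : e * e = e)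
    (h : spow z n = e) : z ∈ maxSubgroup X e := by
  have : e = f := eq_of_mem_maxSubgroup_of_mul_self (h ▸ spow_mem_maxSubgroup hz n) he
  rwa [this]

end MaxSubgroup

theorem Subgroup.countable_closure {G : Type*} [Group G] {s : Set G} (hs : s.Countable) :
    Countable (Subgroup.closure s) := by
  have := hs.to_subtype
  have hF : Countable (FreeGroup s) := by
    unfold FreeGroup
    infer_instance
  have h := FreeGroup.range_lift_eq_closure (f := ((↑) : s → G))
  rw [Subtype.range_coe] at h
  rw [← h]
  exact (MonoidHom.rangeRestrict_surjective (FreeGroup.lift ((↑) : s → G))).countable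

/-- A commutative group embeds into a power of the circle. -/
theorem exists_injective_pi_circle (D : Type u) [CommGroup D] :
    ∃ (ι : Type u) (χ : D →* (ι → Circle)), Function.Injective χ := by
  let j : AddCircle (1 : ℚ) →+ AddCircle (1 : ℝ) :=
    QuotientAddGroup.map _ _ (algebraMap ℚ ℝ).toAddMonoidHom (by
      rw [AddSubgroup.zmultiples_le, AddSubgroup.mem_comap]
      exact ⟨1, by simp⟩)
  have hj : ∀ a, j a = 0 → a = 0 := fun a ha => by
    induction a using QuotientAddGroup.induction_on with
    | H q =>
      rw [QuotientAddGroup.map_mk, QuotientAddGroup.eq_zero_iff] at ha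
      obtain ⟨n, hn⟩ := ha
      refine (QuotientAddGroup.eq_zero_iff q).2 ⟨n, ?_⟩
      have : (n : ℝ) = (q : ℝ) := by simpa using hn
      have : (n : ℚ) = q := by exact_mod_cast this
      simpa using this
  refine ⟨CharacterModule (Additive D),
    { toFun := fun d c => AddCircle.toCircle (j (c (Additive.ofMul d)))
      map_one' := by
        funext c
        simp
      map_mul' := fun a b => by
        funext c
        simp [AddCircle.toCircle_add] },
    (injective_iff_map_eq_one _).2 fun d hd => ?_⟩
  by_contra hne
  obtain ⟨c, hc⟩ := CharacterModule.exists_character_apply_ne_zero_of_ne_zero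
    (a := Additive.ofMul d) (by simpa using hne)
  refine hc (hj _ (AddCircle.injective_toCircle one_ne_zero ?_))
  rw [AddCircle.toCircle_zero]
  exact congrFun hd c

theorem not_isClosed_range_of_countable {D P : Type*} [Group D] [Countable D] [Infinite D]
    [Group P] [TopologicalSpace P] [IsTopologicalGroup P] [CompactSpace P] [T2Space P]
    (χ : D →* P) (hχ : Function.Injective χ) : ¬ IsClosed (range χ) := fun hcl => by
  have hcl' : IsClosed (χ.range : Set P) := by rwa [MonoidHom.coe_range]
  have : CompactSpace χ.range := isCompact_iff_compactSpace.1 hcl'.isCompact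
  have : Countable χ.range := (χ.rangeRestrict_surjective).countable
  have : Infinite χ.range := Infinite.of_injective _ (χ.rangeRestrict_injective_iff.2 hχ)
  obtain ⟨d, hd⟩ := nonempty_interior_of_iUnion_of_closed
    (f := fun d : χ.range => ({d} : Set χ.range)) (fun _ => isClosed_singleton)
    (iUnion_of_singleton _)
  have hd' : IsOpen ({d} : Set χ.range) := by
    rw [← interior_eq_iff_isOpen]
    exact (subset_singleton_iff_eq.1 interior_subset).resolve_left hd.ne_empty
  have hone : IsOpen ({1} : Set χ.range) := by
    convert hd'.preimage (continuous_const_mul d) using 1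
    ext x
    simp
  have := discreteTopology_of_isOpen_singleton_one hone
  have : Finite χ.range := finite_of_compact_of_discrete
  exact _root_.not_finite χ.range

/-- A group with an infinite central subgroup has a non-closed homomorphic image in a
zero-dimensional topological group. -/
theorem exists_hom_not_isClosed_range {H D : Type u} [Group H] [CommGroup D] [Countable D]
    [Infinite D] (i : D →* H) (hi : Function.Injective i) (hc : ∀ d h, i d * h = h * i d) :
    ∃ (Q : Type u) (_ : Group Q) (_ : TopologicalSpace Q) (_ : IsTopologicalGroup Q)
      (_ : T1Space Q) (φ : H →* Q), HasClopenBasis Q ∧ ¬ IsClosed (range φ) := by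
  obtain ⟨ι, χ, hχ⟩ := exists_injective_pi_circle D
  have hncl := not_isClosed_range_of_countable χ hχ
  obtain ⟨p, hp, hpχ⟩ : ∃ p ∈ closure (range χ), p ∉ range χ := by
    by_contra! hcon
    exact hncl (isClosed_of_closure_subset hcon)
  let K : Subgroup (ι → Circle) := Subgroup.closure (insert p (range χ))
  have hK : Countable K := Subgroup.countable_closure ((countable_range χ).insert p)
  have hχK : ∀ d, χ d ∈ K := fun d => Subgroup.subset_closure (Or.inr ⟨d, rfl⟩)
  let pK : K := ⟨p, Subgroup.subset_closure (Or.inl rfl)⟩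
  let χK : D →* K := χ.codRestrict K hχK
  let _ : TopologicalSpace H := ⊥
  have : DiscreteTopology H := ⟨rfl⟩
  let N : Subgroup (H × K) := (i.prod χK⁻¹).range
  have hmem : ∀ (h : H) (k : K), (h, k) ∈ N ↔ ∃ d, i d = h ∧ (χK d)⁻¹ = k := fun h k => by
    simp [N, MonoidHom.mem_range, Prod.ext_iff]
  have hnormal : N.Normal := ⟨by
    rintro ⟨h, k⟩ hhk ⟨h', k'⟩
    obtain ⟨d, rfl, rfl⟩ := (hmem h k).1 hhk
    refine (hmem _ _).2 ⟨d, ?_, ?_⟩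
    · change i d = h' * i d * h'⁻¹
      rw [← hc, mul_inv_cancel_right]
    · change (χK d)⁻¹ = k' * (χK d)⁻¹ * k'⁻¹
      rw [mul_comm k', mul_inv_cancel_right]⟩
  have hNcl : IsClosed (N : Set (H × K)) := by
    refine ⟨isOpen_prod_iff.2 fun h k hhk => ?_⟩
    have hsub : {k' : K | (h, k') ∈ N}.Subsingleton := by
      intro k₁ h₁ k₂ h₂
      obtain ⟨d₁, hd₁, rfl⟩ := (hmem _ _).1 h₁
      obtain ⟨d₂, hd₂, rfl⟩ := (hmem _ _).1 h₂
      rw [hi (hd₁.trans hd₂.symm)]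
    refine ⟨{h}, {k' : K | (h, k') ∈ N}ᶜ, isOpen_discrete _, hsub.isClosed.isOpen_compl, rfl,
      hhk, ?_⟩
    rintro ⟨h', k'⟩ ⟨h1, h2⟩
    obtain rfl : h' = h := h1
    exact h2
  have hT3 : T3Space ((H × K) ⧸ N) := QuotientGroup.instT3Space N
  have hCR : CompletelyRegularSpace ((H × K) ⧸ N) :=
    @UniformSpace.toCompletelyRegularSpace _ (IsTopologicalGroup.rightUniformSpace _)
  let π : H × K → (H × K) ⧸ N := QuotientGroup.mk
  have hπ : Continuous π := QuotientGroup.continuous_mk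
  let φ : H →* (H × K) ⧸ N := (QuotientGroup.mk' N).comp (MonoidHom.inl H K)
  refine ⟨(H × K) ⧸ N, inferInstance, inferInstance, inferInstance, inferInstance, φ, ?_, ?_⟩
  · refine HasClopenBasis.of_locally_countable fun q => ?_
    obtain ⟨⟨h, k⟩, rfl⟩ := QuotientGroup.mk_surjective q
    refine ⟨π '' ({h} ×ˢ univ), QuotientGroup.isOpenMap_coe _
      ((isOpen_discrete _).prod isOpen_univ), ⟨(h, k), ⟨rfl, trivial⟩, rfl⟩, ?_⟩
    exact ((countable_singleton h).prod (countable_univ)).image _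
  · intro hcl
    have hpK : pK ∈ closure (range χK) := by
      rw [closure_subtype, ← range_comp]
      exact hp
    have hmaps : ∀ k ∈ range χK, π (1, k) ∈ range φ := by
      rintro _ ⟨d, rfl⟩
      refine ⟨i d, QuotientGroup.eq.2 ((hmem _ _).2 ⟨d⁻¹, ?_, ?_⟩)⟩
      · simp
      · simp
    have hκ : Continuous fun k : K => π (1, k) :=
      hπ.comp (continuous_const.prodMk continuous_id)
    obtain ⟨h, hh⟩ : π (1, pK) ∈ range φ :=
      hcl.closure_subset (map_mem_closure (f := fun k : K => π (1, k)) hκ hpK hmaps)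
    obtain ⟨d, -, hd⟩ := (hmem _ _).1 (QuotientGroup.eq.1 hh)
    refine hpχ ⟨d⁻¹, ?_⟩
    have := congrArg Subtype.val hd
    simpa [χK, pK] using this

/-- The topology on `WithZero Q` in which `0` is isolated. -/
@[reducible]
def withZeroTopology (Q : Type*) [TopologicalSpace Q] : TopologicalSpace (WithZero Q) :=
  TopologicalSpace.coinduced ((↑) : Q → WithZero Q) inferInstance

section WithZero

attribute [local instance] withZeroTopology

theorem preimage_coe_withZero_image {Q : Type*} (W : Set Q) :
    ((↑) : Q → WithZero Q) ⁻¹' ((↑) '' W) = W :=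
  preimage_image_eq W WithZero.coe_injective

theorem preimage_coe_withZero_zero {Q : Type*} : ((↑) : Q → WithZero Q) ⁻¹' {0} = ∅ := by
  ext q
  simp

theorem t1Space_withZero {Q : Type*} [TopologicalSpace Q] [T1Space Q] :
    T1Space (WithZero Q) := ⟨fun y => by
  rw [isClosed_coinduced]
  exact (subsingleton_singleton.preimage WithZero.coe_injective).isClosed⟩

theorem hasClopenBasis_withZero {Q : Type*} [TopologicalSpace Q] (h : HasClopenBasis Q) :
    HasClopenBasis (WithZero Q) := by
  refine HasClopenBasis.of_forall fun y U hU hy => ?_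
  induction y with
  | zero =>
    refine ⟨{0}, ⟨isClosed_coinduced.2 ?_, isOpen_coinduced.2 ?_⟩, rfl, by simpa using hy⟩ <;>
    rw [preimage_coe_withZero_zero]
    exacts [isClosed_empty, isOpen_empty]
  | coe q =>
    obtain ⟨W, hW, hqW, hWU⟩ := h.exists_isClopen (isOpen_coinduced.1 hU) hy
    refine ⟨(↑) '' W, ⟨isClosed_coinduced.2 ?_, isOpen_coinduced.2 ?_⟩, ⟨q, hqW, rfl⟩,
      image_subset_iff.2 hWU⟩ <;>
    rw [preimage_coe_withZero_image]
    exacts [hW.isClosed, hW.isOpen]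

theorem continuousMul_withZero {Q : Type*} [TopologicalSpace Q] [Mul Q] [ContinuousMul Q] :
    ContinuousMul (WithZero Q) := by
  refine ⟨continuous_def.2 fun s hs => isOpen_prod_iff.2 fun p q hpq => ?_⟩
  have hzero : IsOpen ({0} : Set (WithZero Q)) := by
    rw [isOpen_coinduced, preimage_coe_withZero_zero]
    exact isOpen_empty
  induction p with
  | zero =>
    refine ⟨{0}, univ, hzero, isOpen_univ, rfl, trivial, ?_⟩
    rintro ⟨a, b⟩ ⟨ha, -⟩
    obtain rfl : a = 0 := ha
    simpa using hpq
  | coe p =>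
    induction q with
    | zero =>
      refine ⟨univ, {0}, isOpen_univ, hzero, trivial, rfl, ?_⟩
      rintro ⟨a, b⟩ ⟨-, hb⟩
      obtain rfl : b = 0 := hb
      simpa using hpq
    | coe q =>
      have hopen := (isOpen_coinduced.1 hs).preimage (continuous_mul (M := Q))
      obtain ⟨u, v, hu, hv, hpu, hqv, huv⟩ := isOpen_prod_iff.1 hopen p q hpq
      refine ⟨(↑) '' u, (↑) '' v, ?_, ?_, ⟨p, hpu, rfl⟩, ⟨q, hqv, rfl⟩, ?_⟩
      · rwa [isOpen_coinduced, preimage_coe_withZero_image]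
      · rwa [isOpen_coinduced, preimage_coe_withZero_image]
      · rintro ⟨_, _⟩ ⟨⟨a, ha, rfl⟩, ⟨b, hb, rfl⟩⟩
        exact huv (⟨ha, hb⟩ : (a, b) ∈ u ×ˢ v)

theorem AbsolutelyTzSClosed.isClosed_image_coideal {X Q : Type u} [Semigroup X] [Semigroup Q]
    [TopologicalSpace Q] [ContinuousMul Q] [T1Space Q] (hX : AbsolutelyTzSClosed X)
    (hQ : HasClopenBasis Q) {F : Set X} (hF : IsPrimeCoideal F) (φ : X → Q)
    (hφ : ∀ a ∈ F, ∀ b ∈ F, φ (a * b) = φ a * φ b) : IsClosed (φ '' F) := by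
  classical
  have := t1Space_withZero (Q := Q)
  have := continuousMul_withZero (Q := Q)
  let h : X →ₙ* WithZero Q :=
    { toFun := fun x => if x ∈ F then φ x else 0
      map_mul' := fun a b => by
        by_cases ha : a ∈ F <;> by_cases hb : b ∈ F <;> simp [hF a b, ha, hb]
        rw [hφ a ha b hb, WithZero.coe_mul] }
  have := isClosed_coinduced.1 (hX (WithZero Q) (hasClopenBasis_withZero hQ) h)
  convert this using 1
  ext q
  simp only [mem_image, mem_preimage, mem_range]
  refine exists_congr fun x => ?_
  by_cases hx : x ∈ F <;> simp [h, hx]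

end WithZero

/-- The central part of the maximal subgroup at a viable idempotent is finite. -/
theorem AbsolutelyTzSClosed.finite_center_inter_maxSubgroup {X : Type u} [Semigroup X]
    (hX : AbsolutelyTzSClosed X) {e : X} (he : e ∈ viableIdems X) :
    (centerSet X ∩ maxSubgroup X e).Finite := by
  by_contra hinf
  let _ : Group (maxSubgroup X e) := maxSubgroupGroup he.1
  have hmul : ∀ a b : maxSubgroup X e, ((a * b : maxSubgroup X e) : X) = a * b := fun _ _ => rfl
  let seq := Set.Infinite.natEmbedding _ hinf
  let c : ℕ → Subgroup.center (maxSubgroup X e) := fun n => ⟨⟨seq n, (seq n).2.2⟩,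
    Subgroup.mem_center_iff.2 fun g => Subtype.ext ((seq n).2.1 g).symm⟩
  have hc : Function.Injective c := fun m n hmn =>
    seq.injective (Subtype.ext
      (congrArg (fun a : Subgroup.center (maxSubgroup X e) => ((a : maxSubgroup X e) : X)) hmn))
  let D := Subgroup.closure (range c)
  let _ : CommGroup D :=
    { (inferInstance : Group D) with
      mul_comm := fun a b => Subtype.ext (Subtype.ext
        (Subgroup.mem_center_iff.1 b.1.2 a.1.1)) }
  have : Countable D := Subgroup.countable_closure (countable_range c)
  have : Infinite D := Infinite.of_injective
    (fun n => (⟨c n, Subgroup.subset_closure ⟨n, rfl⟩⟩ : D)) fun m n hmn =>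
      hc (congrArg Subtype.val hmn)
  obtain ⟨Q, _, _, _, _, φ, hQ, hncl⟩ := exists_hom_not_isClosed_range
    (D := D) ((Subgroup.center (maxSubgroup X e)).subtype.comp D.subtype)
    ((Subgroup.subtype_injective _).comp (Subgroup.subtype_injective _))
    fun d h => (Subgroup.mem_center_iff.1 d.1.2 h).symm
  classical
  let ψ : X → Q := fun x => if hx : x * e ∈ maxSubgroup X e then φ ⟨x * e, hx⟩ else 1
  refine hncl ?_
  convert hX.isClosed_image_coideal hQ (isPrimeCoideal_HeCoideal he) ψ ?_ using 1
  · ext q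
    constructor
    · rintro ⟨a, rfl⟩
      refine ⟨a, mem_HeCoideal_of_mem_maxSubgroup a.2, ?_⟩
      have : (a : X) * e ∈ maxSubgroup X e := by rw [a.2.1]; exact a.2
      simp only [ψ, this, dif_pos]
      congr
      exact a.2.1
    · rintro ⟨x, hx, rfl⟩
      exact ⟨⟨x * e, hx.2⟩, by simp [ψ, hx.2]⟩
  · intro a ha b hb
    have hab := mul_mem_HeCoideal ha hb he.1
    simp only [ψ, ha.2, hb.2, hab.1.2, dif_pos, ← map_mul]
    congr 1
    exact Subtype.ext hab.2

theorem IsIdealSet.spow_mem {X : Type*} [Semigroup X] {J : Set X} (hJ : IsIdealSet X J) {x : X}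
    {m n : ℕ} (hmn : m ≤ n) (h : spow x m ∈ J) : spow x n ∈ J := by
  induction n, hmn using Nat.le_induction with
  | base => exact h
  | succ n _ ih => exact (hJ _ ih x).1

theorem IsIdealSet.spow_mem_of_eq_mul {X : Type*} [Semigroup X] {J : Set X} (hJ : IsIdealSet X J)
    {b z : X} (hb : b ∈ centerSet X) {s : WithOne X} (h : (z : WithOne X) = b * s) {n : ℕ}
    (hn : spow b n ∈ J) : spow z n ∈ J := by
  induction s with
  | one =>
    rw [mul_one, WithOne.coe_inj] at h
    rwa [h]
  | coe t =>
    rw [← WithOne.coe_mul, WithOne.coe_inj] at h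
    rw [h, spow_mul (hb t)]
    exact (hJ _ hn _).1

theorem isIdealSet_setOf_not_dvd {X : Type*} [Semigroup X] (z : WithOne X) :
    IsIdealSet X {x | ∀ u v : WithOne X, u * x * v ≠ z} := by
  refine fun x hx y => ⟨fun u v h => hx u (y * v) ?_, fun u v h => hx (u * y) v ?_⟩
  · rw [← h, WithOne.coe_mul]
    simp only [mul_assoc]
  · rw [← h, WithOne.coe_mul]
    simp only [mul_assoc]

/-- Central elements nilpotent modulo an ideal are nilpotent of bounded index. -/
theorem AbsolutelyTzSClosed.exists_spow_mem {X : Type u} [Semigroup X]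
    (hX : AbsolutelyTzSClosed X) {J : Set X} (hJ : IsIdealSet X J) :
    ∃ d, ∀ z ∈ centerSet X, (∃ n, spow z n ∈ J) → spow z d ∈ J := by
  let N : Set X := {z | z ∈ centerSet X ∧ ∃ n, spow z n ∈ J}
  have hNmul : ∀ a ∈ N, ∀ b ∈ N, a * b ∈ N := by
    rintro a ⟨ha, n, hn⟩ b ⟨hb, -⟩
    exact ⟨centerSet_mul_mem ha hb, n, by rw [spow_mul (ha b)]; exact (hJ _ hn _).1⟩
  let P : Set X := {x | x ∈ J ∨ ∃ b ∈ N, ∃ c ∈ N, ∃ s : WithOne X, (x : WithOne X) = b * c * s}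
  have hP : IsIdealSet X P := by
    rintro x (hx | ⟨b, hb, c, hc, s, hs⟩) y
    · exact ⟨Or.inl (hJ x hx y).1, Or.inl (hJ x hx y).2⟩
    · refine ⟨Or.inr ⟨b, hb, c, hc, s * y, ?_⟩, Or.inr ⟨b, hb, c, hc, y * s, ?_⟩⟩
      · rw [WithOne.coe_mul, hs, mul_assoc]
      · rw [WithOne.coe_mul, hs, ← mul_assoc, ← WithOne.coe_mul b, ← WithOne.coe_mul y,
          ← (hNmul b hb c hc).1 y, WithOne.coe_mul, mul_assoc]
  have hR : (N \ P).Finite := by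
    refine hX.finite_of_mul_mem hP (fun a ha => ha.1.1) (fun a ha => ha.2) fun a ha b hb =>
      Or.inr ⟨a, ha.1, b, hb.1, 1, by rw [mul_one, WithOne.coe_mul]⟩
  choose! ν hν using fun (z : X) (hz : z ∈ N) => hz.2
  obtain ⟨d, hd⟩ := (hR.image ν).bddAbove
  have hRd : ∀ z ∈ N \ P, spow z d ∈ J := fun z hz =>
    hJ.spow_mem (hd ⟨z, hz, rfl⟩) (hν z hz.1)
  refine ⟨d, fun z hz hzJ => ?_⟩
  by_contra hzd
  have hstep : ∀ x : {x // x ∈ N ∧ spow x d ∉ J}, ∃ b : {x // x ∈ N ∧ spow x d ∉ J},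
      ∃ c ∈ N, ∃ s : WithOne X, (x : WithOne X) = (b : X) * c * s := by
    rintro ⟨x, hx, hxd⟩
    have hxP : x ∈ P := by
      by_contra hxP
      exact hxd (hRd x ⟨hx, hxP⟩)
    rcases hxP with hxJ | ⟨b, hb, c, hc, s, hs⟩
    · exact absurd (hJ.spow_mem (Nat.zero_le d) hxJ) hxd
    · exact ⟨⟨b, hb, fun hbd => hxd (hJ.spow_mem_of_eq_mul hb.1 (s := c * s)
        (by rw [hs, mul_assoc]) hbd)⟩, c, hc, s, hs⟩
  choose b c hc s hs using hstep
  let z₀ : {x // x ∈ N ∧ spow x d ∉ J} := ⟨z, ⟨hz, hzJ⟩, hzd⟩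
  let β : ℕ → {x // x ∈ N ∧ spow x d ∉ J} := fun n => b^[n] z₀
  have hβ : ∀ n, ((β n : X) : WithOne X) = (β (n + 1) : X) * c (β n) * s (β n) := fun n => by
    have : β (n + 1) = b (β n) := Function.iterate_succ_apply' b n z₀
    rw [this]
    exact hs (β n)
  obtain ⟨q, hq0, hqs⟩ : ∃ q : ℕ → X, q 0 = c (β 0) ∧ ∀ n, q (n + 1) = q n * c (β (n + 1)) :=
    ⟨fun n => Nat.rec (c (β 0)) (fun n y => y * c (β (n + 1))) n, rfl, fun _ => rfl⟩
  have hqN : ∀ n, q n ∈ N := by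
    intro n
    induction n with
    | zero => exact hq0 ▸ hc _
    | succ n ih => exact hqs n ▸ hNmul _ ih _ (hc _)
  have hqr : ∀ i j, i < j → ∃ r ∈ N, q j = q i * r := by
    intro i j hij
    induction j, Nat.succ_le_of_lt hij using Nat.le_induction with
    | base => exact ⟨_, hc _, hqs i⟩
    | succ j hj ih =>
      obtain ⟨r, hr, hqr⟩ := ih hj
      exact ⟨_, hNmul r hr _ (hc (β (j + 1))), by rw [hqs, hqr, mul_assoc]⟩
  let U : Set X := {x | ∀ u v : WithOne X, u * x * v ≠ z}
  have hU : IsIdealSet X U := isIdealSet_setOf_not_dvd _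
  have hqU : ∀ n, q n ∉ U := by
    intro n hn
    have : ∃ t, (z : WithOne X) = ((β (n + 1) : X) : WithOne X) * ((q n : X) : WithOne X) * t := by
      clear hn
      induction n with
      | zero => exact ⟨_, hq0 ▸ hβ 0⟩
      | succ n ih =>
        obtain ⟨t, ht⟩ := ih
        refine ⟨s (β (n + 1)) * t, ?_⟩
        have hcomm : ((β (n + 1) : X) : WithOne X) * (q n : X) = (q n : X) * (β (n + 1) : X) := by
          rw [← WithOne.coe_mul, ← WithOne.coe_mul, (hqN n).1]
        have hcomm' : ((β (n + 2) : X) : WithOne X) * (q n : X) = (q n : X) * (β (n + 2) : X) := by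
          rw [← WithOne.coe_mul, ← WithOne.coe_mul, (hqN n).1]
        rw [ht, hcomm, hβ (n + 1), hqs, WithOne.coe_mul, ← mul_assoc _ ((q n : X) : WithOne X),
          hcomm']
        simp only [mul_assoc]
    obtain ⟨t, ht⟩ := this
    exact hn _ _ ht.symm
  have hJU : ∀ x ∈ J, x ∉ U → False := by
    intro x hx hxU
    simp only [U, mem_ofPred_eq, not_forall, not_not] at hxU
    obtain ⟨u, v, huv⟩ := hxU
    have hxv : ∃ y ∈ J, (y : WithOne X) = x * v := by
      induction v with
      | one => exact ⟨x, hx, (mul_one _).symm⟩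
      | coe v => exact ⟨x * v, (hJ x hx v).1, WithOne.coe_mul _ _⟩
    obtain ⟨y, hy, hyv⟩ := hxv
    rw [mul_assoc, ← hyv] at huv
    have hzJ' : z ∈ J := by
      induction u with
      | one =>
        rw [one_mul, WithOne.coe_inj] at huv
        rwa [← huv]
      | coe u =>
        rw [← WithOne.coe_mul, WithOne.coe_inj] at huv
        rw [← huv]
        exact (hJ y hy u).2
    exact hzd (hJ.spow_mem (Nat.zero_le d) hzJ')
  have hex : ∃ μ, ∃ i, spow (q i) μ ∈ U := by
    obtain ⟨n, hn⟩ := (hqN 0).2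
    exact ⟨n, 0, by_contra (hJU _ hn)⟩
  classical
  obtain ⟨i₀, hi₀⟩ := Nat.find_spec hex
  have hmin : ∀ μ < Nat.find hex, ∀ i, spow (q i) μ ∉ U := fun μ hμ i h =>
    Nat.find_min hex hμ ⟨i, h⟩
  obtain ⟨μ, hμ⟩ : ∃ μ, Nat.find hex = μ + 1 := by
    refine Nat.exists_eq_succ_of_ne_zero fun h0 => hqU i₀ ?_
    rw [h0] at hi₀
    exact hi₀
  rw [hμ] at hi₀ hmin
  have hμU : ∀ i, spow (q i) μ ∉ U := hmin μ (Nat.lt_succ_self μ)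
  have hge : ∀ i, i₀ ≤ i → spow (q i) (μ + 1) ∈ U := by
    intro i hi
    rcases hi.eq_or_lt with rfl | hlt
    · exact hi₀
    · obtain ⟨r, hr, hqr⟩ := hqr _ _ hlt
      rw [hqr, spow_mul ((hqN _).1 r)]
      exact (hU _ hi₀ _).1
  have hprod : ∀ i j, i₀ ≤ i → i ≤ j → spow (q i) μ * spow (q j) μ ∈ U := by
    intro i j hi hij
    have hii : spow (q i) μ * spow (q i) μ ∈ U := by
      rw [spow_mul_spow]
      exact hU.spow_mem (by omega) (hge i hi)
    rcases hij.eq_or_lt with rfl | hlt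
    · exact hii
    · obtain ⟨r, hr, hqr⟩ := hqr _ _ hlt
      rw [hqr, spow_mul ((hqN _).1 r), ← mul_assoc]
      exact (hU _ hii _).1
  have hinj : ∀ i j, i < j → spow (q i) μ ≠ spow (q j) μ := by
    intro i j hij heq
    obtain ⟨r, ⟨hr, n, hn⟩, hqr⟩ := hqr _ _ hij
    rw [hqr, spow_mul ((hqN _).1 r)] at heq
    have hpow : ∀ k, spow (q i) μ = spow (q i) μ * spow (spow r μ) k := by
      intro k
      induction k with
      | zero => exact heq
      | succ k ih =>
        rw [spow, ← mul_assoc, ← ih]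
        exact heq
    refine hJU (spow (q i) μ) ?_ (hμU i)
    rw [hpow n, spow_spow]
    refine (hJ _ (hJ.spow_mem ?_ hn) _).2
    omega
  let a : ℕ → X := fun k => spow (q (i₀ + k)) μ
  have ha : Function.Injective a := by
    intro i j h
    by_contra hne
    rcases Nat.lt_or_gt_of_ne hne with hij | hij
    · exact hinj _ _ (by omega) h
    · exact hinj _ _ (by omega) h.symm
  refine infinite_range_of_injective ha (hX.finite_of_mul_mem hU ?_ ?_ ?_)
  · rintro _ ⟨k, rfl⟩
    exact spow_mem_centerSet (hqN _).1 _
  · rintro _ ⟨k, rfl⟩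
    exact hμU _
  · rintro _ ⟨k, rfl⟩ _ ⟨l, rfl⟩
    rcases le_total k l with h | h
    · exact hprod _ _ (by omega) (by omega)
    · rw [spow_mem_centerSet (hqN _).1]
      exact hprod _ _ (by omega) (by omega)

section Viable

variable {X : Type u} [Semigroup X]

theorem HeCoideal_subset {e f : X} (hf : f ∈ viableIdems X) (h : e ∈ HeCoideal X f) :
    HeCoideal X e ⊆ HeCoideal X f := fun x hx => by
  obtain ⟨w, hw, hxw, -⟩ := exists_inv_mem_maxSubgroup hx.2
  have hF := isPrimeCoideal_HeCoideal hf
  rw [← hxw] at h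
  exact ((hF _ _).1 ((hF _ _).1 h).1).1

theorem eq_of_mem_HeCoideal {e f : X} (he : e * e = e) (hf : f * f = f) (h : e ∈ HeCoideal X f)
    (h' : f ∈ HeCoideal X e) : e = f :=
  ((mem_HeCoideal_iff he hf).1 h').1.symm.trans ((mem_HeCoideal_iff hf he).1 h).2

/-- A sequence of distinct viable idempotents contains an infinite antichain. -/
theorem AbsolutelyTzSClosed.exists_antichain (hX : AbsolutelyTzSClosed X) {e : ℕ → X}
    (he : Function.Injective e) (hv : ∀ n, e n ∈ viableIdems X) :
    ∃ φ : ℕ ↪o ℕ, ∀ i j, e (φ i) ∈ HeCoideal X (e (φ j)) → i = j := by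
  have hself : ∀ n, e n ∈ HeCoideal X (e n) := fun n =>
    mem_HeCoideal_of_mem_maxSubgroup (self_mem_maxSubgroup (hv n).1)
  have hprime := fun n => isPrimeCoideal_HeCoideal (hv n)
  have hanti : ∀ i j, e i ∈ HeCoideal X (e j) → e j ∈ HeCoideal X (e i) → i = j := fun i j h h' =>
    he (eq_of_mem_HeCoideal (hv i).1 (hv j).1 h h')
  let r : ℕ → ℕ → Prop := fun i j => e j ∈ HeCoideal X (e i)
  have : IsTrans ℕ r := ⟨fun i j k hij hjk => HeCoideal_subset (hv i) hij hjk⟩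
  have : IsTrans ℕ (Function.swap r) := ⟨fun i j k hij hjk => HeCoideal_subset (hv k) hjk hij⟩
  obtain ⟨g, hg | hg⟩ := exists_increasing_or_nonincreasing_subseq r id
  · refine (hX.no_decreasing_coideals (fun j => HeCoideal X (e (g j))) (fun _ => hprime _)
      (fun i => e (g i)) fun i j => ⟨fun h => ?_, fun h => ?_⟩).elim
    · by_contra! hij
      exact hij.ne (g.injective (hanti _ _ h (hg i j hij)))
    · rcases h.eq_or_lt with rfl | h
      exacts [hself _, hg _ _ h]
  obtain ⟨g', hg' | hg'⟩ := exists_increasing_or_nonincreasing_subseq (Function.swap r) g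
  · refine (hX.no_increasing_coideals (fun j => HeCoideal X (e (g (g' j)))) (fun _ => hprime _)
      (monotone_nat_of_le_succ fun n => HeCoideal_subset (hv _) (hg' n (n + 1) n.lt_succ_self))
      (fun i => e (g (g' i))) fun i j => ⟨fun h => ?_, fun h => ?_⟩).elim
    · by_contra! hij
      exact hij.ne' (g'.injective (g.injective (hanti _ _ h (hg' j i hij))))
    · rcases h.eq_or_lt with rfl | h
      exacts [hself _, hg' _ _ h]
  · refine ⟨g'.trans g, fun i j h => ?_⟩
    by_contra hne
    rcases Nat.lt_or_gt_of_ne hne with hij | hij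
    · exact hg' i j hij h
    · exact hg _ _ (g'.strictMono hij) h

theorem isIdealSet_setOf_mem_maxSubgroup {e : X} (he : e ∈ viableIdems X) :
    IsIdealSet X {x | x ∈ HeCoideal X e → x ∈ maxSubgroup X e} := by
  have hF := isPrimeCoideal_HeCoideal he
  refine fun x hx y => ⟨fun h => ?_, fun h => ?_⟩
  · have h' := (hF x y).1 h
    have hx' := hx h'.1
    have : x * y = x * (y * e) := by rw [h'.2.1, ← mul_assoc, hx'.1]
    rw [this]
    exact mul_mem_maxSubgroup hx' h'.2.2
  · have h' := (hF y x).1 h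
    have hx' := hx h'.2
    have : y * x = y * e * x := by rw [mul_assoc, hx'.2.1]
    rw [this]
    exact mul_mem_maxSubgroup h'.1.2 hx'

theorem isIdealSet_iInter {ι : Sort*} {J : ι → Set X} (hJ : ∀ i, IsIdealSet X (J i)) :
    IsIdealSet X (⋂ i, J i) := fun x hx y =>
  ⟨mem_iInter.2 fun i => (hJ i x (mem_iInter.1 hx i) y).1,
    mem_iInter.2 fun i => (hJ i x (mem_iInter.1 hx i) y).2⟩

theorem AbsolutelyTzSClosed.exists_spow_mem_maxSubgroup (hX : AbsolutelyTzSClosed X) {e : X}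
    (he : e ∈ viableIdems X) :
    ∃ d, ∀ z ∈ centerSet X, (∃ n, spow z n = e) → spow z d ∈ maxSubgroup X e := by
  obtain ⟨d, hd⟩ := hX.exists_spow_mem (isIdealSet_setOf_mem_maxSubgroup he)
  refine ⟨d, fun z hz ⟨n, hn⟩ => hd z hz ⟨n, ?_⟩ ?_⟩
  · intro _
    rw [hn]
    exact self_mem_maxSubgroup he.1
  · exact ((isPrimeCoideal_HeCoideal he).spow_mem_iff z d).2 (mem_HeCoideal_of_spow_eq hz he.1 hn)

theorem spow_mem_maxSubgroup_of_le {e z : X} (he : e ∈ viableIdems X) {m n : ℕ} (hmn : m ≤ n)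
    (h : spow z m ∈ maxSubgroup X e) : spow z n ∈ maxSubgroup X e := by
  have hF := isPrimeCoideal_HeCoideal he
  refine (isIdealSet_setOf_mem_maxSubgroup he).spow_mem hmn (fun _ => h) ?_
  exact (hF.spow_mem_iff z n).2 ((hF.spow_mem_iff z m).1 (mem_HeCoideal_of_mem_maxSubgroup h))

theorem exists_not_mem_maxSubgroup_of_spow_eq {e z : X} (he : e ∈ viableIdems X)
    (hz : z ∈ centerSet X) (hze : z ∉ maxSubgroup X e) {n : ℕ} (hn : spow z n = e) :
    ∃ w ∈ centerSet X, w ∉ maxSubgroup X e ∧ w * w ∈ maxSubgroup X e ∧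
      ∀ F : Set X, IsPrimeCoideal F → (w ∈ F ↔ e ∈ F) := by
  classical
  have hex : ∃ n, spow z n ∈ maxSubgroup X e := ⟨n, by
    rw [hn]; exact self_mem_maxSubgroup he.1⟩
  have hspec := Nat.find_spec hex
  obtain ⟨m, hm⟩ : ∃ m, Nat.find hex = m + 1 := by
    refine Nat.exists_eq_succ_of_ne_zero fun h0 => hze ?_
    rw [h0] at hspec
    exact hspec
  rw [hm] at hspec
  refine ⟨spow z m, spow_mem_centerSet hz m, Nat.find_min hex (hm ▸ m.lt_succ_self), ?_,
    fun F hF => by rw [hF.spow_mem_iff, ← hn, hF.spow_mem_iff]⟩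
  rw [spow_mul_spow]
  exact spow_mem_maxSubgroup_of_le he (by omega) hspec

/-- Only finitely many viable idempotents have a central root outside their maximal
subgroup. -/
theorem AbsolutelyTzSClosed.finite_setOf_root_not_mem (hX : AbsolutelyTzSClosed X) {A : Set X}
    (hA : A ⊆ viableIdems X) :
    {e ∈ A | ∃ z ∈ centerSet X, z ∉ maxSubgroup X e ∧ ∃ n, spow z n = e}.Finite := by
  by_contra hinf
  let e := Set.Infinite.natEmbedding _ hinf
  obtain ⟨φ, hφ⟩ := hX.exists_antichain (e := fun n => (e n : X))
    (Subtype.val_injective.comp e.injective) fun n => hA (e n).2.1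
  have hv : ∀ k, (e (φ k) : X) ∈ viableIdems X := fun k => hA (e (φ k)).2.1
  have hw : ∀ k, ∃ w ∈ centerSet X, w ∉ maxSubgroup X (e (φ k)) ∧
      w * w ∈ maxSubgroup X (e (φ k)) ∧
      ∀ F : Set X, IsPrimeCoideal F → (w ∈ F ↔ (e (φ k) : X) ∈ F) := fun k => by
    obtain ⟨z, hz, hzk, n, hn⟩ := (e (φ k)).2.2
    exact exists_not_mem_maxSubgroup_of_spow_eq (hv k) hz hzk hn
  choose w hwc hwn hww hwF using hw
  have hwj : ∀ k j, w k ∈ HeCoideal X (e (φ j)) ↔ k = j := fun k j => by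
    rw [hwF k _ (isPrimeCoideal_HeCoideal (hv j))]
    refine ⟨hφ k j, ?_⟩
    rintro rfl
    exact mem_HeCoideal_of_mem_maxSubgroup (self_mem_maxSubgroup (hv k).1)
  have hinj : Function.Injective w := fun k j hkj => (hwj k j).1 (hkj ▸ (hwj j j).2 rfl)
  refine infinite_range_of_injective hinj (hX.finite_of_mul_mem
    (isIdealSet_iInter fun k => isIdealSet_setOf_mem_maxSubgroup (hv k)) ?_ ?_ ?_)
  · rintro _ ⟨k, rfl⟩
    exact hwc k
  · rintro _ ⟨k, rfl⟩ h
    exact hwn k (mem_iInter.1 h k ((hwj k k).2 rfl))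
  · rintro _ ⟨k, rfl⟩ _ ⟨l, rfl⟩
    refine mem_iInter.2 fun j h => ?_
    obtain ⟨h1, h2⟩ := (isPrimeCoideal_HeCoideal (hv j) _ _).1 h
    obtain rfl := (hwj k j).1 h1
    obtain rfl := (hwj l k).1 h2
    exact hww l

theorem AbsolutelyTzSClosed.exists_spow_mem_maxSubgroup_of_subset (hX : AbsolutelyTzSClosed X)
    {A : Set X} (hA : A ⊆ viableIdems X) :
    ∃ d, ∀ z ∈ centerSet X, ∀ n, spow z n ∈ A → spow z d ∈ maxSubgroup X (spow z n) := by
  choose! δ hδ using fun (e : X) (he : e ∈ viableIdems X) => hX.exists_spow_mem_maxSubgroup he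
  obtain ⟨d, hd⟩ := ((hX.finite_setOf_root_not_mem hA).image δ).bddAbove
  refine ⟨d, fun z hz n hn => ?_⟩
  by_cases h : z ∈ maxSubgroup X (spow z n)
  · exact spow_mem_maxSubgroup h d
  · exact spow_mem_maxSubgroup_of_le (hA hn) (hd ⟨_, ⟨hn, z, hz, h, n, rfl⟩, rfl⟩)
      (hδ _ (hA hn) z hz ⟨n, rfl⟩)

theorem AbsolutelyTzSClosed.boundedSet_of_boundedSet_cliffordPart (hX : AbsolutelyTzSClosed X)
    {A : Set X} (hA : A ⊆ viableIdems X)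
    (h : BoundedSet X (centerSet X ∩ cliffordPart X ∩ sqrtSet X A)) :
    BoundedSet X (centerSet X ∩ sqrtSet X A) := by
  obtain ⟨d, hd⟩ := hX.exists_spow_mem_maxSubgroup_of_subset hA
  obtain ⟨n, hn⟩ := h
  refine ⟨d * n + d + n, fun z ⟨hz, k, hk⟩ => ?_⟩
  rw [← spow_spow]
  refine hn _ ⟨⟨spow_mem_centerSet hz d, mem_biUnion (hA hk).1 (hd z hz k hk)⟩, k, ?_⟩
  have : spow (spow z d) k = spow z k := by
    rw [spow_spow, show d * k + d + k = k * d + k + d by ring, ← spow_spow]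
    exact spow_of_mul_self (hA hk).1 d
  rwa [this]

theorem AbsolutelyTzSClosed.exists_spow_eq (hX : AbsolutelyTzSClosed X) {e g : X}
    (he : e ∈ viableIdems X) (hg : g ∈ maxSubgroup X e) (hgc : g ∈ centerSet X) :
    ∃ n, spow g n = e := by
  obtain ⟨i, -, j, -, hij, heq⟩ := infinite_univ.exists_lt_map_eq_of_mapsTo
    (f := spow g) (t := centerSet X ∩ maxSubgroup X e)
    (fun n _ => ⟨spow_mem_centerSet hgc n, spow_mem_maxSubgroup hg n⟩)
    (hX.finite_center_inter_maxSubgroup he)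
  refine ⟨j - i - 1, ?_⟩
  refine mul_right_cancel_of_mem_maxSubgroup (spow_mem_maxSubgroup hg i)
    (spow_mem_maxSubgroup hg _) (self_mem_maxSubgroup he.1) ?_
  rw [spow_mul_spow, (spow_mem_maxSubgroup hg i).2.1, heq]
  congr 1
  omega

theorem AbsolutelyTzSClosed.centrobounded_of_boundedSet (hX : AbsolutelyTzSClosed X)
    {A B : Set X} (hA : A ⊆ viableIdems X) (hB : B ⊆ A)
    (h : BoundedSet X (centerSet X ∩ sqrtSet X A)) : Centrobounded B := by
  obtain ⟨n, hn⟩ := h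
  refine ⟨n, fun e he x _ y _ w _ _ _ hg hgc => hn _ ⟨hgc, ?_⟩⟩
  obtain ⟨k, hk⟩ := hX.exists_spow_eq (hA (hB he)) hg hgc
  exact ⟨k, by rw [hk]; exact hB he⟩

end Viable

open Classical in
/-- The multiplication of `adjoinSemigroup`. -/
noncomputable def adjoinMul {S : Type*} [Semigroup S] (o : S) (T : Set S) :
    Option S → Option S → Option S
  | some a, some b => some (a * b)
  | some a, none => if a ∈ T then none else some o
  | none, some a => if a ∈ T then none else some o
  | none, none => some o

/-- Adjunction of a point `y` to a semigroup with zero `o` such that `t * y = y * t = y` for `t`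
in a prime coideal `T` and all other products involving `y` are equal to `o`. -/
@[reducible]
noncomputable def adjoinSemigroup {S : Type*} [Semigroup S] {o : S}
    (ho : ∀ x, o * x = o ∧ x * o = o) {T : Set S} (hT : IsPrimeCoideal T) (hoT : o ∉ T) :
    Semigroup (Option S) where
  mul := adjoinMul o T
  mul_assoc := by
    have hol : ∀ x, o * x = o := fun x => (ho x).1
    have hor : ∀ x, x * o = o := fun x => (ho x).2
    intro a b c
    change adjoinMul o T (adjoinMul o T a b) c = adjoinMul o T a (adjoinMul o T b c)
    rcases a with _ | a <;> rcases b with _ | b <;> rcases c with _ | c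
    · simp [adjoinMul]
    · by_cases hc : c ∈ T <;> simp [adjoinMul, hc, hol, hoT]
    · by_cases hb : b ∈ T <;> simp [adjoinMul, hb, hoT]
    · by_cases hb : b ∈ T <;> by_cases hc : c ∈ T <;> simp [adjoinMul, hb, hc, hT b c, hol]
    · by_cases ha : a ∈ T <;> simp [adjoinMul, ha, hor, hoT]
    · by_cases ha : a ∈ T <;> by_cases hc : c ∈ T <;> simp [adjoinMul, ha, hc, hol, hor]
    · by_cases ha : a ∈ T <;> by_cases hb : b ∈ T <;> simp [adjoinMul, ha, hb, hT a b, hor]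
    · simp [adjoinMul, mul_assoc]

theorem AbsolutelyTzSClosed.false_of_zero {S : Type u} [Semigroup S] (hS : AbsolutelyTzSClosed S)
    {o : S} (ho : ∀ x, o * x = o ∧ x * o = o) {T : Set S} (hT : IsPrimeCoideal T) (hoT : o ∉ T)
    (C : Bool → ℕ → Set S) (hanti : ∀ b, Antitone (C b)) (hoC : ∀ b, o ∉ C b 0)
    (hdisj : ∀ v ∈ C true 0, v ∉ C false 0) (hCT : ∀ b, ∀ v ∈ C b 0, v ∉ T)
    (hleave : ∀ b p, ∃ n, p ∉ C b n) (hne : ∀ n, (C true n).Nonempty)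
    (hTC : ∀ b, ∀ t ∈ T, ∀ n, ∀ v ∈ C b n, t * v ∈ C b n ∧ v * t ∈ C b n)
    (haC : ∀ b, ∀ a ∉ T, ∃ n, ∀ v ∈ C b n, a * v = o ∧ v * a = o)
    (hmul : ∀ b c n, ∀ v ∈ C b (n + 1), ∀ w ∈ C c (n + 1), v * w ∈ C false n ∨ v * w = o) :
    False := by
  let _ : Semigroup (Option S) := adjoinSemigroup ho hT hoT
  have hss : ∀ a b : S, (some a * some b : Option S) = some (a * b) := fun _ _ => rfl
  let pt : Bool → Option S := fun b => if b then none else some o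
  have hpt : Function.Injective pt := by
    rintro (_ | _) (_ | _) h <;> simp_all [pt]
  have hTpt : ∀ b, ∀ t ∈ T, some t * pt b = pt b ∧ pt b * some t = pt b := by
    rintro (_ | _) t ht
    · exact ⟨congrArg some (ho t).2, congrArg some (ho t).1⟩
    · exact ⟨if_pos ht, if_pos ht⟩
  have hapt : ∀ b, ∀ a ∉ T, some a * pt b = some o ∧ pt b * some a = some o := by
    rintro (_ | _) a ha
    · exact ⟨congrArg some (ho a).2, congrArg some (ho a).1⟩
    · exact ⟨if_neg ha, if_neg ha⟩
  have hptpt : ∀ b c, pt b * pt c = some o := by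
    rintro b (_ | _)
    · exact (hapt b o hoT).2
    · rcases b with _ | _
      · exact if_neg hoT
      · rfl
  have hC0 : ∀ {b n v}, v ∈ C b n → v ∈ C b 0 := fun {b n v} h => hanti b (Nat.zero_le n) h
  have hvpt : ∀ {b n v}, v ∈ C b n → ∀ c, some v ≠ pt c := by
    rintro b n v hv (_ | _) h
    · exact hoC b (Option.some_injective _ h ▸ hC0 hv)
    · exact Option.some_ne_none _ h
  let N : Option S → ℕ → Set (Option S) := fun p n =>
    {x | x = p ∨ ∃ b, p = pt b ∧ ∃ v ∈ C b n, x = some v}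
  have hNpt : ∀ {b n x}, x ∈ N (pt b) n → x = pt b ∨ ∃ v ∈ C b n, x = some v := by
    rintro b n x (h | ⟨c, hc, h⟩)
    · exact Or.inl h
    · exact Or.inr (hpt hc ▸ h)
  have hleave' : ∀ p q, p ≠ q → ∃ n, q ∉ N p n := by
    intro p q hpq
    by_cases hp : ∃ b, p = pt b
    · obtain ⟨b, rfl⟩ := hp
      rcases q with _ | v
      · refine ⟨0, fun h => ?_⟩
        rcases hNpt h with h | ⟨v, -, h⟩
        exacts [hpq h.symm, Option.some_ne_none _ h.symm]
      · obtain ⟨n, hn⟩ := hleave b v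
        refine ⟨n, fun h => ?_⟩
        rcases hNpt h with h | ⟨w, hw, h⟩
        exacts [hpq h.symm, hn (Option.some_injective _ h ▸ hw)]
    · refine ⟨0, ?_⟩
      rintro (h | ⟨b, hb, -⟩)
      exacts [hpq h.symm, hp ⟨b, hb⟩]
  have hsingle : ∀ {p n}, (∀ b, p ≠ pt b) → ∀ x ∈ N p n, x = p := by
    rintro p n hp x (h | ⟨b, hb, -⟩)
    exacts [h, absurd hb (hp b)]
  have hN : ∀ p n, p ∈ N p n := fun _ _ => Or.inl rfl
  have hanti' : ∀ p, Antitone (N p) := by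
    rintro p m n hmn x (h | ⟨b, hb, v, hv, h⟩)
    exacts [Or.inl h, Or.inr ⟨b, hb, v, hanti b hmn hv, h⟩]
  let c : ClopenNhds (Option S) :=
    { N := N
      mem := hN
      anti := hanti'
      isOpen' := by
        rintro p n q (rfl | ⟨b, rfl, v, hv, rfl⟩)
        · exact ⟨n, Subset.rfl⟩
        · refine ⟨0, fun x hx => ?_⟩
          rw [hsingle (hvpt hv) x hx]
          exact Or.inr ⟨b, rfl, v, hv, rfl⟩
      isClosed' := by
        intro p n q hq
        have hqp : q ≠ p := fun h => hq (h ▸ hN p n)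
        obtain ⟨m, hm⟩ := hleave' q p hqp
        refine ⟨m, disjoint_left.2 ?_⟩
        rintro x (rfl | ⟨b, rfl, v, hv, rfl⟩) hx
        · exact hq hx
        · rcases hx with rfl | ⟨c, rfl, w, hw, h⟩
          · exact hm (Or.inr ⟨b, rfl, v, hv, rfl⟩)
          · obtain rfl := Option.some_injective _ h
            rcases b with _ | _ <;> rcases c with _ | _
            exacts [hqp rfl, hdisj v (hC0 hw) (hC0 hv), hdisj v (hC0 hv) (hC0 hw), hqp rfl]
      mul' := by
        have hleft : ∀ p q n, ∃ m, ∀ x ∈ N (some p) m, ∀ y ∈ N (pt q) m,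
            (∀ b, some p ≠ pt b) → x * y ∈ N (some p * pt q) n ∧ y * x ∈ N (pt q * some p) n := by
          intro p b n
          by_cases hp : p ∈ T
          · refine ⟨n, fun x hx y hy hsp => ?_⟩
            rw [hsingle hsp x hx, (hTpt b p hp).1, (hTpt b p hp).2]
            rcases hNpt hy with rfl | ⟨v, hv, rfl⟩
            · rw [(hTpt b p hp).1, (hTpt b p hp).2]
              exact ⟨hN _ _, hN _ _⟩
            · exact ⟨Or.inr ⟨b, rfl, _, (hTC b p hp n v hv).1, rfl⟩,
                Or.inr ⟨b, rfl, _, (hTC b p hp n v hv).2, rfl⟩⟩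
          · obtain ⟨m, hm⟩ := haC b p hp
            refine ⟨m, fun x hx y hy hsp => ?_⟩
            rw [hsingle hsp x hx, (hapt b p hp).1, (hapt b p hp).2]
            rcases hNpt hy with rfl | ⟨v, hv, rfl⟩
            · rw [(hapt b p hp).1, (hapt b p hp).2]
              exact ⟨hN _ _, hN _ _⟩
            · rw [hss, hss, (hm v hv).1, (hm v hv).2]
              exact ⟨hN _ _, hN _ _⟩
        intro p q n
        by_cases hp : ∃ b, p = pt b <;> by_cases hq : ∃ b, q = pt b
        · obtain ⟨b, rfl⟩ := hp
          obtain ⟨c, rfl⟩ := hq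
          refine ⟨n + 1, fun x hx y hy => ?_⟩
          rw [hptpt]
          rcases hNpt hx with rfl | ⟨v, hv, rfl⟩ <;> rcases hNpt hy with rfl | ⟨w, hw, rfl⟩
          · rw [hptpt]
            exact hN _ _
          · rw [(hapt b w (hCT c w (hC0 hw))).2]
            exact hN _ _
          · rw [(hapt c v (hCT b v (hC0 hv))).1]
            exact hN _ _
          · rcases hmul b c n v hv w hw with h | h
            · exact Or.inr ⟨false, rfl, _, h, rfl⟩
            · rw [hss, h]
              exact hN _ _
        · obtain ⟨b, rfl⟩ := hp
          rcases q with _ | q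
          · exact absurd ⟨true, rfl⟩ hq
          · obtain ⟨m, hm⟩ := hleft q b n
            exact ⟨m, fun x hx y hy => (hm y hy x hx fun b hb => hq ⟨b, hb⟩).2⟩
        · obtain ⟨b, rfl⟩ := hq
          rcases p with _ | p
          · exact absurd ⟨true, rfl⟩ hp
          · obtain ⟨m, hm⟩ := hleft p b n
            exact ⟨m, fun x hx y hy => (hm x hx y hy fun b hb => hp ⟨b, hb⟩).1⟩
        · refine ⟨0, fun x hx y hy => ?_⟩
          rw [hsingle (fun b hb => hp ⟨b, hb⟩) x hx, hsingle (fun b hb => hq ⟨b, hb⟩) y hy]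
          exact hN _ _
      sep := hleave' }
  obtain ⟨x, hx⟩ := hS.exists_eq_of_clopenNhds c ⟨some, fun _ _ => rfl⟩ none fun n => by
    obtain ⟨v, hv⟩ := hne n
    exact ⟨v, Or.inr ⟨true, rfl, v, hv, rfl⟩⟩
  exact Option.some_ne_none x hx

theorem reesMk_mem_image {X : Type*} [Semigroup X] {U : Set X} (hU : IsIdealSet X U) {A : Set X}
    (hA : ∀ a ∈ A, a ∉ U) {x : X} : reesMk hU x ∈ reesMk hU '' A ↔ x ∈ A := by
  refine ⟨?_, fun h => ⟨x, h, rfl⟩⟩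
  rintro ⟨a, ha, h⟩
  rcases (reesMk_eq hU).1 h with rfl | ⟨haU, -⟩
  exacts [ha, absurd haU (hA a ha)]

theorem AbsolutelyTzSClosed.false_of_ideal {X : Type u} [Semigroup X] (hX : AbsolutelyTzSClosed X)
    {I : Set X} (hI : IsIdealSet X I) {o : X} (ho : o ∈ I) {T : Set X} (hT : IsPrimeCoideal T)
    (hTI : ∀ t ∈ T, t ∉ I) (C : Bool → ℕ → Set X) (hanti : ∀ b, Antitone (C b))
    (hCI : ∀ b n, ∀ v ∈ C b n, v ∉ I) (hdisj : ∀ v ∈ C true 0, v ∉ C false 0)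
    (hCT : ∀ b, ∀ v ∈ C b 0, v ∉ T) (hleave : ∀ b p, ∃ n, p ∉ C b n)
    (hne : ∀ n, (C true n).Nonempty)
    (hTC : ∀ b, ∀ t ∈ T, ∀ n, ∀ v ∈ C b n, t * v ∈ C b n ∧ v * t ∈ C b n)
    (haC : ∀ b, ∀ a ∉ T, ∃ n, ∀ v ∈ C b n, a * v ∈ I ∧ v * a ∈ I)
    (hmul : ∀ b c n, ∀ v ∈ C b (n + 1), ∀ w ∈ C c (n + 1), v * w ∈ C false n ∨ v * w ∈ I) :
    False := by
  have hzero : ∀ x ∈ I, reesMk hI x = reesMk hI o := fun x hx => (reesMk_eq hI).2 (Or.inr ⟨hx, ho⟩)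
  have hsurj := reesMk_surjective hI
  refine (hX.of_surjective _ hsurj).false_of_zero (reesMk_zero hI ho) (T := reesMk hI '' T)
    ?_ ?_ (fun b n => reesMk hI '' C b n) (fun b m n hmn => image_mono (hanti b hmn)) ?_ ?_ ?_ ?_
    (fun n => (hne n).image _) ?_ ?_ ?_
  · intro a b
    obtain ⟨a, rfl⟩ := hsurj a
    obtain ⟨b, rfl⟩ := hsurj b
    rw [← map_mul, reesMk_mem_image hI hTI, reesMk_mem_image hI hTI, reesMk_mem_image hI hTI, hT]
  · rw [reesMk_mem_image hI hTI]
    exact fun h => hTI o h ho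
  · intro b
    rw [reesMk_mem_image hI (hCI b 0)]
    exact fun h => hCI b 0 o h ho
  · rintro _ ⟨v, hv, rfl⟩
    rw [reesMk_mem_image hI (hCI _ _)]
    exact hdisj v hv
  · rintro b _ ⟨v, hv, rfl⟩
    rw [reesMk_mem_image hI hTI]
    exact hCT b v hv
  · intro b p
    obtain ⟨p, rfl⟩ := hsurj p
    obtain ⟨n, hn⟩ := hleave b p
    exact ⟨n, by rwa [reesMk_mem_image hI (hCI _ _)]⟩
  · rintro b _ ⟨t, ht, rfl⟩ n _ ⟨v, hv, rfl⟩
    exact ⟨⟨_, (hTC b t ht n v hv).1, rfl⟩, ⟨_, (hTC b t ht n v hv).2, rfl⟩⟩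
  · intro b a ha
    obtain ⟨a, rfl⟩ := hsurj a
    rw [reesMk_mem_image hI hTI] at ha
    obtain ⟨n, hn⟩ := haC b a ha
    refine ⟨n, ?_⟩
    rintro _ ⟨v, hv, rfl⟩
    exact ⟨hzero _ (hn v hv).1, hzero _ (hn v hv).2⟩
  · rintro b c n _ ⟨v, hv, rfl⟩ _ ⟨w, hw, rfl⟩
    exact (hmul b c n v hv w hw).imp (fun h => ⟨_, h, rfl⟩) fun h => hzero _ h

section Rays

variable {X : Type u} [Semigroup X]

theorem AbsolutelyTzSClosed.exists_infinite_forall_or_finite (hX : AbsolutelyTzSClosed X)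
    {F : ℕ → Set X} (hF : ∀ k, IsPrimeCoideal (F k)) :
    ∃ K : Set ℕ, K.Infinite ∧ ∀ a, (∀ k ∈ K, a ∈ F k) ∨ {k ∈ K | a ∈ F k}.Finite := by
  by_contra! hcon
  have hstep : ∀ b : {b : X // {k | b ∈ F k}.Infinite}, ∃ c : {b : X // {k | b ∈ F k}.Infinite},
      (∀ k, c.1 ∈ F k → b.1 ∈ F k) ∧ ∃ k, b.1 ∈ F k ∧ c.1 ∉ F k := by
    rintro ⟨b, hb⟩
    obtain ⟨a, ⟨k, hk, hak⟩, ha⟩ := hcon _ hb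
    refine ⟨⟨b * a, ha.mono fun l hl => (hF l b a).2 hl⟩, fun l hl => ((hF l b a).1 hl).1, k, hk,
      fun h => hak ((hF k b a).1 h).2⟩
  obtain ⟨a, -, ha⟩ := hcon univ infinite_univ
  choose next hsub hne using hstep
  let b : ℕ → {b : X // {k | b ∈ F k}.Infinite} := fun n =>
    next^[n] ⟨a, ha.mono fun l hl => hl.2⟩
  have hb : ∀ n, b (n + 1) = next (b n) := fun n => Function.iterate_succ_apply' _ _ _
  have hanti : ∀ k, Antitone fun n => (b n).1 ∈ F k := fun k =>
    antitone_nat_of_succ_le fun n => by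
      rw [hb]
      exact hsub _ k
  refine hX.no_increasing_coideals (fun i => {x | ∀ k, (b i).1 ∈ F k → x ∈ F k}) ?_ ?_
    (fun i => (b i).1) fun i j => ⟨fun h => ?_, fun h k => hanti k h⟩
  · intro i x y
    simp only [mem_ofPred_eq, hF _ x y, ← forall_and]
  · exact fun i j hij x hx k hk => hx k (hanti k hij hk)
  · by_contra! hij
    obtain ⟨k, hk, hk'⟩ := hne (b j)
    rw [← hb] at hk'
    exact hk' (hanti k hij (h k hk))

/-- The set `T¹y` of left translates of `y` by elements of `T`, together with `y`. -/
def leftTranslates (T : Set X) (y : X) : Set X := {v | v = y ∨ ∃ t ∈ T, v = t * y}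

theorem mem_iff_of_mem_leftTranslates {T F : Set X} (hF : IsPrimeCoideal F) (hTF : T ⊆ F)
    {y v : X} (hv : v ∈ leftTranslates T y) : v ∈ F ↔ y ∈ F := by
  rcases hv with rfl | ⟨t, ht, rfl⟩
  · exact Iff.rfl
  · rw [hF, and_iff_right (hTF ht)]

theorem mul_mem_leftTranslates {T : Set X} (hT : ∀ a ∈ T, ∀ b ∈ T, a * b ∈ T) {t y v : X}
    (ht : t ∈ T) (hy : y ∈ centerSet X) (hv : v ∈ leftTranslates T y) :
    t * v ∈ leftTranslates T y ∧ v * t ∈ leftTranslates T y := by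
  rcases hv with rfl | ⟨s, hs, rfl⟩
  · exact ⟨Or.inr ⟨t, ht, rfl⟩, Or.inr ⟨t, ht, hy t⟩⟩
  · exact ⟨Or.inr ⟨t * s, hT t ht s hs, (mul_assoc _ _ _).symm⟩,
      Or.inr ⟨s * t, hT s hs t ht, by rw [mul_assoc, hy, mul_assoc]⟩⟩

theorem mul_mem_leftTranslates_mul {T : Set X} (hT : ∀ a ∈ T, ∀ b ∈ T, a * b ∈ T) {y z v w : X}
    (hy : y ∈ centerSet X) (hv : v ∈ leftTranslates T y) (hw : w ∈ leftTranslates T z) :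
    v * w ∈ leftTranslates T (y * z) := by
  rcases hv with rfl | ⟨s, hs, rfl⟩ <;> rcases hw with rfl | ⟨t, ht, rfl⟩
  · exact Or.inl rfl
  · exact Or.inr ⟨t, ht, by rw [← mul_assoc, hy, mul_assoc]⟩
  · exact Or.inr ⟨s, hs, mul_assoc _ _ _⟩
  · exact Or.inr ⟨s * t, hT s hs t ht, by
      rw [mul_assoc, ← mul_assoc y, hy t]
      simp only [mul_assoc]⟩

theorem AbsolutelyTzSClosed.exists_mem_leftTranslates (hX : AbsolutelyTzSClosed X)
    {F : ℕ → Set X} (hF : ∀ k, IsPrimeCoideal (F k)) {K : Set ℕ} (hK : K.Infinite)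
    (hKF : ∀ a, (∀ k ∈ K, a ∈ F k) ∨ {k ∈ K | a ∈ F k}.Finite) {x : ℕ → X}
    (hx : ∀ k, x k ∈ centerSet X) (hxF : ∀ i j, x i ∈ F j ↔ i = j) {N : ℕ} (hN : 0 < N) :
    ∃ k ∈ K, ∃ j, (j + 2) * N < k ∧ ∃ v ∈ leftTranslates {a | ∀ k ∈ K, a ∈ F k} (x k),
      v ∈ leftTranslates {a | ∀ k ∈ K, a ∈ F k} (spow (x k) (j + 1)) := by
  set T : Set X := {a | ∀ k ∈ K, a ∈ F k} with hTdef
  by_contra! hdisj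
  have hTmul : IsPrimeCoideal T := fun a b =>
    ⟨fun h => ⟨fun k hk => ((hF k a b).1 (h k hk)).1, fun k hk => ((hF k a b).1 (h k hk)).2⟩,
      fun h k hk => (hF k a b).2 ⟨h.1 k hk, h.2 k hk⟩⟩
  have hTmul' : ∀ a ∈ T, ∀ b ∈ T, a * b ∈ T := fun a ha b hb => (hTmul a b).2 ⟨ha, hb⟩
  have hL : ∀ {k l j v}, l ∈ K → v ∈ leftTranslates T (spow (x k) j) → (v ∈ F l ↔ k = l) := by
    intro k l j v hl hv
    rw [mem_iff_of_mem_leftTranslates (hF l) (T := T) (fun t ht => ht l hl) hv,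
      (hF l).spow_mem_iff, hxF]
  let I : Set X := {a | ∀ k ∈ K, a ∉ F k}
  let C : Bool → ℕ → Set X := fun b m => {v | ∃ k ∈ K, ∃ j, (j = 0 ↔ b = true) ∧
    (j + 1) * 2 ^ m * N < k ∧ v ∈ leftTranslates T (spow (x k) j)}
  have hlt : ∀ {k j m}, (j + 1) * 2 ^ m * N < k → m < k := fun {k j m} h =>
    (Nat.lt_two_pow_self.trans_le ((Nat.le_mul_of_pos_left _ j.succ_pos).trans
      (Nat.le_mul_of_pos_right _ hN))).trans h
  obtain ⟨k₀, hk₀⟩ := hK.nonempty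
  obtain ⟨k₁, hk₁, hk₀₁⟩ := hK.exists_gt k₀
  refine hX.false_of_ideal (I := I) (o := x k₀ * x k₁) ?_ ?_ hTmul
    (fun t ht htI => htI k₀ hk₀ (ht k₀ hk₀)) C ?_ ?_ ?_ ?_ ?_ ?_ ?_ ?_ ?_
  · exact fun a ha b => ⟨fun k hk h => ha k hk ((hF k a b).1 h).1,
      fun k hk h => ha k hk ((hF k b a).1 h).2⟩
  · intro k _ h
    rw [hF, hxF, hxF] at h
    omega
  · rintro b m n hmn v ⟨k, hk, j, hj, hlt, hv⟩
    refine ⟨k, hk, j, hj, lt_of_le_of_lt ?_ hlt, hv⟩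
    gcongr
    exact one_le_two
  · rintro b m v ⟨k, hk, j, -, -, hv⟩ hvI
    exact hvI k hk ((hL hk hv).2 rfl)
  · rintro v ⟨k, hk, j, hj, -, hv⟩ ⟨l, hl, i, hi, hlt, hv'⟩
    obtain rfl := hj.2 rfl
    obtain rfl := (hL hl hv).1 ((hL hl hv').2 rfl)
    obtain ⟨i, rfl⟩ := Nat.exists_eq_succ_of_ne_zero fun h0 => Bool.false_ne_true (hi.1 h0)
    refine hdisj k hk i ?_ v hv hv'
    simpa using hlt
  · rintro b v ⟨k, hk, j, -, -, hv⟩ hvT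
    obtain ⟨l, hl, hkl⟩ := hK.exists_gt k
    exact hkl.ne ((hL hl hv).1 (hvT l hl))
  · intro b p
    by_contra! hp
    obtain ⟨k, hk, j, -, -, hv⟩ := hp 0
    obtain ⟨l, hl, i, -, hkl, hv'⟩ := hp k
    exact (hlt hkl).ne ((hL hl hv).1 ((hL hl hv').2 rfl))
  · intro m
    obtain ⟨k, hk, hmk⟩ := hK.exists_gt (2 ^ m * N)
    exact ⟨x k, k, hk, 0, by simp, by simpa using hmk, Or.inl rfl⟩
  · rintro b t ht m v ⟨k, hk, j, hj, hlt, hv⟩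
    have := mul_mem_leftTranslates hTmul' ht (spow_mem_centerSet (hx k) j) hv
    exact ⟨⟨k, hk, j, hj, hlt, this.1⟩, ⟨k, hk, j, hj, hlt, this.2⟩⟩
  · intro b a ha
    obtain ⟨M, hM⟩ := ((hKF a).resolve_left ha).bddAbove
    refine ⟨M, ?_⟩
    rintro v ⟨k, hk, j, -, hMk, hv⟩
    have hak : a ∉ F k := fun h => ((hlt hMk).trans_le (hM ⟨hk, h⟩)).false
    refine ⟨fun l hl h => ?_, fun l hl h => ?_⟩
    · obtain rfl := (hL hl hv).1 ((hF l _ _).1 h).2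
      exact hak ((hF k _ _).1 h).1
    · obtain rfl := (hL hl hv).1 ((hF l _ _).1 h).1
      exact hak ((hF k _ _).1 h).2
  · rintro b c m v ⟨k, hk, i, -, hi, hv⟩ w ⟨l, hl, j, -, hj, hw⟩
    by_cases hkl : k = l
    · subst hkl
      refine Or.inl ⟨k, hk, i + j + 1, by simp, ?_, ?_⟩
      · rw [pow_succ] at hi hj
        nlinarith
      · rw [← spow_mul_spow]
        exact mul_mem_leftTranslates_mul hTmul' (spow_mem_centerSet (hx k) i) hv hw
    · refine Or.inr fun a ha h => hkl ?_
      rw [(hL ha hv).1 ((hF a _ _).1 h).1, (hL ha hw).1 ((hF a _ _).1 h).2]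

end Rays

section Centrobounded

variable {X : Type u} [Semigroup X]

theorem AbsolutelyTzSClosed.exists_sequence_of_not_boundedSet (hX : AbsolutelyTzSClosed X)
    {A : Set X} (hA : A ⊆ viableIdems X)
    (h : ¬ BoundedSet X (centerSet X ∩ cliffordPart X ∩ sqrtSet X A)) :
    ∃ e x : ℕ → X, (∀ k, e k ∈ A) ∧ (∀ k, x k ∈ maxSubgroup X (e k)) ∧
      (∀ k, x k ∈ centerSet X) ∧ (∀ k, ∀ i < k, spow (x k) i ≠ e k) ∧
      ∀ i j, e i ∈ HeCoideal X (e j) → i = j := by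
  have hP : ∀ k, ∃ e ∈ A, ∃ x ∈ maxSubgroup X e, x ∈ centerSet X ∧ ∀ i < k, spow x i ≠ e := by
    intro k
    simp only [BoundedSet, not_exists, not_forall] at h
    obtain ⟨x, ⟨⟨hxc, hxH⟩, m, hm⟩, hxk⟩ := h (k.factorial - 1)
    simp only [cliffordPart, mem_iUnion] at hxH
    obtain ⟨f, -, hxf⟩ := hxH
    refine ⟨_, hm, x, mem_maxSubgroup_of_spow_eq hxf (hA hm).1 rfl, hxc, fun i hi hie => hxk ?_⟩
    obtain ⟨q, hq⟩ := Nat.dvd_factorial i.succ_pos hi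
    obtain ⟨q, rfl⟩ : ∃ r, q = r + 1 := Nat.exists_eq_succ_of_ne_zero fun h0 =>
      k.factorial_ne_zero (by rw [hq, h0, mul_zero])
    have hidx : k.factorial - 1 = i * q + i + q := by
      rw [hq, Nat.succ_mul, mul_add_one]
      omega
    rw [hidx, ← spow_spow, hie, spow_of_mul_self (hA hm).1]
    exact (hA hm).1
  choose E hEA y hyE hyc hyne using hP
  have hκ : ∀ e ∈ A, ∃ n, ∀ k, E k = e → k ≤ n := by
    intro e he
    choose! ν hν using fun g (hg : g ∈ centerSet X ∩ maxSubgroup X e) =>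
      hX.exists_spow_eq (hA he) hg.2 hg.1
    obtain ⟨n, hn⟩ := ((hX.finite_center_inter_maxSubgroup (hA he)).image ν).bddAbove
    refine ⟨n, ?_⟩
    rintro k rfl
    by_contra! hnk
    have hyk : y k ∈ centerSet X ∩ maxSubgroup X (E k) := ⟨hyc k, hyE k⟩
    exact hyne k _ ((hn ⟨_, hyk, rfl⟩).trans_lt hnk) (hν _ hyk)
  choose! κ hκ using hκ
  obtain ⟨f, -, hf⟩ := exists_seq_of_forall_finset_exists (fun _ : ℕ => True)
    (fun i j => κ (E i) < j) fun s _ => ⟨s.sup (fun i => κ (E i)) + 1, trivial, fun i hi =>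
      Nat.lt_succ_of_le (Finset.le_sup (f := fun i => κ (E i)) hi)⟩
  have hmono : StrictMono f := fun m n hmn => (hκ _ (hEA _) _ rfl).trans_lt (hf m n hmn)
  have hinj : Function.Injective fun n => E (f n) := by
    refine Function.Injective.of_lt_imp_ne fun m n hmn heq => ?_
    exact (hf m n hmn).not_ge (hκ _ (hEA _) _ heq.symm)
  obtain ⟨φ, hφ⟩ := hX.exists_antichain hinj fun n => hA (hEA _)
  exact ⟨fun k => E (f (φ k)), fun k => y (f (φ k)), fun k => hEA _, fun k => hyE _,
    fun k => hyc _, fun k i hi => hyne _ i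
      (hi.trans_le ((φ.strictMono.le_apply).trans hmono.le_apply)), hφ⟩

theorem AbsolutelyTzSClosed.boundedSet_of_centrobounded (hX : AbsolutelyTzSClosed X)
    {A : Set X} (hA : A ⊆ viableIdems X)
    (h : ∀ B ⊆ A, B.Countable → B.Infinite → IsIdemAntichain B → Centrobounded B) :
    BoundedSet X (centerSet X ∩ cliffordPart X ∩ sqrtSet X A) := by
  by_contra hunb
  obtain ⟨e, x, heA, hxe, hxc, hxne, hanti⟩ := hX.exists_sequence_of_not_boundedSet hA hunb
  have hF : ∀ k, IsPrimeCoideal (HeCoideal X (e k)) := fun k =>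
    isPrimeCoideal_HeCoideal (hA (heA k))
  have hee : ∀ k, e k * e k = e k := fun k => (hA (heA k)).1
  have heF : ∀ i j, e i ∈ HeCoideal X (e j) ↔ i = j := fun i j => ⟨hanti i j, by
    rintro rfl
    exact mem_HeCoideal_of_mem_maxSubgroup (self_mem_maxSubgroup (hee i))⟩
  have hxF : ∀ i j, x i ∈ HeCoideal X (e j) ↔ i = j := fun i j => by
    obtain ⟨w, hw, hxw, -⟩ := exists_inv_mem_maxSubgroup (hxe i)
    rw [← heF]
    constructor <;> intro hi
    · rw [← (hxe i).1] at hi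
      exact ((hF j _ _).1 hi).2
    · rw [← hxw] at hi
      exact ((hF j _ _).1 hi).1
  have hinj : Function.Injective e := fun i j hij => (heF i j).1 (hij ▸ (heF j j).2 rfl)
  obtain ⟨K, hK, hKF⟩ := hX.exists_infinite_forall_or_finite hF
  obtain ⟨n, hn⟩ := h (e '' K) (image_subset_iff.2 fun k _ => heA k) (K.to_countable.image e)
    (hK.image hinj.injOn) (by
      rintro _ ⟨i, -, rfl⟩ _ ⟨j, -, rfl⟩ hij
      refine ⟨fun h => hij ?_, fun h => hij ?_⟩
      · rw [hanti j i ((mem_HeCoideal_iff (hee i) (hee j)).2 h)]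
      · rw [hanti i j ((mem_HeCoideal_iff (hee j) (hee i)).2 h.symm)])
  obtain ⟨k, hk, j, hjk, v, hv, hv'⟩ := hX.exists_mem_leftTranslates hF hK hKF hxc hxF n.succ_pos
  set T : Set X := {a | ∀ k ∈ K, a ∈ HeCoideal X (e k)} with hT
  have hTmul : ∀ a ∈ T, ∀ b ∈ T, a * b ∈ T := fun a ha b hb l hl =>
    (hF l a b).2 ⟨ha l hl, hb l hl⟩
  have hTmem : ∀ a ∈ T, a ∈ ⋂ f ∈ e '' K, HeCoideal X f := by
    intro a ha
    rw [biInter_image]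
    exact mem_iInter₂.2 ha
  have hpow : ∀ i, spow (x k) i ∈ maxSubgroup X (e k) := spow_mem_maxSubgroup (hxe k)
  have hcancel : ∀ t s : X, t ∈ T → s ∈ T → t * x k = s * spow (x k) (j + 1) → False := by
    intro t s ht hs hts
    obtain ⟨w, hw, hsw, hws⟩ := exists_inv_mem_maxSubgroup (hs k hk).2
    have hte : t * e k = s * e k * spow (x k) j := by
      refine mul_right_cancel_of_mem_maxSubgroup (hxe k) (ht k hk).2
        (mul_mem_maxSubgroup (hs k hk).2 (hpow j)) ?_
      rw [mul_assoc, (hxe k).2.1, hts, spow, mul_assoc s, (hpow j).2.1, mul_assoc]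
    have htw : t * e k * w = spow (x k) j := by
      rw [hte, ← spow_mem_centerSet (hxc k) j (s * e k), mul_assoc, hsw, (hpow j).1]
    have hid := hn (e k) ⟨k, hk, rfl⟩ t (hTmem t ht) s (hTmem s hs) w hw hsw hws
      (htw ▸ hpow j) (htw ▸ spow_mem_centerSet (hxc k) j)
    rw [htw, spow_spow] at hid
    refine hxne k _ ?_ (eq_of_mem_maxSubgroup_of_mul_self (hpow _) hid)
    nlinarith
  have hlift : ∀ {y v t : X}, t ∈ T → v ∈ leftTranslates T y → ∃ s ∈ T, t * v = s * y := by
    rintro y v t ht (rfl | ⟨s, hs, rfl⟩)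
    exacts [⟨t, ht, rfl⟩, ⟨t * s, hTmul t ht s hs, (mul_assoc _ _ _).symm⟩]
  rcases T.eq_empty_or_nonempty with hT0 | ⟨t, ht⟩
  · rcases hv with rfl | ⟨t, ht, -⟩
    · rcases hv' with hv' | ⟨t, ht, -⟩
      · refine hxne k j (by nlinarith) (mul_right_cancel_of_mem_maxSubgroup (hxe k) (hpow j)
          (self_mem_maxSubgroup (hee k)) ?_)
        rw [(hxe k).2.1]
        exact hv'.symm
      · exact (hT0 ▸ ht : t ∈ (∅ : Set X))
    · exact (hT0 ▸ ht : t ∈ (∅ : Set X))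
  · obtain ⟨r, hr, hrv⟩ := hlift ht hv
    obtain ⟨s, hs, hsv⟩ := hlift ht hv'
    exact hcancel r s hr hs (hrv.symm.trans hsv)

end Centrobounded

theorem statement17 (X : Type u) [Semigroup X] (hX : AbsolutelyTzSClosed X)
    (A : Set X) (hA : A ⊆ viableIdems X) :
    (BoundedSet X (centerSet X ∩ sqrtSet X A) ↔
      BoundedSet X (centerSet X ∩ cliffordPart X ∩ sqrtSet X A)) ∧
    (BoundedSet X (centerSet X ∩ sqrtSet X A) ↔
      ∀ B ⊆ A, B.Countable → B.Infinite → IsIdemAntichain B → Centrobounded B) := by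
  have h21 := hX.boundedSet_of_boundedSet_cliffordPart hA
  refine ⟨⟨?_, h21⟩, fun h B hB _ _ _ => hX.centrobounded_of_boundedSet hA hB h,
    fun h => h21 (hX.boundedSet_of_centrobounded hA h)⟩
  rintro ⟨n, hn⟩
  exact ⟨n, fun x hx => hn x ⟨hx.1.1, hx.2⟩⟩
end

section
/- Let X be a semigroup, A ⊆ VE(X) a countable set of viable idempotents, C := ⋂_{e∈A} H_e/e the corresponding prime coideal, H := ∏_{e∈A} H_e, and h : C → H the homomorphism h(x) = (xe)_{e∈A} (well defined since xe = ex ∈ H_e for x ∈ C). Then X is A-centrobounded provided one of the following holds: (1) X is projectively TzS-closed and for every e ∈ A the subsemigroup Ce = {xe : x ∈ C} of H_e is commutative; (2) the semigroup h[C] is polyfinite; (3) X is projectively TzS-closed and h[C] is countable; (4) X is absolutely TzS-closed, the cardinality of h[C] is at most the continuum 𝔠, and for every e ∈ A the subsemigroup Ce of H_e is bounded. -/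
universe u

open Set TopologicalSpace

theorem AbsolutelyTzSClosed.projectively {X : Type u} [Semigroup X]
    (hX : AbsolutelyTzSClosed X) : ProjectivelyTzSClosed X := by
  intro c Y _ _ _ _ hY h _ _
  have := hX Y hY (h.comp (Con.mkMulHom c))
  have hr : Set.range (h.comp (Con.mkMulHom c)) = Set.range h :=
    Function.Surjective.range_comp (f := Con.mkMulHom c) Quotient.mk_surjective h
  rwa [hr] at this

/-- The extension by zero of a homomorphism defined on the complement of an ideal. -/
noncomputable def extendZero {X M : Type*} [Semigroup X] [Semigroup M] (C : Subsemigroup X)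
    (hC : IsIdealSet X (C : Set X)ᶜ) (φ : C →ₙ* M) : X →ₙ* WithZero M :=
  open Classical in
  { toFun := fun x => if hx : x ∈ C then (φ ⟨x, hx⟩ : WithZero M) else 0
    map_mul' := fun x y => by
      by_cases hx : x ∈ C
      · by_cases hy : y ∈ C
        · rw [dif_pos hx, dif_pos hy, dif_pos (C.mul_mem hx hy), ← WithZero.coe_mul, ← map_mul]
          rfl
        · rw [dif_neg hy, dif_neg (show x * y ∉ C from (hC y hy x).2), mul_zero]
      · rw [dif_neg hx, dif_neg (show x * y ∉ C from (hC x hx y).1), zero_mul] }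

theorem extendZero_of_mem {X M : Type*} [Semigroup X] [Semigroup M] {C : Subsemigroup X}
    (hC : IsIdealSet X (C : Set X)ᶜ) (φ : C →ₙ* M) (x : C) :
    extendZero C hC φ x = (φ x : WithZero M) :=
  dif_pos x.2

theorem extendZero_of_notMem {X M : Type*} [Semigroup X] [Semigroup M] {C : Subsemigroup X}
    (hC : IsIdealSet X (C : Set X)ᶜ) (φ : C →ₙ* M) {x : X} (hx : x ∉ C) :
    extendZero C hC φ x = 0 :=
  dif_neg hx

/-- If `X` is projectively `TzS`-closed, then no surjective image `T` of the complement of an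
ideal carries a free filter that behaves like the trace of the neighbourhoods of a zero. -/
theorem ProjectivelyTzSClosed.false_of_filter {X T : Type u} [Semigroup X] [Semigroup T]
    (hX : ProjectivelyTzSClosed X) {C : Subsemigroup X} (hC : IsIdealSet X (C : Set X)ᶜ)
    (φ : C →ₙ* T) (hφ : Function.Surjective φ) (F : Filter T) [F.NeBot]
    (hfree : ∀ t, {t}ᶜ ∈ F)
    (hmul : Filter.Tendsto (fun p : T × T => p.1 * p.2) (F ×ˢ F) F)
    (hleft : ∀ t, Filter.Tendsto (t * ·) F F)
    (hright : ∀ t, Filter.Tendsto (· * t) F F) : False := by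
  let j : T → WithZero (WithZero T) := fun t => WithZero.coe (WithZero.coe t)
  have hjmul : ∀ s t, j s * j t = j (s * t) := fun s t => rfl
  have hjinj : Function.Injective j := fun s t hst =>
    WithZero.coe_injective (WithZero.coe_injective hst)
  let w : WithZero (WithZero T) := WithZero.coe (0 : WithZero T)
  have hwj : ∀ t, w * j t = w := fun t => rfl
  have hjw : ∀ t, j t * w = w := fun t => rfl
  have hww : w * w = w := rfl
  have hj_ne : ∀ t, j t ≠ w := fun t h => WithZero.coe_ne_zero (WithZero.coe_injective h)
  have h0w : (0 : WithZero (WithZero T)) ≠ w := WithZero.zero_ne_coe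
  have hcases : ∀ y : WithZero (WithZero T), y = 0 ∨ y = w ∨ ∃ t, y = j t := by
    intro y
    rcases y with _ | _ | t
    exacts [Or.inl rfl, Or.inr (Or.inl rfl), Or.inr (Or.inr ⟨t, rfl⟩)]
  let G : Filter (WithZero (WithZero T)) := F.map j
  let τ : TopologicalSpace (WithZero (WithZero T)) := nhdsAdjoint w G
  have hnw : nhds w = pure w ⊔ G := nhds_nhdsAdjoint_same w G
  have hn : ∀ y, y ≠ w → nhds y = pure y := fun y hy => nhds_nhdsAdjoint_of_ne G hy
  have hopen : ∀ s : Set (WithZero (WithZero T)), IsOpen s ↔ (w ∈ s → s ∈ G) :=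
    fun s => Iff.rfl
  have hGfree : ∀ y, {y}ᶜ ∈ G := by
    intro y
    rcases hcases y with rfl | rfl | ⟨t, rfl⟩
    · exact Filter.mem_map.2 (Filter.mem_of_superset Filter.univ_mem
        fun t _ => WithZero.coe_ne_zero)
    · exact Filter.mem_map.2 (Filter.mem_of_superset Filter.univ_mem fun t _ => hj_ne t)
    · exact Filter.mem_map.2 (Filter.mem_of_superset (hfree t) fun s hs h => hs (hjinj h))
  have : T1Space (WithZero (WithZero T)) :=
    ⟨fun y => isOpen_compl_iff.1 ((hopen _).2 fun _ => hGfree y)⟩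
  have hbasis : HasClopenBasis (WithZero (WithZero T)) := by
    refine ⟨{s | IsClopen s}, fun s hs => hs,
      isTopologicalBasis_of_isOpen_of_nhds (fun s hs => hs.isOpen) fun y U hy hU => ?_⟩
    by_cases hyw : y = w
    · refine ⟨U, ⟨isOpen_compl_iff.1 ((hopen _).2 fun h => ?_), hU⟩, hy, le_rfl⟩
      exact absurd (hyw ▸ hy) h
    · exact ⟨{y}, ⟨isClosed_singleton, (hopen _).2 fun h => absurd h.symm hyw⟩, rfl,
        Set.singleton_subset_iff.2 hy⟩
  have : ContinuousMul (WithZero (WithZero T)) := by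
    refine ⟨continuous_iff_continuousAt.2 ?_⟩
    rintro ⟨a, b⟩
    rw [ContinuousAt, nhds_prod_eq]
    rcases hcases a with rfl | ha
    · rw [hn 0 h0w, zero_mul, hn 0 h0w, Filter.pure_prod, Filter.tendsto_map'_iff]
      exact Filter.tendsto_pure.2 (Filter.Eventually.of_forall fun y => zero_mul y)
    rcases hcases b with rfl | hb
    · rw [hn 0 h0w, mul_zero, hn 0 h0w, Filter.prod_pure, Filter.tendsto_map'_iff]
      exact Filter.tendsto_pure.2 (Filter.Eventually.of_forall fun y => mul_zero y)
    rcases ha with rfl | ⟨s, rfl⟩ <;> rcases hb with rfl | ⟨t, rfl⟩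
    · rw [hww, hnw, Filter.sup_prod, Filter.prod_sup, Filter.prod_sup, Filter.prod_pure_pure,
        Filter.pure_prod, Filter.prod_pure, Filter.prod_map_map_eq]
      refine Filter.Tendsto.sup (Filter.Tendsto.sup ?_ ?_) (Filter.Tendsto.sup ?_ ?_)
      · exact (Filter.tendsto_pure_pure _ _).mono_right le_sup_left
      · rw [Filter.tendsto_map'_iff, Filter.tendsto_map'_iff]
        exact (Filter.tendsto_pure.2 (Filter.Eventually.of_forall hwj)).mono_right le_sup_left
      · rw [Filter.tendsto_map'_iff, Filter.tendsto_map'_iff]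
        exact (Filter.tendsto_pure.2 (Filter.Eventually.of_forall hjw)).mono_right le_sup_left
      · rw [Filter.tendsto_map'_iff]
        exact (Filter.tendsto_map.comp hmul).mono_right le_sup_right
    · rw [hwj, hnw, hn _ (hj_ne t), Filter.prod_pure, Filter.tendsto_map'_iff]
      refine Filter.Tendsto.sup_sup (Filter.tendsto_pure_pure _ _) ?_
      rw [Filter.tendsto_map'_iff]
      exact Filter.tendsto_map.comp (hright t)
    · rw [hjw, hnw, hn _ (hj_ne s), Filter.pure_prod, Filter.tendsto_map'_iff]
      refine Filter.Tendsto.sup_sup (Filter.tendsto_pure_pure _ _) ?_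
      rw [Filter.tendsto_map'_iff]
      exact Filter.tendsto_map.comp (hleft s)
    · rw [hjmul, hn _ (hj_ne s), hn _ (hj_ne t), hn _ (hj_ne _), Filter.prod_pure_pure]
      exact Filter.tendsto_pure_pure _ _
  let f : X →ₙ* WithZero (WithZero T) :=
    extendZero C hC ⟨fun x => WithZero.coe (φ x), fun x y => by rw [map_mul]; rfl⟩
  have hfC : ∀ x : C, f x = j (φ x) := fun x => extendZero_of_mem hC _ x
  have hfw : ∀ x, f x ≠ w := by
    intro x
    by_cases hx : x ∈ C
    · exact hfC ⟨x, hx⟩ ▸ hj_ne _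
    · exact fun h => h0w ((extendZero_of_notMem hC _ hx).symm.trans h)
  let g : (Con.ker f).Quotient →ₙ* WithZero (WithZero T) :=
    { toFun := fun q => Con.liftOn q f fun _ _ h => h
      map_mul' := fun p q => Con.induction_on₂ p q fun x y => map_mul f x y }
  have hg : ∀ x : X, g x = f x := fun x => rfl
  have hgw : ∀ q, g q ≠ w := fun q => Con.induction_on q hfw
  have hginj : Function.Injective g := fun p q =>
    Con.induction_on₂ p q fun x y hxy => (Con.eq _).2 hxy
  have hclosed := hX (Con.ker f) (WithZero (WithZero T)) hbasis g hginj <| by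
    refine discreteTopology_iff_isOpen_singleton.2 fun p => ?_
    refine ⟨{p.1}, (hopen _).2 fun h => ?_, ?_⟩
    · obtain ⟨q, hq⟩ := p.2
      exact absurd (hq.trans h.symm) (hgw q)
    · ext q
      simp [Subtype.ext_iff]
  have hwmem : w ∈ Set.range g := by
    refine hclosed.closure_eq ▸ mem_closure_iff.2 fun U hU hwU => ?_
    obtain ⟨t, ht⟩ := F.nonempty_of_mem (Filter.mem_map.1 ((hopen U).1 hU hwU))
    obtain ⟨x, rfl⟩ := hφ t
    exact ⟨j (φ x), ht, (x : X), (hg x).trans (hfC x)⟩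
  obtain ⟨q, hq⟩ := hwmem
  exact hgw q hq

theorem ProjectivelyTzSClosed.false_of_filterBasis {X T : Type u} [Semigroup X] [Semigroup T]
    (hX : ProjectivelyTzSClosed X) {C : Subsemigroup X} (hC : IsIdealSet X (C : Set X)ᶜ)
    (φ : C →ₙ* T) (hφ : Function.Surjective φ) {ι : Type*} [LinearOrder ι] [Nonempty ι]
    (V : ι → Set T) (hanti : Antitone V) (hne : ∀ i, (V i).Nonempty)
    (hfree : ∀ t, ∃ i, t ∉ V i)
    (hmul : ∀ i, ∃ k, ∀ a ∈ V k, ∀ b ∈ V k, a * b ∈ V i)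
    (htrans : ∀ i t, ∃ k, ∀ a ∈ V k, t * a ∈ V i ∧ a * t ∈ V i) : False := by
  have hdir : Directed (· ⊇ ·) V := hanti.directed_ge
  have hb := Filter.hasBasis_iInf_principal hdir
  have : (⨅ i, Filter.principal (V i)).NeBot := hb.neBot_iff.2 fun _ => hne _
  refine hX.false_of_filter hC φ hφ (⨅ i, Filter.principal (V i)) (fun t => ?_) ?_
    (fun t => ?_) (fun t => ?_)
  · obtain ⟨i, hi⟩ := hfree t
    exact hb.mem_iff.2 ⟨i, trivial, fun s hs h => hi (h ▸ hs)⟩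
  · refine (hb.prod_self.tendsto_iff hb).2 fun i _ => ?_
    obtain ⟨k, hk⟩ := hmul i
    exact ⟨k, trivial, fun p hp => hk _ hp.1 _ hp.2⟩
  · refine (hb.tendsto_iff hb).2 fun i _ => ?_
    obtain ⟨k, hk⟩ := htrans i t
    exact ⟨k, trivial, fun p hp => (hk p hp).1⟩
  · refine (hb.tendsto_iff hb).2 fun i _ => ?_
    obtain ⟨k, hk⟩ := htrans i t
    exact ⟨k, trivial, fun p hp => (hk p hp).2⟩

section Words

variable {T : Type u} [Semigroup T]

/-- The unary word operations on `T` with constants in `K` built by at most `L` successive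
doublings of length, each paired with its degree. -/
def wordMaps (K : Set T) : ℕ → Set (ℕ × (T → T))
  | 0 => insert (1, id) ((fun k => (0, fun _ => k)) '' K)
  | L + 1 => wordMaps K L ∪
      Set.image2 (fun p q => (p.1 + q.1, fun x => p.2 x * q.2 x)) (wordMaps K L) (wordMaps K L)

theorem wordMaps_mono_right (K : Set T) : Monotone (wordMaps K) :=
  monotone_nat_of_le_succ fun _ => Set.subset_union_left

theorem id_mem_wordMaps (K : Set T) (L : ℕ) : ((1, id) : ℕ × (T → T)) ∈ wordMaps K L :=
  wordMaps_mono_right K (Nat.zero_le L) (Set.mem_insert _ _)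

theorem const_mem_wordMaps {K : Set T} {k : T} (hk : k ∈ K) (L : ℕ) :
    ((0, fun _ => k) : ℕ × (T → T)) ∈ wordMaps K L :=
  wordMaps_mono_right K (Nat.zero_le L) (Set.mem_insert_of_mem _ ⟨k, hk, rfl⟩)

theorem mul_mem_wordMaps {K : Set T} {L : ℕ} {p q : ℕ × (T → T)} (hp : p ∈ wordMaps K L)
    (hq : q ∈ wordMaps K L) :
    ((p.1 + q.1, fun x => p.2 x * q.2 x) : ℕ × (T → T)) ∈ wordMaps K (L + 1) :=
  Or.inr ⟨p, hp, q, hq, rfl⟩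

theorem wordMaps_finite {K : Set T} (hK : K.Finite) (L : ℕ) : (wordMaps K L).Finite := by
  induction L with
  | zero => exact (hK.image _).insert _
  | succ L ih => exact ih.union (ih.image2 _ ih)

theorem mk_wordMaps_le (K : Set T) (L : ℕ) :
    Cardinal.mk (wordMaps K L) ≤ max (Cardinal.mk K) Cardinal.aleph0 := by
  have h0 : Cardinal.aleph0 ≤ max (Cardinal.mk K) Cardinal.aleph0 := le_max_right _ _
  induction L with
  | zero =>
    refine Cardinal.mk_insert_le.trans (Cardinal.add_le_of_le h0
      (Cardinal.mk_image_le.trans (le_max_left _ _)) ?_)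
    exact Cardinal.one_le_aleph0.trans h0
  | succ L ih =>
    refine (Cardinal.mk_union_le _ _).trans (Cardinal.add_le_of_le h0 ih ?_)
    rw [← Set.image_prod]
    refine Cardinal.mk_image_le.trans ?_
    rw [Cardinal.mk_setProd]
    exact Cardinal.mul_le_of_le h0 (by simpa using ih) (by simpa using ih)

theorem const_apply_mem_wordMaps {K K' : Set T} (hK : K ⊆ K') {x : T} (hx : x ∈ K') {L : ℕ}
    {p : ℕ × (T → T)} (hp : p ∈ wordMaps K L) :
    ((0, fun _ => p.2 x) : ℕ × (T → T)) ∈ wordMaps K' L := by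
  induction L generalizing p with
  | zero =>
    rcases hp with rfl | ⟨k, hk, rfl⟩
    exacts [const_mem_wordMaps hx 0, const_mem_wordMaps (hK hk) 0]
  | succ L ih =>
    rcases hp with hp | ⟨p, hp, q, hq, rfl⟩
    exacts [wordMaps_mono_right _ (Nat.le_succ L) (ih hp), mul_mem_wordMaps (ih hp) (ih hq)]

theorem map_wordMaps_apply {K : Set T} {L : ℕ} {p : ℕ × (T → T)} (hp : p ∈ wordMaps K L)
    {G : Type*} [Group G] (ψ : T →ₙ* G) {z : G} (hz : ∀ t, Commute z (ψ t)) {x y : T}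
    (hxy : ψ x = z * ψ y) : ψ (p.2 x) = z ^ p.1 * ψ (p.2 y) := by
  induction L generalizing p with
  | zero =>
    rcases hp with rfl | ⟨k, hk, rfl⟩ <;> simp [hxy]
  | succ L ih =>
    rcases hp with hp | ⟨p, hp, q, hq, rfl⟩
    · exact ih hp
    · simp only [map_mul, ih hp, ih hq, pow_add, mul_assoc]
      rw [← mul_assoc (ψ (p.2 y)), ← ((hz (p.2 y)).pow_left q.1).eq, mul_assoc]

/-- There is a uniform bound on the orders of the central ratios `z = ψ x * (ψ y)⁻¹`, over all
homomorphisms `ψ` from `T` to groups. -/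
def HasBoundedCentralRatios (T : Type u) [Semigroup T] : Prop :=
  ∃ n : ℕ, 0 < n ∧ ∀ (G : Type u) [Group G] (ψ : T →ₙ* G) (x y : T) (z : G),
    (∀ t, Commute z (ψ t)) → ψ x = z * ψ y → z ^ n = 1

theorem map_spow {G : Type*} [Group G] (ψ : T →ₙ* G) (x : T) (n : ℕ) :
    ψ (spow x n) = ψ x ^ (n + 1) := by
  induction n with
  | zero => simp [spow]
  | succ n ih => rw [spow, map_mul, ih, ← pow_succ]

/-- The elements `x ^ (i + 1) * y ^ (N - i + 1)` differ by powers of the central ratio. -/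
theorem map_spow_mul_spow {G : Type*} [Group G] (ψ : T →ₙ* G) {x y : T} {z : G}
    (hz : ∀ t, Commute z (ψ t)) (hxy : ψ x = z * ψ y) {i N : ℕ} (hi : i ≤ N) :
    ψ (spow x i * spow y (N - i)) = z ^ (i + 1) * ψ y ^ (N + 2) := by
  rw [map_mul, map_spow, map_spow, hxy, (hz y).mul_pow, mul_assoc, ← pow_add]
  congr 2
  omega

theorem pow_factorial_eq_one {G : Type*} [Group G] {z : G} {a b M : ℕ} (hab : a < b)
    (hb : b ≤ M) (h : z ^ a = z ^ b) : z ^ M.factorial = 1 := by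
  have h1 : z ^ (b - a) = 1 := by rw [pow_sub _ hab.le, h, mul_inv_cancel]
  obtain ⟨c, hc⟩ := Nat.dvd_factorial (Nat.sub_pos_of_lt hab) ((Nat.sub_le b a).trans hb)
  rw [hc, pow_mul, h1, one_pow]

theorem hasBoundedCentralRatios_of_cover {K : Set T} (hK : K.Finite) (L : ℕ)
    (h : ∀ x, ∃ p ∈ wordMaps K L, 1 ≤ p.1 ∧ p.2 x ∈ K) : HasBoundedCentralRatios T := by
  choose p hp hp1 hpK using h
  let S := wordMaps K L ×ˢ K
  have hS : S.Finite := (wordMaps_finite hK L).prod hK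
  have : Fintype S := hS.fintype
  obtain ⟨D, hD⟩ := ((wordMaps_finite hK L).image Prod.fst).bddAbove
  let N := Fintype.card S
  refine ⟨((N + 1) * D).factorial, Nat.factorial_pos _, fun G _ ψ x y z hz hxy => ?_⟩
  let v : ℕ → T := fun i => spow x i * spow y (N - i)
  let c : Fin (N + 1) → S := fun i => ⟨(p (v i), (p (v i)).2 (v i)), hp _, hpK _⟩
  obtain ⟨i, j, hij, hcij⟩ := Fintype.exists_ne_map_eq_of_card_lt c (by simp [N])
  wlog hlt : i < j generalizing i j
  · exact this j i hij.symm hcij.symm (lt_of_le_of_ne (not_lt.1 hlt) hij.symm)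
  have hcij' := Subtype.ext_iff.1 hcij
  have h1 : p (v i) = p (v j) := congrArg Prod.fst hcij'
  have h2 : (p (v i)).2 (v i) = (p (v j)).2 (v j) := congrArg Prod.snd hcij'
  have hi := map_spow_mul_spow ψ hz hxy (Nat.lt_succ_iff.1 i.2)
  have hj := map_spow_mul_spow ψ hz hxy (Nat.lt_succ_iff.1 j.2)
  have hltv : (i : ℕ) < j := hlt
  have hzc : ∀ t, Commute (z ^ ((j : ℕ) - i)) (ψ t) := fun t => (hz t).pow_left _
  have hv : ψ (v j) = z ^ ((j : ℕ) - i) * ψ (v i) := by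
    rw [hi, hj, ← mul_assoc, ← pow_add]
    congr 2
    omega
  have h3 := map_wordMaps_apply (hp (v j)) ψ hzc hv
  rw [← h2, ← h1, right_eq_mul, ← pow_mul] at h3
  have hdD : (p (v i)).1 ≤ D := hD ⟨_, hp _, rfl⟩
  refine pow_factorial_eq_one (a := 0) (b := ((j : ℕ) - i) * (p (v i)).1) ?_ ?_ (by simp [h3])
  · exact Nat.mul_pos (by omega) (hp1 _)
  · exact Nat.mul_le_mul (by have := j.2; omega) hdD

theorem ProjectivelyTzSClosed.exists_finite_cover {X : Type u} [Semigroup X]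
    (hX : ProjectivelyTzSClosed X) {C : Subsemigroup X} (hC : IsIdealSet X (C : Set X)ᶜ)
    (φ : C →ₙ* T) (hφ : Function.Surjective φ) [Countable T] :
    ∃ (K : Set T) (L : ℕ), K.Finite ∧ ∀ x, ∃ p ∈ wordMaps K L, 1 ≤ p.1 ∧ p.2 x ∈ K := by
  rcases isEmpty_or_nonempty T with hT | hT
  · exact ⟨∅, 0, Set.finite_empty, fun x => hT.elim x⟩
  by_contra hcon
  have hx : ∀ (K : Set T) (L : ℕ), ∃ x, K.Finite → ∀ p ∈ wordMaps K L, 1 ≤ p.1 → p.2 x ∉ K := by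
    intro K L
    by_contra! h
    exact hcon ⟨K, L, (h hT.some).1, fun x => (h x).2⟩
  choose g hg using hx
  obtain ⟨t, ht⟩ := exists_surjective_nat T
  let P : Set T → ℕ → ℕ → Set T := fun K i m =>
    (fun p : ℕ × (T → T) => p.2 (g K i)) '' {p | p ∈ wordMaps K m ∧ 1 ≤ p.1}
  let K : ℕ → Set T := fun i =>
    Nat.rec {t 0} (fun i Ki => Ki ∪ {t (i + 1)} ∪ P Ki i i) i
  have hKs : ∀ i, K (i + 1) = K i ∪ {t (i + 1)} ∪ P (K i) i i := fun i => rfl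
  have hKfin : ∀ i, (K i).Finite := by
    intro i
    induction i with
    | zero => exact Set.finite_singleton _
    | succ i ih =>
      rw [hKs]
      exact (ih.union (Set.finite_singleton _)).union
        (((wordMaps_finite ih i).subset fun p hp => hp.1).image _)
  have hKmono : Monotone K := monotone_nat_of_le_succ fun i x hx => Or.inl (Or.inl hx)
  have htK : ∀ i, t i ∈ K i := by
    rintro (_ | i)
    exacts [rfl, Or.inl (Or.inr rfl)]
  have hPmono : ∀ i {m n}, m ≤ n → P (K i) i m ⊆ P (K i) i n := fun i m n hmn =>
    Set.image_mono fun p hp => ⟨wordMaps_mono_right _ hmn hp.1, hp.2⟩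
  have hPK : ∀ {i j m}, i < j → m ≤ i → P (K i) i m ⊆ K j := fun {i j m} hij hm x hx =>
    hKmono hij (Or.inr (hPmono i hm hx))
  have hPP : ∀ {i m a b}, a ∈ P (K i) i m → b ∈ P (K i) i m → a * b ∈ P (K i) i (m + 1) := by
    rintro i m _ _ ⟨p, ⟨hp, hp1⟩, rfl⟩ ⟨q, ⟨hq, hq1⟩, rfl⟩
    exact ⟨_, ⟨mul_mem_wordMaps hp hq, le_add_right hp1⟩, rfl⟩
  have hKP : ∀ {i m a b}, a ∈ K i → b ∈ P (K i) i m →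
      a * b ∈ P (K i) i (m + 1) ∧ b * a ∈ P (K i) i (m + 1) := by
    rintro i m a _ ha ⟨q, ⟨hq, hq1⟩, rfl⟩
    exact ⟨⟨_, ⟨mul_mem_wordMaps (const_mem_wordMaps ha m) hq, le_add_left hq1⟩, rfl⟩,
      ⟨_, ⟨mul_mem_wordMaps hq (const_mem_wordMaps ha m), le_add_right hq1⟩, rfl⟩⟩
  let V : ℕ → Set T := fun n => ⋃ i ≥ n, P (K i) i (i - n)
  have hV : ∀ {n a}, a ∈ V n ↔ ∃ i ≥ n, a ∈ P (K i) i (i - n) := by simp [V]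
  have hVanti : Antitone V := by
    intro m n hmn a ha
    obtain ⟨i, hi, ha⟩ := hV.1 ha
    exact hV.2 ⟨i, hmn.trans hi, hPmono i (Nat.sub_le_sub_left hmn i) ha⟩
  refine hX.false_of_filterBasis hC φ hφ V hVanti (fun n => ?_) (fun a => ?_) (fun n => ?_)
    (fun n a => ?_)
  · exact ⟨_, hV.2 ⟨n, le_rfl, _, ⟨id_mem_wordMaps _ _, le_rfl⟩, rfl⟩⟩
  · obtain ⟨n, rfl⟩ := ht a
    refine ⟨n, fun hn => ?_⟩
    obtain ⟨i, hi, p, ⟨hp, hp1⟩, hpt⟩ := hV.1 hn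
    refine hg (K i) i (hKfin i) p (wordMaps_mono_right _ (Nat.sub_le i n) hp) hp1 ?_
    simp only at hpt
    exact hpt ▸ hKmono hi (htK n)
  · refine ⟨n + 1, fun a ha b hb => ?_⟩
    obtain ⟨i, hi, ha⟩ := hV.1 ha
    obtain ⟨k, hk, hb⟩ := hV.1 hb
    refine hV.2 ?_
    rcases lt_trichotomy i k with hik | rfl | hik
    · refine ⟨k, by omega, ?_⟩
      rw [show k - n = k - (n + 1) + 1 by omega]
      exact (hKP (hPK hik (Nat.sub_le _ _) ha) hb).1
    · refine ⟨i, by omega, ?_⟩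
      rw [show i - n = i - (n + 1) + 1 by omega]
      exact hPP ha hb
    · refine ⟨i, by omega, ?_⟩
      rw [show i - n = i - (n + 1) + 1 by omega]
      exact (hKP (hPK hik (Nat.sub_le _ _) hb) ha).2
  · obtain ⟨m, rfl⟩ := ht a
    refine ⟨max (n + 1) m, fun b hb => ?_⟩
    obtain ⟨i, hi, hb⟩ := hV.1 hb
    have hin : n + 1 ≤ i := (le_max_left _ _).trans hi
    have hb' := hKP (hKmono ((le_max_right (n + 1) m).trans hi) (htK m)) hb
    have hle : i - max (n + 1) m + 1 ≤ i - n := by omega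
    exact ⟨hV.2 ⟨i, by omega, hPmono i hle hb'.1⟩, hV.2 ⟨i, by omega, hPmono i hle hb'.2⟩⟩

end Words

theorem WellFoundedLT.exists_rec {ι : Type*} {α : Type*} [LT ι] [WellFoundedLT ι]
    (R : ∀ i : ι, (∀ j, j < i → α) → α → Prop) (h : ∀ i g, ∃ a, R i g a) :
    ∃ x : ι → α, ∀ i, R i (fun j _ => x j) (x i) := by
  choose F hF using h
  refine ⟨wellFounded_lt.fix F, fun i => ?_⟩
  conv => arg 3; rw [WellFounded.fix_eq]
  exact hF i _

theorem ProjectivelyTzSClosed.exists_small_cover {X T : Type u} [Semigroup X] [Semigroup T]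
    (hX : ProjectivelyTzSClosed X) {C : Subsemigroup X} (hC : IsIdealSet X (C : Set X)ᶜ)
    (φ : C →ₙ* T) (hφ : Function.Surjective φ) (hT : Cardinal.aleph0 < Cardinal.mk T) :
    ∃ K : Set T, Cardinal.mk K < Cardinal.mk T ∧
      ∀ x, ∃ L, ∃ p ∈ wordMaps K L, 1 ≤ p.1 ∧ p.2 x ∈ K := by
  by_contra! hcon
  let ι := (Cardinal.mk T).ord.ToType
  have hι : Cardinal.mk ι = Cardinal.mk T := Cardinal.mk_ord_toType _
  obtain ⟨e⟩ := Cardinal.eq.1 hι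
  have : Nonempty ι := Cardinal.mk_ne_zero_iff.1 (hι ▸ (Cardinal.aleph0_pos.trans hT).ne')
  have hIio : ∀ i : ι, Cardinal.mk (Set.Iio i) < Cardinal.mk T :=
    fun i => (Cardinal.mk_Iio_lt i (by rw [hι, Ordinal.type_toType])).trans_eq hι
  let D : ∀ i : ι, (∀ j, j < i → T) → Set T := fun i g =>
    insert (e i) (e '' Set.Iio i ∪ Set.range fun j : Set.Iio i => g j j.2)
  have hD : ∀ i g, Cardinal.mk (D i g) < Cardinal.mk T := by
    intro i g
    refine Cardinal.mk_insert_le.trans_lt (Cardinal.add_lt_of_lt hT.le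
      ((Cardinal.mk_union_le _ _).trans_lt (Cardinal.add_lt_of_lt hT.le ?_ ?_))
      (Cardinal.one_lt_aleph0.trans hT))
    · exact Cardinal.mk_image_le.trans_lt (hIio i)
    · exact Cardinal.mk_range_le.trans_lt (hIio i)
  obtain ⟨x, hx⟩ := WellFoundedLT.exists_rec
    (fun (i : ι) g a => ∀ L, ∀ p ∈ wordMaps (D i g) L, 1 ≤ p.1 → p.2 a ∉ D i g)
    fun i g => hcon _ (hD i g)
  let K : ι → Set T := fun i => D i fun j _ => x j
  have heK : ∀ {i j}, i ≤ j → e i ∈ K j := by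
    intro i j hij
    rcases hij.eq_or_lt with rfl | hij
    exacts [Set.mem_insert _ _, Or.inr (Or.inl ⟨i, hij, rfl⟩)]
  have hxK : ∀ {i j}, i < j → x i ∈ K j := fun {i j} hij => Or.inr (Or.inr ⟨⟨i, hij⟩, rfl⟩)
  have hKmono : ∀ {i j}, i < j → K i ⊆ K j := by
    rintro i j hij _ (rfl | ⟨k, hk, rfl⟩ | ⟨k, rfl⟩)
    · exact heK hij.le
    · exact heK (le_of_lt (lt_trans hk hij))
    · exact hxK (lt_trans k.2 hij)
  let Q : ι → Set T := fun i => {a | ∃ L, ∃ p ∈ wordMaps (K i) L, 1 ≤ p.1 ∧ p.2 (x i) = a}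
  have hmul : ∀ {i L M p q}, p ∈ wordMaps (K i) L → q ∈ wordMaps (K i) M → 1 ≤ p.1 + q.1 →
      p.2 (x i) * q.2 (x i) ∈ Q i := fun {i L M p q} hp hq hpq =>
    ⟨max L M + 1, _, mul_mem_wordMaps (wordMaps_mono_right _ (le_max_left L M) hp)
      (wordMaps_mono_right _ (le_max_right L M) hq), hpq, rfl⟩
  have hQQ : ∀ {i a b}, a ∈ Q i → b ∈ Q i → a * b ∈ Q i := by
    rintro i _ _ ⟨L, p, hp, hp1, rfl⟩ ⟨M, q, hq, hq1, rfl⟩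
    exact hmul hp hq (by omega)
  have hQlt : ∀ {i k a b}, i < k → a ∈ Q i → b ∈ Q k → a * b ∈ Q k ∧ b * a ∈ Q k := by
    rintro i k _ _ hik ⟨L, p, hp, hp1, rfl⟩ ⟨M, q, hq, hq1, rfl⟩
    have hp' := const_apply_mem_wordMaps (hKmono hik) (hxK hik) hp
    exact ⟨hmul hp' hq (le_add_left hq1), hmul hq hp' (le_add_right hq1)⟩
  let V : ι → Set T := fun n => ⋃ i ≥ n, Q i
  have hV : ∀ {n a}, a ∈ V n ↔ ∃ i ≥ n, a ∈ Q i := by simp [V]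
  refine hX.false_of_filterBasis hC φ hφ V (fun m n hmn a ha => ?_) (fun n => ?_) (fun a => ?_)
    (fun n => ?_) (fun n a => ?_)
  · obtain ⟨i, hi, ha⟩ := hV.1 ha
    exact hV.2 ⟨i, hmn.trans hi, ha⟩
  · exact ⟨x n, hV.2 ⟨n, le_rfl, 0, _, id_mem_wordMaps _ _, le_rfl, rfl⟩⟩
  · obtain ⟨n, rfl⟩ := e.surjective a
    refine ⟨n, fun hn => ?_⟩
    obtain ⟨i, hi, L, p, hp, hp1, hpt⟩ := hV.1 hn
    exact hx i L p hp hp1 (hpt ▸ heK hi)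
  · refine ⟨n, fun a ha b hb => ?_⟩
    obtain ⟨i, hi, ha⟩ := hV.1 ha
    obtain ⟨k, hk, hb⟩ := hV.1 hb
    rcases lt_trichotomy i k with hik | rfl | hik
    · exact hV.2 ⟨k, hk, (hQlt hik ha hb).1⟩
    · exact hV.2 ⟨i, hi, hQQ ha hb⟩
    · exact hV.2 ⟨i, hi, (hQlt hik hb ha).2⟩
  · obtain ⟨m, rfl⟩ := e.surjective a
    refine ⟨max n m, fun b hb => ?_⟩
    obtain ⟨i, hi, L, q, hq, hq1, rfl⟩ := hV.1 hb
    have hin : n ≤ i := (le_max_left _ _).trans hi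
    have hc := const_mem_wordMaps (heK ((le_max_right _ _).trans hi)) L
    exact ⟨hV.2 ⟨i, hin, hmul hc hq (le_add_left hq1)⟩,
      hV.2 ⟨i, hin, hmul hq hc (le_add_right hq1)⟩⟩

section Product

variable {T : Type u} [Semigroup T] {ι : Type u} {G : ι → Type u} [∀ i, Group (G i)]
  (ψ : ∀ i, T →ₙ* G i)

theorem exists_forall_map_eq_inv (hexp : ∀ i, ∃ N, 0 < N ∧ ∀ t, ψ i t ^ N = 1)
    (hclosed : ∀ (s : ℕ → T) (p : ∀ i, G i),
      (∀ i, ∀ᶠ n in Filter.atTop, ψ i (s n) = p i) → ∃ t, ∀ i, ψ i t = p i) (y : T) :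
    ∃ t, ∀ i, ψ i t = (ψ i y)⁻¹ := by
  refine hclosed (fun n => spow y ((n + 2).factorial - 2)) _ fun i => ?_
  obtain ⟨N, hN, hy⟩ := hexp i
  filter_upwards [Filter.eventually_ge_atTop N] with n hn
  have h2 : 2 ≤ (n + 2).factorial := (Nat.le_add_left 2 n).trans (Nat.self_le_factorial _)
  obtain ⟨c, hc⟩ := Nat.dvd_factorial hN (show N ≤ n + 2 by omega)
  rw [map_spow, eq_inv_iff_mul_eq_one, ← pow_succ,
    show (n + 2).factorial - 2 + 1 + 1 = (n + 2).factorial by omega, hc, pow_mul, hy, one_pow]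

theorem false_of_small_cover [Countable ι] (hexp : ∀ i, ∃ N, 0 < N ∧ ∀ t, ψ i t ^ N = 1)
    (hclosed : ∀ (s : ℕ → T) (p : ∀ i, G i),
      (∀ i, ∀ᶠ n in Filter.atTop, ψ i (s n) = p i) → ∃ t, ∀ i, ψ i t = p i)
    {K : Set T} (hK : Cardinal.mk K < Cardinal.continuum)
    (hcover : ∀ x, ∃ L, ∃ p ∈ wordMaps K L, 1 ≤ p.1 ∧ p.2 x ∈ K)
    (hunb : ∀ n, 0 < n → ∃ i x y, ∃ z : G i, (∀ t, Commute z (ψ i t)) ∧ ψ i x = z * ψ i y ∧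
      z ^ n ≠ 1) : False := by
  have hinv := exists_forall_map_eq_inv ψ hexp hclosed
  obtain ⟨i₀, x₀, -⟩ := hunb 1 one_pos
  obtain ⟨o, ho⟩ : ∃ o, ∀ i, ψ i o = 1 := by
    obtain ⟨y, hy⟩ := hinv x₀
    exact ⟨x₀ * y, fun i => by rw [map_mul, hy, mul_inv_cancel]⟩
  have hstep : ∀ (J : Finset ι) (m : ℕ), ∃ i t, (∀ j ∈ J, ψ j t = 1) ∧
      (∀ s, Commute (ψ i t) (ψ i s)) ∧ ψ i t ^ (m + 1).factorial ≠ 1 := by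
    intro J m
    choose N hN hψN using hexp
    have hc : 0 < ∏ j ∈ J, N j := Finset.prod_pos fun j _ => hN j
    obtain ⟨i, x, y, z, hz, hxy, hzn⟩ :=
      hunb ((∏ j ∈ J, N j) * (m + 1).factorial) (Nat.mul_pos hc (Nat.factorial_pos _))
    obtain ⟨y', hy'⟩ := hinv y
    have hcs : (∏ j ∈ J, N j) - 1 + 1 = ∏ j ∈ J, N j := Nat.sub_add_cancel hc
    have ht : ψ i (spow (x * y') ((∏ j ∈ J, N j) - 1)) = z ^ ∏ j ∈ J, N j := by
      rw [map_spow, hcs, map_mul, hy', hxy, mul_inv_cancel_right]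
    refine ⟨i, spow (x * y') ((∏ j ∈ J, N j) - 1), fun j hj => ?_, fun s => ?_, ?_⟩
    · obtain ⟨c, hc⟩ := Finset.dvd_prod_of_mem N hj
      rw [map_spow, hcs, hc, pow_mul, hψN, one_pow]
    · rw [ht]
      exact (hz s).pow_left _
    · rwa [ht, ← pow_mul]
  choose I τ hτJ hτc hτ using hstep
  have : Nonempty ι := ⟨i₀⟩
  obtain ⟨g, hg⟩ := exists_surjective_nat ι
  classical
  let J : ℕ → Finset ι := fun n => Nat.rec ∅ (fun n Jn => insert (g n) (insert (I Jn n) Jn)) n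
  have hJs : ∀ n, J (n + 1) = insert (g n) (insert (I (J n) n) (J n)) := fun n => rfl
  have hJmono : Monotone J := monotone_nat_of_le_succ fun n => by
    rw [hJs]
    exact (Finset.subset_insert _ _).trans (Finset.subset_insert _ _)
  let r : (ℕ → Bool) → ℕ → T := fun ε n =>
    Nat.rec o (fun n rn => rn * if ε n then τ (J n) n else o) n
  have hrs : ∀ ε n, r ε (n + 1) = r ε n * if ε n then τ (J n) n else o := fun ε n => rfl
  have hrconst : ∀ ε i m, i ∈ J m → ∀ n ≥ m, ψ i (r ε n) = ψ i (r ε m) := by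
    intro ε i m hi n hn
    induction n, hn using Nat.le_induction with
    | base => rfl
    | succ n hn ih =>
      rw [hrs, map_mul, ih]
      split_ifs
      · rw [hτJ _ _ i (hJmono hn hi), mul_one]
      · rw [ho, mul_one]
  have hmem : ∀ i, ∃ n, i ∈ J n := fun i => by
    obtain ⟨n, rfl⟩ := hg i
    exact ⟨n + 1, by rw [hJs]; exact Finset.mem_insert_self _ _⟩
  choose k hk using hmem
  have hlim : ∀ ε, ∃ t, ∀ i n, i ∈ J n → ψ i t = ψ i (r ε n) := by
    intro ε
    obtain ⟨t, ht⟩ := hclosed (r ε) (fun i => ψ i (r ε (k i))) fun i =>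
      Filter.eventually_atTop.2 ⟨k i, hrconst ε i (k i) (hk i)⟩
    refine ⟨t, fun i n hi => ?_⟩
    rw [ht]
    rcases le_total n (k i) with h | h
    · exact hrconst ε i n hi _ h
    · exact (hrconst ε i _ (hk i) _ h).symm
  choose t ht using hlim
  choose L p hp hp1 hpK using hcover
  -- words of degree at most `m` separate sequences that first differ at the index `m`
  have hsep : ∀ ε δ m, (∀ l < m, ε l = δ l) → ε m = true → δ m = false →
      p (t ε) = p (t δ) → (p (t ε)).2 (t ε) = (p (t δ)).2 (t δ) → m < (p (t ε)).1 := by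
    intro ε δ m hlt hε hδ h1 h2
    have hr : r ε m = r δ m := by
      have : ∀ l ≤ m, r ε l = r δ l := by
        intro l
        induction l with
        | zero => exact fun _ => rfl
        | succ l ih => exact fun hl => by rw [hrs, hrs, ih (by omega), hlt l (by omega)]
      exact this m le_rfl
    have hi : I (J m) m ∈ J (m + 1) := by
      rw [hJs]
      exact Finset.mem_insert_of_mem (Finset.mem_insert_self _ _)
    have hψ : ψ (I (J m) m) (t ε) = ψ _ (τ (J m) m) * ψ _ (t δ) := by
      rw [ht ε _ (m + 1) hi, ht δ _ (m + 1) hi, hrs, hrs, hε, hδ, hr, map_mul, map_mul, if_pos rfl,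
        if_neg (by simp), ho, mul_one]
      exact (hτc _ _ _).eq.symm
    have h3 := map_wordMaps_apply (hp (t ε)) _ (hτc (J m) m) hψ
    rw [h2, ← h1, right_eq_mul] at h3
    by_contra hle
    obtain ⟨c, hc⟩ := Nat.dvd_factorial (hp1 (t ε)) (show (p (t ε)).1 ≤ m + 1 by omega)
    exact hτ (J m) m (by rw [hc, pow_mul, h3, one_pow])
  let W : Set (ℕ × (T → T)) := ⋃ L, wordMaps K L
  let code : (ℕ → Bool) → W × K × List Bool := fun ε =>
    (⟨p (t ε), Set.mem_iUnion.2 ⟨_, hp _⟩⟩, ⟨_, hpK (t ε)⟩, (List.range (p (t ε)).1).map ε)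
  have hcode : Function.Injective code := by
    intro ε δ h
    have h1 : p (t ε) = p (t δ) := congrArg (fun c => (c.1 : ℕ × (T → T))) h
    have h2 : (p (t ε)).2 (t ε) = (p (t δ)).2 (t δ) := congrArg (fun c => (c.2.1 : T)) h
    have h3 : (List.range (p (t ε)).1).map ε = (List.range (p (t δ)).1).map δ :=
      congrArg (fun c => c.2.2) h
    rw [← h1, List.map_inj_left] at h3
    by_contra hne
    have hex : ∃ m, ε m ≠ δ m := Function.ne_iff.1 hne
    have hm := Nat.find_spec hex
    have hmin : ∀ l < Nat.find hex, ε l = δ l := fun l hl => not_not.1 (Nat.find_min hex hl)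
    have hlt : Nat.find hex < (p (t ε)).1 := by
      rcases hε : ε (Nat.find hex) with _ | _ <;> rcases hδ : δ (Nat.find hex) with _ | _
      · exact absurd (hε.trans hδ.symm) hm
      · rw [h1]
        exact hsep δ ε _ (fun l hl => (hmin l hl).symm) hδ hε h1.symm h2.symm
      · exact hsep ε δ _ hmin hε hδ h1 h2
      · exact absurd (hε.trans hδ.symm) hm
    exact hm (h3 _ (List.mem_range.2 hlt))
  have hmax : max (Cardinal.mk K) Cardinal.aleph0 < Cardinal.continuum :=
    max_lt hK Cardinal.aleph0_lt_continuum
  have h0 : Cardinal.aleph0 ≤ max (Cardinal.mk K) Cardinal.aleph0 := le_max_right _ _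
  have hW : Cardinal.mk W ≤ max (Cardinal.mk K) Cardinal.aleph0 := by
    have h1 := Cardinal.mk_iUnion_le_lift (fun L => wordMaps K L)
    rw [Cardinal.lift_id'.{0, u}] at h1
    refine h1.trans (Cardinal.mul_le_of_le h0 ?_ (ciSup_le' fun L => ?_))
    · simp
    · simpa using mk_wordMaps_le K L
  have hcard := Cardinal.lift_mk_le_lift_mk_of_injective hcode
  have h2 : Cardinal.mk (W × K × List Bool) ≤ max (Cardinal.mk K) Cardinal.aleph0 := by
    simp only [Cardinal.mk_prod, Cardinal.lift_uzero, Cardinal.lift_id]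
    exact Cardinal.mul_le_of_le h0 (by simpa using hW)
      (Cardinal.mul_le_of_le h0 (by simp) (by simp))
  have h3 : Cardinal.lift.{u} (Cardinal.mk (ℕ → Bool)) = Cardinal.continuum := by simp
  rw [h3, Cardinal.lift_uzero] at hcard
  exact absurd (hcard.trans h2) (not_le.2 hmax)

end Product

theorem map_polyEval {T : Type*} [Semigroup T] {G : Type*} [Group G] (ψ : T →ₙ* G) {x y : T}
    {z : G} (hz : ∀ t, Commute z (ψ t)) (hxy : ψ x = z * ψ y) (a : WithOne T)
    (l : List (WithOne T)) :
    WithOne.lift ψ (polyEval a l x) = z ^ l.length * WithOne.lift ψ (polyEval a l y) := by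
  have hz' : ∀ b : WithOne T, Commute z (WithOne.lift ψ b) := by
    intro b
    cases b with
    | one => simp
    | coe t => simpa using hz t
  induction l using List.reverseRecOn with
  | nil => simp [polyEval]
  | append_singleton l b ih =>
    simp only [polyEval, List.foldl_append, List.foldl_cons, List.foldl_nil, List.length_append,
      List.length_singleton, map_mul, WithOne.lift_coe] at ih ⊢
    rw [ih, hxy, pow_succ]
    simp only [mul_assoc]
    rw [((hz' _).symm.left_comm _ :)]

theorem Polyfinite.hasBoundedCentralRatios {T : Type u} [Semigroup T] (hT : Polyfinite T) :
    HasBoundedCentralRatios T := by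
  obtain ⟨d, F, hF, h⟩ := hT
  let S := F ×ˢ F
  have : Fintype S := (hF.prod hF).fintype
  let N := Fintype.card S
  refine ⟨((d + 1) ^ (N + 1)).factorial, Nat.factorial_pos _, fun G _ ψ x y z hz hxy => ?_⟩
  have hkey : ∀ s : Fin (N + 1), ∃ (m : ℕ) (q : S), 1 ≤ m ∧ m ≤ d ∧
      ψ q.1.1 = z ^ ((d + 1) ^ (s : ℕ) * m) * ψ q.1.2 := by
    intro s
    have hs : (d + 1) ^ (s : ℕ) ≤ (d + 1) ^ N :=
      Nat.pow_le_pow_right (Nat.succ_pos d) (Nat.lt_succ_iff.1 s.2)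
    obtain ⟨f, m, hmd, ⟨hm, a, l, rfl, hf⟩, ⟨u, hu, hfu⟩, v, hv, hfv⟩ :=
      h (spow x ((d + 1) ^ (s : ℕ)) * spow y ((d + 1) ^ N - (d + 1) ^ (s : ℕ)))
        (spow x 0 * spow y ((d + 1) ^ N - 0))
    have h1 : ψ (spow x ((d + 1) ^ (s : ℕ)) * spow y ((d + 1) ^ N - (d + 1) ^ (s : ℕ))) =
        z ^ (d + 1) ^ (s : ℕ) * ψ (spow x 0 * spow y ((d + 1) ^ N - 0)) := by
      rw [map_spow_mul_spow ψ hz hxy hs, map_spow_mul_spow ψ hz hxy (Nat.zero_le _), ← mul_assoc,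
        ← pow_add, zero_add]
    have h2 := map_polyEval ψ (fun t => (hz t).pow_left _) h1 a l
    rw [← hf, ← hf, hfu, hfv, WithOne.lift_coe, WithOne.lift_coe, ← pow_mul] at h2
    exact ⟨l.length, ⟨(u, v), hu, hv⟩, hm, hmd, h2⟩
  choose m q hm hmd hq using hkey
  obtain ⟨i, j, hij, hqij⟩ : ∃ i j, i < j ∧ q i = q j := by
    obtain ⟨i, j, hne, hq⟩ := Fintype.exists_ne_map_eq_of_card_lt q (by simp [N])
    rcases lt_or_gt_of_ne hne with h | h
    exacts [⟨i, j, h, hq⟩, ⟨j, i, h, hq.symm⟩]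
  have hle : ∀ s : Fin (N + 1), (d + 1) ^ (s : ℕ) * m s < (d + 1) ^ ((s : ℕ) + 1) := fun s => by
    rw [pow_succ]
    exact Nat.mul_lt_mul_of_pos_left (Nat.lt_succ_of_le (hmd s)) (by positivity)
  refine pow_factorial_eq_one (a := (d + 1) ^ (i : ℕ) * m i) (b := (d + 1) ^ (j : ℕ) * m j)
    ?_ ?_ ?_
  · calc _ < (d + 1) ^ ((i : ℕ) + 1) := hle i
      _ ≤ (d + 1) ^ (j : ℕ) := Nat.pow_le_pow_right (Nat.succ_pos d) hij
      _ ≤ _ := Nat.le_mul_of_pos_right _ (hm j)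
  · exact (hle j).le.trans
      (Nat.pow_le_pow_right (Nat.succ_pos d) (Nat.succ_le_succ (Nat.lt_succ_iff.1 j.2)))
  · have h1 := hq i
    rw [hqij, hq j] at h1
    exact (mul_right_cancel h1).symm

/-- Every countable subgroup of an abelian group embeds into a countable divisible group, and
this embedding extends to the whole group. -/
theorem AddSubgroup.exists_countable_extension {Γ : Type u} [AddCommGroup Γ] (D : AddSubgroup Γ)
    [Countable D] : ∃ (E : Type u) (_ : AddCommGroup E) (_ : Countable E) (f : Γ →+ E),
      ∀ x ∈ D, f x = 0 → x = 0 := by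
  let emb : (D →₀ ℤ) →+ (D →₀ ℚ) := Finsupp.mapRange.addMonoidHom (Int.castAddHom ℚ)
  have hemb : Function.Injective emb := Finsupp.mapRange_injective _ rfl Int.cast_injective
  let lin : (D →₀ ℤ) →+ D := Finsupp.liftAddHom fun d => zmultiplesHom D d
  have hlin : ∀ d : D, lin (Finsupp.single d 1) = d := by simp [lin]
  let N : AddSubgroup (D →₀ ℚ) := lin.ker.map emb
  have hN : ∀ a, QuotientAddGroup.mk' N (emb a) = 0 ↔ lin a = 0 := by
    intro a
    rw [← AddMonoidHom.mem_ker, QuotientAddGroup.ker_mk']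
    exact (AddSubgroup.mem_map_iff_mem hemb).trans AddMonoidHom.mem_ker
  let E := (D →₀ ℚ) ⧸ N
  let g : D →+ E := AddMonoidHom.mk' (fun d => QuotientAddGroup.mk' N (emb (Finsupp.single d 1)))
    fun a b => by
      rw [← sub_eq_zero, ← map_add, ← map_add, ← map_sub, ← map_sub, hN, map_sub, map_add, hlin,
        hlin, hlin, sub_self]
  have : DivisibleBy (D →₀ ℚ) ℤ :=
    { div := fun a n => (n : ℚ)⁻¹ • a
      div_zero := fun a => by simp
      div_cancel := fun {n} a hn => by
        rw [← Int.cast_smul_eq_zsmul ℚ, smul_inv_smul₀ (Int.cast_ne_zero.2 hn)] }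
  have : DivisibleBy E ℤ := (QuotientAddGroup.mk'_surjective N).divisibleBy _
    fun a n => map_zsmul _ _ _
  obtain ⟨f, hf⟩ := (Module.Baer.of_divisible E).extension_property_addMonoidHom D.subtype
    D.subtype_injective g
  refine ⟨E, inferInstance, (QuotientAddGroup.mk'_surjective N).countable, f, fun x hx hfx => ?_⟩
  have h1 : g ⟨x, hx⟩ = 0 := by
    rw [← hf]
    exact hfx
  have h2 := (hN _).1 h1
  rw [hlin] at h2
  exact congrArg Subtype.val h2

theorem Subgroup.exists_countable_extension {Γ : Type u} [CommGroup Γ] (D : Subgroup Γ)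
    [Countable D] : ∃ (E : Type u) (_ : CommGroup E) (_ : Countable E) (f : Γ →* E),
      ∀ x ∈ D, f x = 1 → x = 1 := by
  have : Countable D.toAddSubgroup := ‹Countable D›
  obtain ⟨E, _, _, f, hf⟩ := AddSubgroup.exists_countable_extension D.toAddSubgroup
  exact ⟨Multiplicative E, inferInstance, ‹Countable E›, AddMonoidHom.toMultiplicativeRight f, hf⟩

theorem ProjectivelyTzSClosed.hasBoundedCentralRatios {X T : Type u} [Semigroup X] [Semigroup T]
    (hX : ProjectivelyTzSClosed X) {C : Subsemigroup X} (hC : IsIdealSet X (C : Set X)ᶜ)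
    (φ : C →ₙ* T) (hφ : Function.Surjective φ) [Countable T] : HasBoundedCentralRatios T := by
  obtain ⟨K, L, hK, h⟩ := hX.exists_finite_cover hC φ hφ
  exact hasBoundedCentralRatios_of_cover hK L h

open scoped IsMulCommutative in
theorem ProjectivelyTzSClosed.exists_pow_eq_one_of_commute {X : Type u} [Semigroup X]
    (hX : ProjectivelyTzSClosed X) {C : Subsemigroup X} (hC : IsIdealSet X (C : Set X)ᶜ)
    {P : Type u} [Group P] (φ : C →ₙ* P) (hcomm : ∀ x y, φ x * φ y = φ y * φ x)
    (x y : ℕ → C) : ∃ n, 0 < n ∧ ∀ k, (φ (x k) * (φ (y k))⁻¹) ^ n = 1 := by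
  let Γ := Subgroup.closure (Set.range φ)
  have hΓ : IsMulCommutative Γ := Subgroup.isMulCommutative_closure (by
    rintro _ ⟨a, rfl⟩ _ ⟨b, rfl⟩
    exact hcomm a b)
  let φ' : C →ₙ* Γ :=
    { toFun := fun c => ⟨φ c, Subgroup.subset_closure ⟨c, rfl⟩⟩
      map_mul' := fun a b => Subtype.ext (map_mul φ a b) }
  let D : Subgroup Γ := (FreeGroup.lift fun k => φ' (x k) * (φ' (y k))⁻¹).range
  have : Countable D := (MonoidHom.rangeRestrict_surjective _).countable
  obtain ⟨E, _, _, f, hf⟩ := D.exists_countable_extension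
  let g : C →ₙ* E := (f : Γ →ₙ* E).comp φ'
  obtain ⟨n, hn, h⟩ := hX.hasBoundedCentralRatios hC g.srangeRestrict g.srangeRestrict_surjective
  refine ⟨n, hn, fun k => ?_⟩
  have h1 := h E (MulMemClass.subtype g.srange) (g.srangeRestrict (x k)) (g.srangeRestrict (y k))
    (g (x k) * (g (y k))⁻¹) (fun t => Commute.all _ _) (inv_mul_cancel_right _ _).symm
  have h2 : f ((φ' (x k) * (φ' (y k))⁻¹) ^ n) = 1 := by
    rw [map_pow, map_mul, map_inv]
    exact h1
  exact congrArg Subtype.val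
    (hf _ (pow_mem (⟨FreeGroup.of k, FreeGroup.lift_apply_of⟩ : _ ∈ D) n) h2)

theorem exists_group_of_mem_idemSet {X : Type u} [Semigroup X] {e : X} (he : e ∈ idemSet X) :
    ∃ (G : Type u) (_ : Group G) (j : G →ₙ* X),
      Function.Injective j ∧ Set.range j = maxSubgroup X e := by
  have hmul : ∀ {a b}, a ∈ maxSubgroup X e → b ∈ maxSubgroup X e → a * b ∈ maxSubgroup X e := by
    rintro a b ⟨ha, ha', c, hc, hc', hac, hca⟩ ⟨hb, hb', d, hd, hd', hbd, hdb⟩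
    refine ⟨by rw [mul_assoc, hb], by rw [← mul_assoc, ha'], d * c, by rw [mul_assoc, hc],
      by rw [← mul_assoc, hd'], ?_, ?_⟩
    · rw [mul_assoc, ← mul_assoc b, hbd, hc', hac]
    · rw [mul_assoc, ← mul_assoc c, hca, hb', hdb]
  have hinv : ∀ a : maxSubgroup X e, ∃ b ∈ maxSubgroup X e, b * a = e := by
    rintro ⟨a, ha, ha', c, hc, hc', hac, hca⟩
    exact ⟨c, ⟨hc, hc', a, ha, ha', hca, hac⟩, hca⟩
  choose inv hinvmem hinv using hinv
  let _ : Mul (maxSubgroup X e) := ⟨fun a b => ⟨a * b, hmul a.2 b.2⟩⟩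
  let _ : One (maxSubgroup X e) := ⟨⟨e, he, he, e, he, he, he, he⟩⟩
  let _ : Inv (maxSubgroup X e) := ⟨fun a => ⟨inv a, hinvmem a⟩⟩
  let _ : Group (maxSubgroup X e) := Group.ofLeftAxioms
    (fun a b c => Subtype.ext (mul_assoc (a : X) b c)) (fun a => Subtype.ext a.2.2.1)
    (fun a => Subtype.ext (hinv a))
  exact ⟨maxSubgroup X e, inferInstance, ⟨Subtype.val, fun _ _ => rfl⟩, Subtype.val_injective,
    Subtype.range_val⟩

theorem MulHom.exists_lift_of_injective {T G X : Type*} [Semigroup T] [Semigroup G] [Semigroup X]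
    (j : G →ₙ* X) (hj : Function.Injective j) (f : T →ₙ* X) (hf : ∀ t, f t ∈ Set.range j) :
    ∃ ψ : T →ₙ* G, ∀ t, j (ψ t) = f t := by
  choose ψ hψ using hf
  exact ⟨⟨ψ, fun a b => hj (by simp only [map_mul, hψ])⟩, hψ⟩

section Translation

variable {X : Type u} [Semigroup X] {A : Set X} {C : Subsemigroup X}

theorem isIdealSet_compl_of_viable (hA : A ⊆ viableIdems X)
    (hC : (C : Set X) = ⋂ e ∈ A, HeCoideal X e) : IsIdealSet X (C : Set X)ᶜ := by
  intro x hx y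
  rw [hC] at hx ⊢
  simp only [Set.mem_compl_iff, Set.mem_iInter, not_forall] at hx ⊢
  obtain ⟨e, he, hxe⟩ := hx
  obtain ⟨h1, h2⟩ := (hA he).2 x ⟨trivial, hxe⟩ y
  exact ⟨⟨e, he, h1.2⟩, ⟨e, he, h2.2⟩⟩

theorem map_one_of_range_eq {G : Type*} [Group G] {j : G →ₙ* X} {e : X} (he : e ∈ idemSet X)
    (hinj : Function.Injective j) (hrange : Set.range j = maxSubgroup X e) : j 1 = e := by
  obtain ⟨u, hu⟩ : e ∈ Set.range j := hrange ▸ ⟨he, he, e, he, he, he, he⟩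
  have : u * u = u := hinj (by rw [map_mul, hu]; exact he)
  rwa [mul_eq_left.1 this] at hu

theorem spow_map_mem_idemSet_iff {G : Type*} [Group G] {j : G →ₙ* X} (hinj : Function.Injective j)
    (g : G) (n : ℕ) : spow (j g) n ∈ idemSet X ↔ g ^ (n + 1) = 1 := by
  have h : ∀ n, spow (j g) n = j (g ^ (n + 1)) := by
    intro n
    induction n with
    | zero => simp [spow]
    | succ n ih => rw [spow, ih, ← map_mul, ← pow_succ]
  rw [h, idemSet, Set.mem_ofPred_eq, ← map_mul, hinj.eq_iff, mul_eq_left]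

variable {G : A → Type u} [∀ e, Group (G e)] {j : ∀ e, G e →ₙ* X} {ψ : ∀ e, C →ₙ* G e}

theorem centrobounded_of_exists_pow_eq_one (hA : A ⊆ viableIdems X)
    (hC : (C : Set X) = ⋂ e ∈ A, HeCoideal X e) (hinj : ∀ e, Function.Injective (j e))
    (hrange : ∀ e, Set.range (j e) = maxSubgroup X e)
    (hψ : ∀ e x, j e (ψ e x) = (x : X) * e)
    (h : ∃ n, 0 < n ∧ ∀ e x y, (∀ t, Commute (ψ e x * (ψ e y)⁻¹) (ψ e t)) →
      (ψ e x * (ψ e y)⁻¹) ^ n = 1) : Centrobounded A := by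
  obtain ⟨n, hn, h⟩ := h
  refine ⟨n - 1, fun e he x hx y hy w hw hyw _ _ hcen => ?_⟩
  rw [← hC] at hx hy
  lift e to A using he
  lift x to C using hx
  lift y to C using hy
  have h1 := map_one_of_range_eq (hA e.2).1 (hinj e) (hrange e)
  obtain ⟨v, rfl⟩ : w ∈ Set.range (j e) := hrange e ▸ hw
  have hv : (ψ e y)⁻¹ = v := inv_eq_of_mul_eq_one_right (hinj e (by rw [map_mul, hψ, hyw, h1]))
  subst hv
  rw [← hψ, ← map_mul] at hcen ⊢
  rw [spow_map_mem_idemSet_iff (hinj e), Nat.sub_add_cancel hn]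
  refine h e x y fun t => hinj e ?_
  exact (map_mul (j e) _ _).trans ((hcen _).trans (map_mul (j e) _ _).symm)

theorem centrobounded_of_hasBoundedCentralRatios {T : Type u} [Semigroup T]
    (hT : HasBoundedCentralRatios T) (φ : C →ₙ* T) (hφ : Function.Surjective φ)
    (θ : ∀ e, T →ₙ* G e) (hA : A ⊆ viableIdems X)
    (hC : (C : Set X) = ⋂ e ∈ A, HeCoideal X e) (hinj : ∀ e, Function.Injective (j e))
    (hrange : ∀ e, Set.range (j e) = maxSubgroup X e)
    (hθ : ∀ e x, j e (θ e (φ x)) = (x : X) * e) : Centrobounded A := by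
  obtain ⟨n, hn, h⟩ := hT
  exact centrobounded_of_exists_pow_eq_one (ψ := fun e => (θ e).comp φ) hA hC hinj hrange hθ
    ⟨n, hn, fun e x y hxy => h (G e) (θ e) (φ x) (φ y) _ (hφ.forall.2 hxy)
      (inv_mul_cancel_right _ _).symm⟩

end Translation

theorem hasClopenBasis_pi {ι : Type*} (Y : ι → Type*) [∀ i, TopologicalSpace (Y i)]
    [∀ i, DiscreteTopology (Y i)] : HasClopenBasis (∀ i, Y i) := by
  refine ⟨_, ?_, isTopologicalBasis_pi fun i => isTopologicalBasis_singletons (Y i)⟩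
  rintro _ ⟨U, F, -, rfl⟩
  exact ⟨isClosed_set_pi fun i _ => isClosed_discrete _,
    isOpen_set_pi F.finite_toSet fun i _ => isOpen_discrete _⟩

/-- In an absolutely `TzS`-closed semigroup, pointwise eventually constant sequences in products
of groups converge inside the image. -/
theorem AbsolutelyTzSClosed.exists_forall_eq_of_eventually {X : Type u} [Semigroup X]
    (hX : AbsolutelyTzSClosed X) {C : Subsemigroup X} (hC : IsIdealSet X (C : Set X)ᶜ)
    {ι : Type u} {G : ι → Type u} [∀ i, Group (G i)] (ψ : ∀ i, C →ₙ* G i) (s : ℕ → C)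
    (p : ∀ i, G i) (hs : ∀ i, ∀ᶠ n in Filter.atTop, ψ i (s n) = p i) :
    ∃ t, ∀ i, ψ i t = p i := by
  rcases isEmpty_or_nonempty ι with hι | ⟨⟨i₀⟩⟩
  · exact ⟨s 0, fun i => hι.elim i⟩
  let _ (i : ι) : TopologicalSpace (WithZero (G i)) := ⊥
  have (i : ι) : DiscreteTopology (WithZero (G i)) := ⟨rfl⟩
  let f : X →ₙ* ∀ i, WithZero (G i) :=
    { toFun := fun x i => extendZero C hC (ψ i) x
      map_mul' := fun x y => funext fun i => map_mul _ x y }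
  have hf : ∀ (x : C) i, f x i = (ψ i x : WithZero (G i)) :=
    fun x i => extendZero_of_mem hC (ψ i) x
  have hmem : (fun i => (p i : WithZero (G i))) ∈ Set.range f := by
    refine (hX _ (hasClopenBasis_pi _) f).mem_of_tendsto (f := fun n => f (s n))
      (b := Filter.atTop) (tendsto_pi_nhds.2 fun i => ?_)
      (Filter.Eventually.of_forall fun n => ⟨_, rfl⟩)
    refine tendsto_nhds_of_eventually_eq ?_
    filter_upwards [hs i] with n hn
    rw [hf, hn]
  obtain ⟨x, hx⟩ := hmem
  have hxC : x ∈ C := by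
    by_contra hxC
    have := congrFun hx i₀
    exact WithZero.coe_ne_zero (this.symm.trans (extendZero_of_notMem hC (ψ i₀) hxC))
  exact ⟨⟨x, hxC⟩, fun i => WithZero.coe_injective ((hf ⟨x, hxC⟩ i).symm.trans (congrFun hx i))⟩

theorem AbsolutelyTzSClosed.centrobounded {X : Type u} [Semigroup X]
    (hX : AbsolutelyTzSClosed X) {A : Set X} (hA : A ⊆ viableIdems X) (hAcount : A.Countable)
    {C : Subsemigroup X} (hC : (C : Set X) = ⋂ e ∈ A, HeCoideal X e) {T : Type u} [Semigroup T]
    (hTc : Cardinal.mk T ≤ Cardinal.continuum) (φ : C →ₙ* T) (hφ : Function.Surjective φ)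
    {G : A → Type u} [∀ e, Group (G e)] {j : ∀ e, G e →ₙ* X} (θ : ∀ e, T →ₙ* G e)
    (hinj : ∀ e, Function.Injective (j e)) (hrange : ∀ e, Set.range (j e) = maxSubgroup X e)
    (hθ : ∀ e x, j e (θ e (φ x)) = (x : X) * e)
    (hbd : ∀ e ∈ A, ∃ n : ℕ, ∀ x ∈ (C : Set X), spow (x * e) n ∈ idemSet X) :
    Centrobounded A := by
  have hCI := isIdealSet_compl_of_viable hA hC
  by_cases hT : Countable T
  · exact centrobounded_of_hasBoundedCentralRatios
      (hX.projectively.hasBoundedCentralRatios hCI φ hφ) φ hφ θ hA hC hinj hrange hθ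
  obtain ⟨K, hK, hcover⟩ := hX.projectively.exists_small_cover hCI φ hφ
    (not_le.1 fun h => hT (Cardinal.mk_le_aleph0_iff.1 h))
  by_contra hcon
  have : Countable A := hAcount
  refine false_of_small_cover θ (fun e => ?_) (fun s p hs => ?_) (hK.trans_le hTc) hcover
    fun n hn => ?_
  · obtain ⟨n, hn⟩ := hbd e e.2
    refine ⟨n + 1, Nat.succ_pos n, hφ.forall.2 fun x => ?_⟩
    rw [← spow_map_mem_idemSet_iff (hinj e), hθ]
    exact hn x x.2
  · choose σ hσ using hφ
    obtain ⟨t, ht⟩ := hX.exists_forall_eq_of_eventually hCI (fun e => (θ e).comp φ)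
      (fun n => σ (s n)) p (by simpa [hσ] using hs)
    exact ⟨φ t, ht⟩
  · by_contra! hall
    refine hcon (centrobounded_of_exists_pow_eq_one (ψ := fun e => (θ e).comp φ) hA hC hinj
      hrange hθ ⟨n, hn, fun e x y hxy => ?_⟩)
    exact hall e (φ x) (φ y) _ (hφ.forall.2 hxy) (inv_mul_cancel_right _ _).symm
theorem statement18 (X : Type u) [Semigroup X] (A : Set X) (hA : A ⊆ viableIdems X)
    (hAcount : A.Countable) (C : Subsemigroup X)
    (hC : (C : Set X) = ⋂ e ∈ A, HeCoideal X e)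
    (h : ↥C →ₙ* (↥A → X)) (hh : ∀ (x : ↥C) (e : ↥A), h x e = (x : X) * (e : X))
    (hyp :
      (ProjectivelyTzSClosed X ∧ ∀ e ∈ A, ∀ x ∈ (C : Set X), ∀ y ∈ (C : Set X),
          (x * e) * (y * e) = (y * e) * (x * e)) ∨
      Polyfinite ↥h.srange ∨
      (ProjectivelyTzSClosed X ∧ (Set.range ⇑h).Countable) ∨
      (AbsolutelyTzSClosed X ∧ Cardinal.mk ↥(Set.range ⇑h) ≤ Cardinal.continuum ∧
        ∀ e ∈ A, ∃ n : ℕ, ∀ x ∈ (C : Set X), spow (x * e) n ∈ idemSet X)) :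
    Centrobounded A := by
  have hgrp := fun e : A => exists_group_of_mem_idemSet (hA e.2).1
  choose G _ j hinj hrange using hgrp
  have hCI := isIdealSet_compl_of_viable hA hC
  have hθ : ∀ e : A, ∃ θ : h.srange →ₙ* G e, ∀ t, j e (θ t) = (t : A → X) e := by
    intro e
    refine MulHom.exists_lift_of_injective (j e) (hinj e)
      ((Pi.evalMulHom (fun _ => X) e).comp (MulMemClass.subtype h.srange)) ?_
    rintro ⟨_, x, rfl⟩
    have hx : (x : X) ∈ ⋂ e ∈ A, HeCoideal X e := hC ▸ x.2
    have hxe := (Set.mem_iInter₂.1 hx e e.2).2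
    rw [hrange e]
    change h x e ∈ _
    rwa [hh]
  choose θ hθ using hθ
  have hφ := h.srangeRestrict_surjective
  have hθφ : ∀ e x, j e (θ e (h.srangeRestrict x)) = (x : X) * e := fun e x => by
    rw [hθ, ← hh]
    rfl
  rcases hyp with ⟨hX, hcomm⟩ | hpoly | ⟨hX, hcount⟩ | ⟨hX, hcard, hbd⟩
  · let ψ : C →ₙ* ∀ e, G e :=
      { toFun := fun x e => θ e (h.srangeRestrict x)
        map_mul' := fun x y => funext fun e => by rw [map_mul, map_mul]; rfl }
    have hψcomm : ∀ x y, ψ x * ψ y = ψ y * ψ x := fun x y => funext fun e => hinj e (by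
      simp only [Pi.mul_apply, map_mul, ψ, MulHom.coe_mk, hθφ]
      exact hcomm e e.2 x x.2 y y.2)
    by_contra hcon
    have hex : ∀ n : ℕ, ∃ x y, (ψ x * (ψ y)⁻¹) ^ (n + 1) ≠ 1 := by
      by_contra! hall
      obtain ⟨n, hn⟩ := hall
      refine hcon (centrobounded_of_exists_pow_eq_one
        (ψ := fun e => (θ e).comp h.srangeRestrict) hA hC hinj hrange hθφ
        ⟨n + 1, Nat.succ_pos n, fun e x y _ => congrFun (hn x y) e⟩)
    choose x y hxy using hex
    obtain ⟨n, hn, hpow⟩ := hX.exists_pow_eq_one_of_commute hCI ψ hψcomm x y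
    exact hxy (n - 1) (by rw [Nat.sub_add_cancel hn, hpow])
  · exact centrobounded_of_hasBoundedCentralRatios hpoly.hasBoundedCentralRatios
      h.srangeRestrict hφ θ hA hC hinj hrange hθφ
  · have : Countable h.srange := hcount
    exact centrobounded_of_hasBoundedCentralRatios
      (hX.hasBoundedCentralRatios hCI h.srangeRestrict hφ) h.srangeRestrict hφ θ hA hC hinj hrange
      hθφ
  · exact hX.centrobounded hA hAcount hC (T := h.srange) hcard h.srangeRestrict hφ θ hinj hrange
      hθφ hbd
end
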